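/- arXiv:1103.6159 — 2 statements merged into one kernel-verified Lean document; each statement's English description precedes it below -/
import Mathlib

section
/- Let n ∈ ℕ, E a complex Banach space, s ∈ ℝ, 0 < p ≤ ∞, 0 < q ≤ ∞. Let k₀, k⁰ ∈ S(ℝ^n) with k̂₀(0) ≠ 0 and k̂⁰(0) ≠ 0, let N ∈ ℕ₀ with 2N > s, and set k^N := Δ^N k⁰ (the N-fold Laplacian) and k^N_j(x) := 2^{jn} k^N(2^j x). Then there exist constants c₁, c₂ > 0 such that for all f ∈ B^s_{p,q}(E): c₁ ‖f|B^s_{p,q}(E)‖ ≤ ‖k₀ * f|L_p(E)‖ + (Σ_{j≥1} 2^{jsq} ‖k^N_j * f|L_p(E)‖^q)^{1/q} ≤ c₂ ‖f|B^s_{p,q}(E)‖ (supremum over j if q = ∞). Moreover, an f ∈ S'(ℝ^n,E) belongs to B^s_{p,q}(E) if and only if ‖k₀ * f|L_p(E)‖ + (Σ_{j≥1} 2^{jsq} ‖k^N_j * f|L_p(E)‖^q)^{1/q} < ∞. -/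
noncomputable section

open MeasureTheory Filter Metric Real Set SchwartzMap
open scoped ENNReal NNReal Topology FourierTransform

/-- Euclidean space ℝⁿ. -/
abbrev Rn (n : ℕ) : Type := EuclideanSpace ℝ (Fin n)

/-- The Schwartz space 𝓢(ℝⁿ, ℂ). -/
abbrev Sch (n : ℕ) : Type := SchwartzMap (Rn n) ℂ

/-- Partial derivative in the `i`-th coordinate direction. -/
def pd {F : Type*} [NormedAddCommGroup F] [NormedSpace ℝ F] {n : ℕ} (i : Fin n)
    (g : Rn n → F) : Rn n → F :=
  fun x => lineDeriv ℝ g x (EuclideanSpace.single i (1 : ℝ))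

/-- Multi-index derivative `D^α = ∂₁^{α₁} ⋯ ∂ₙ^{αₙ}`. -/
def mderiv {F : Type*} [NormedAddCommGroup F] [NormedSpace ℝ F] {n : ℕ} (α : Fin n → ℕ)
    (g : Rn n → F) : Rn n → F :=
  (List.finRange n).foldr (fun i h => (pd i)^[α i] h) g

/-- The order `|α|` of a multi-index. -/
def mdeg {n : ℕ} (α : Fin n → ℕ) : ℕ := ∑ i, α i

/-- The Schwartz seminorm `‖φ‖_{K,L} = sup_x (1+|x|²)^{K/2} ∑_{|α| ≤ L} |D^α φ(x)|`. -/
def schSemi {n : ℕ} (K L : ℕ) (φ : Sch n) : ℝ :=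
  ⨆ x : Rn n, (1 + ‖x‖ ^ 2) ^ ((K : ℝ) / 2) *
    ∑ α : Fin n → Fin (L + 1), if mdeg (fun i => (α i : ℕ)) ≤ L
      then ‖mderiv (fun i => (α i : ℕ)) (fun y => φ y) x‖ else 0

/-- `E`-valued tempered distributions: linear maps `𝓢(ℝⁿ) → E` bounded by some
Schwartz seminorm. -/
structure TDist (n : ℕ) (E : Type*) [NormedAddCommGroup E] [NormedSpace ℂ E] where
  toFun : Sch n →ₗ[ℂ] E
  bound : ∃ (c : ℝ) (K L : ℕ), ∀ φ : Sch n, ‖toFun φ‖ ≤ c * schSemi K L φ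

namespace Aux

lemma hasTemperateGrowth_sub_left {n : ℕ} (x : Rn n) :
    Function.HasTemperateGrowth (fun y : Rn n => x - y) := by
  apply Function.HasTemperateGrowth.of_fderiv (k := 1) (C := ‖x‖ + 1)
  · have h : (fderiv ℝ (fun y : Rn n => x - y)) =
        fun _ : Rn n => -(ContinuousLinearMap.id ℝ (Rn n)) := by
      ext1 y
      rw [fderiv_const_sub]
      simp
    rw [h]
    exact .const _
  · exact (differentiable_const x).sub differentiable_id
  · intro y
    have h1 : ‖x - y‖ ≤ ‖x‖ + ‖y‖ := norm_sub_le x y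
    have h2 : (0:ℝ) ≤ ‖y‖ := norm_nonneg y
    have h3 : (0:ℝ) ≤ ‖x‖ := norm_nonneg x
    calc ‖x - y‖ ≤ ‖x‖ + ‖y‖ := h1
      _ ≤ (‖x‖ + 1) * (1 + ‖y‖) ^ 1 := by nlinarith

lemma antilipschitz_sub_left {n : ℕ} (x : Rn n) :
    AntilipschitzWith 1 (fun y : Rn n => x - y) := by
  refine (Isometry.antilipschitz ?_)
  intro y z
  simp only [edist_dist, dist_eq_norm, sub_sub_sub_cancel_left, norm_sub_rev]

end Aux

/-- The Schwartz function `y ↦ ψ(x - y)`. -/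
def shiftReflect {n : ℕ} (ψ : Sch n) (x : Rn n) : Sch n :=
  SchwartzMap.compCLMOfAntilipschitz (𝕜 := ℝ)
    (Aux.hasTemperateGrowth_sub_left x) (Aux.antilipschitz_sub_left x) ψ

/-- The dilated Schwartz function `ψ(t ·)` (junk value `0` when `t = 0`). -/
def dilate {n : ℕ} (ψ : Sch n) (t : ℝ) : Sch n :=
  if h : t = 0 then 0 else
    SchwartzMap.compCLM (𝕜 := ℝ) (g := fun y : Rn n => t • y)
      (by
        have := (t • ContinuousLinearMap.id ℝ (Rn n)).hasTemperateGrowth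
        exact this)
      (⟨1, |t|⁻¹, fun y => by
        have ht : 0 < |t| := abs_pos.mpr h
        have : ‖t • y‖ = |t| * ‖y‖ := by rw [norm_smul]; simp [Real.norm_eq_abs]
        rw [pow_one, this]
        rw [mul_add, mul_one]
        have : |t|⁻¹ * (|t| * ‖y‖) = ‖y‖ := by field_simp
        nlinarith [norm_nonneg y, inv_pos.mpr ht]⟩) ψ

/-- Fourier transform on Schwartz space. -/
def fourierS {n : ℕ} (φ : Sch n) : Sch n := FourierTransform.fourierCLE ℂ (Sch n) φ

/-- Inverse Fourier transform on Schwartz space. -/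
def invFourierS {n : ℕ} (φ : Sch n) : Sch n := (FourierTransform.fourierCLE ℂ (Sch n)).symm φ

variable {n : ℕ} {E : Type*} [NormedAddCommGroup E] [NormedSpace ℂ E]

/-- Convolution `(ψ * f)(x) := (2π)^{-n/2} f(ψ(x - ·))` of a Schwartz function with an
`E`-valued tempered distribution. -/
def tdConv (ψ : Sch n) (f : TDist n E) : Rn n → E :=
  fun x => ((2 * π) ^ (-(n : ℝ) / 2) : ℝ) • f.toFun (shiftReflect ψ x)

/-- The operator `f ↦ (φ f̂)ˇ = φ̌ * f`. -/
def mOp (φ : Sch n) (f : TDist n E) : Rn n → E := tdConv (invFourierS φ) f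

/-- `L_p`-norm (in `[0,∞]`) of an `ℝ≥0∞`-valued function. -/
def lpNormENN {n : ℕ} (p : ℝ≥0∞) (g : Rn n → ℝ≥0∞) : ℝ≥0∞ :=
  if p = ∞ then essSup g volume else (∫⁻ x, (g x) ^ p.toReal) ^ (1 / p.toReal)

/-- `ℓ_q`-norm (in `[0,∞]`) of a sequence, with the usual modification for `q = ∞`. -/
def lqSum (q : ℝ≥0∞) (a : ℕ → ℝ≥0∞) : ℝ≥0∞ :=
  if q = ∞ then ⨆ j, a j else (∑' j, (a j) ^ q.toReal) ^ (1 / q.toReal)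

/-- A smooth dyadic resolution of unity. -/
structure SmoothResolution (n : ℕ) (φ : ℕ → Sch n) : Prop where
  supp0 : Function.support (φ 0) ⊆ {ξ : Rn n | ‖ξ‖ ≤ 2}
  suppj : ∀ j : ℕ, 0 < j →
    Function.support (φ j) ⊆ {ξ : Rn n | 2 ^ ((j : ℝ) - 1) ≤ ‖ξ‖ ∧ ‖ξ‖ ≤ 2 ^ ((j : ℝ) + 1)}
  sum_eq : ∀ ξ : Rn n, ∑' j : ℕ, φ j ξ = 1
  deriv_bound : ∀ α : Fin n → ℕ, ∃ c : ℝ, ∀ (j : ℕ) (ξ : Rn n),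
    ‖mderiv α (fun y => φ j y) ξ‖ ≤ c * 2 ^ (-(j : ℝ) * (mdeg α : ℝ))

/-- The Besov quasi-norm `‖f | B^s_{p,q}(E)‖` w.r.t. the resolution of unity `φ`. -/
def besovNorm (s : ℝ) (p q : ℝ≥0∞) (φ : ℕ → Sch n) (f : TDist n E) : ℝ≥0∞ :=
  lqSum q fun j => (2 : ℝ≥0∞) ^ ((j : ℝ) * s) * eLpNorm (mOp (φ j) f) p volume

/-- The Triebel–Lizorkin quasi-norm `‖f | F^s_{p,q}(E)‖` w.r.t. the resolution of unity `φ`. -/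
def triebelNorm (s : ℝ) (p q : ℝ≥0∞) (φ : ℕ → Sch n) (f : TDist n E) : ℝ≥0∞ :=
  lpNormENN p fun x =>
    lqSum q fun j => (2 : ℝ≥0∞) ^ ((j : ℝ) * s) * (‖mOp (φ j) f x‖₊ : ℝ≥0∞)

variable {n : ℕ} {E : Type*} [NormedAddCommGroup E] [NormedSpace ℂ E]

/-- The Laplacian on Schwartz space, `Δφ = ∑ᵢ ∂ᵢ²φ`. -/
def schLap {n : ℕ} (φ : Sch n) : Sch n :=
  ∑ i : Fin n, LineDeriv.lineDerivOpCLM ℝ (Sch n) (EuclideanSpace.single i (1 : ℝ))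
    (LineDeriv.lineDerivOpCLM ℝ (Sch n) (EuclideanSpace.single i (1 : ℝ)) φ)

/-- The local means norm
`‖k₀*f|L_p(E)‖ + (∑_{j≥1} 2^{jsq} ‖k^N_j*f|L_p(E)‖^q)^{1/q}`,
where `k^N_j(x) = 2^{jn} k^N(2^j x)`. -/
def localMeansB (s : ℝ) (p q : ℝ≥0∞) (k0 kN : Sch n) (f : TDist n E) : ℝ≥0∞ :=
  eLpNorm (tdConv k0 f) p volume +
    lqSum q fun j => (2 : ℝ≥0∞) ^ (((j : ℝ) + 1) * s) *
      eLpNorm (tdConv (((2 : ℝ) ^ (((j : ℝ) + 1) * (n : ℝ))) •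
        dilate kN ((2 : ℝ) ^ ((j : ℝ) + 1))) f) p volume

/-- The local means norm
`‖k₀*f|L_p(E)‖ + ‖(∑_{j≥1} 2^{jsq} ‖(k^N_j*f)(·)‖^q)^{1/q}|L_p‖`. -/
def localMeansF (s : ℝ) (p q : ℝ≥0∞) (k0 kN : Sch n) (f : TDist n E) : ℝ≥0∞ :=
  eLpNorm (tdConv k0 f) p volume +
    lpNormENN p fun x => lqSum q fun j => (2 : ℝ≥0∞) ^ (((j : ℝ) + 1) * s) *
      (‖tdConv (((2 : ℝ) ^ (((j : ℝ) + 1) * (n : ℝ))) •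
        dilate kN ((2 : ℝ) ^ ((j : ℝ) + 1))) f x‖₊ : ℝ≥0∞)


namespace LM

open LineDeriv

lemma shiftReflect_apply (ψ : Sch n) (x y : Rn n) : shiftReflect ψ x y = ψ (x - y) := rfl

lemma dilate_apply (ψ : Sch n) {t : ℝ} (ht : t ≠ 0) (y : Rn n) : dilate ψ t y = ψ (t • y) := by
  rw [dilate, dif_neg ht]; rfl

/-- pointwise product of Schwartz functions -/
def mulS (μ ν : Sch n) : Sch n := pairing (ContinuousLinearMap.mul ℂ ℂ) μ ν

@[simp] lemma mulS_apply (μ ν : Sch n) (x : Rn n) : mulS μ ν x = μ x * ν x := by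
  simp [mulS, pairing_apply_apply]

/-- convolution of Schwartz functions -/
def convS (ψ χ : Sch n) : Sch n := SchwartzMap.convolution (ContinuousLinearMap.mul ℂ ℂ) ψ χ

lemma convS_apply (ψ χ : Sch n) (x : Rn n) : convS ψ χ x = ∫ y, ψ y * χ (x - y) := by
  rw [convS, SchwartzMap.convolution_apply]; rfl

lemma convS_inv (μ ν : Sch n) : convS (𝓕⁻ μ) (𝓕⁻ ν) = 𝓕⁻ (mulS μ ν) := by
  have h := SchwartzMap.fourier_convolution (ContinuousLinearMap.mul ℂ ℂ) (𝓕⁻ μ) (𝓕⁻ ν)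
  rw [FourierTransform.fourier_fourierInv_eq, FourierTransform.fourier_fourierInv_eq] at h
  rw [convS, mulS, ← h, FourierTransform.fourierInv_fourier_eq]

/-- A translation invariant, homogeneous operator on Schwartz space. -/
structure GoodOp (D : Sch n → Sch n) (k : ℕ) : Prop where
  add : ∀ φ ψ, D (φ + ψ) = D φ + D ψ
  smul : ∀ (c : ℂ) φ, D (c • φ) = c • D φ
  shift : ∀ ψ x, D (shiftReflect ψ x) = (-1 : ℂ) ^ k • shiftReflect (D ψ) x
  conv : ∀ ψ χ, D (convS ψ χ) = convS ψ (D χ)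
  dil : ∀ ψ (t : ℝ), t ≠ 0 → D (dilate ψ t) = (t : ℂ) ^ k • dilate (D ψ) t

lemma GoodOp.id : GoodOp (id : Sch n → Sch n) 0 := by
  constructor <;> intros <;> simp

lemma shiftReflect_smul (c : ℂ) (ψ : Sch n) (x : Rn n) :
    shiftReflect (c • ψ) x = c • shiftReflect ψ x := by
  ext y; simp [shiftReflect_apply]

lemma dilate_smul (c : ℂ) (ψ : Sch n) {t : ℝ} (ht : t ≠ 0) :
    dilate (c • ψ) t = c • dilate ψ t := by
  ext y; simp [dilate_apply _ ht]

lemma GoodOp.comp {D D' : Sch n → Sch n} {k k' : ℕ} (h : GoodOp D k) (h' : GoodOp D' k') :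
    GoodOp (D ∘ D') (k + k') := by
  constructor
  · intro φ ψ; simp [h.add, h'.add]
  · intro φ ψ; simp [h.smul, h'.smul]
  · intro φ ψ; simp [h.smul, h'.shift, h.shift, smul_smul, pow_add, mul_comm]
  · intro φ ψ; simp [h.conv, h'.conv]
  · intro φ t ht; simp [h.smul, h'.dil _ _ ht, h.dil _ _ ht, smul_smul, pow_add, mul_comm]

lemma GoodOp.iterate {D : Sch n → Sch n} {k : ℕ} (h : GoodOp D k) (m : ℕ) :
    ∃ k', GoodOp (D^[m]) k' := by
  induction m with
  | zero => exact ⟨0, GoodOp.id⟩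
  | succ m ih =>
    obtain ⟨k', hk⟩ := ih
    exact ⟨k' + k, hk.comp h⟩

/-- partial derivative on Schwartz space -/
def pdS (i : Fin n) (φ : Sch n) : Sch n := ∂_{EuclideanSpace.single i (1 : ℝ)} φ

lemma pdS_coe (i : Fin n) (φ : Sch n) : ⇑(pdS i φ) = pd i φ := by
  ext x; exact SchwartzMap.lineDerivOp_apply _ _ _

lemma pdS_apply (i : Fin n) (φ : Sch n) (x : Rn n) :
    pdS i φ x = fderiv ℝ φ x (EuclideanSpace.single i (1 : ℝ)) := rfl

lemma pdS_good (i : Fin n) : GoodOp (pdS (n := n) i) 1 := by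
  constructor
  · intro φ ψ; exact lineDerivOp_add _ _ _
  · intro c φ; exact lineDerivOp_smul _ _ _
  · intro ψ x
    ext y
    rw [pdS_apply]
    have h1 : HasFDerivAt (fun y : Rn n => x - y) (-(ContinuousLinearMap.id ℝ (Rn n))) y := by
      simpa using (hasFDerivAt_id y).const_sub x
    have h2 : HasFDerivAt (shiftReflect ψ x) _ y := (ψ.hasFDerivAt (x - y)).comp y h1
    rw [h2.fderiv]
    simp [shiftReflect_apply, pdS_apply]
  · intro ψ χ
    have h : ∀ φ : Sch n, pdS i φ = 𝓕⁻ (𝓕 (pdS i φ)) := fun φ =>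
      (FourierTransform.fourierInv_fourier_eq _).symm
    have hg : (fun x : Rn n => inner ℝ x (EuclideanSpace.single i (1 : ℝ))).HasTemperateGrowth := by
      fun_prop
    have h2 : ∀ φ : Sch n, φ = 𝓕⁻ (𝓕 φ : Sch n) := fun φ =>
      (FourierTransform.fourierInv_fourier_eq φ).symm
    have e : ∀ μ : Sch n, 𝓕 (pdS i μ) = _ := fun μ => fourier_lineDerivOp_eq μ _
    rw [h, h2 (convS ψ (pdS i χ)), e, convS, convS]
    congr 1
    rw [SchwartzMap.fourier_convolution, SchwartzMap.fourier_convolution, e]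
    ext x
    simp [smulLeftCLM_apply_apply hg, pairing_apply_apply]
    ring
  · intro ψ t ht
    ext y
    rw [pdS_apply]
    have h1 : HasFDerivAt (fun y : Rn n => t • y) (t • (ContinuousLinearMap.id ℝ (Rn n))) y := by
      exact (hasFDerivAt_id y).const_smul t
    have h2 : HasFDerivAt (fun y => ψ (t • y)) _ y :=
      HasFDerivAt.comp y (ψ.hasFDerivAt (t • y)) h1
    have h3 : (dilate ψ t : Rn n → ℂ) = fun y => ψ (t • y) := by
      ext z; exact dilate_apply _ ht z
    rw [h3, h2.fderiv]
    simp [dilate_apply _ ht, pdS_apply]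

/-- multi-index derivative on Schwartz space -/
def mderivS (α : Fin n → ℕ) (φ : Sch n) : Sch n :=
  (List.finRange n).foldr (fun i h => (pdS i)^[α i] h) φ

lemma pdS_iter_coe (i : Fin n) (m : ℕ) (φ : Sch n) : ⇑((pdS i)^[m] φ) = (pd i)^[m] φ := by
  induction m generalizing φ with
  | zero => rfl
  | succ m ih => rw [Function.iterate_succ_apply, Function.iterate_succ_apply, ih, pdS_coe]

lemma mderivS_coe (α : Fin n → ℕ) (φ : Sch n) : ⇑(mderivS α φ) = mderiv α φ := by
  unfold mderivS mderiv
  induction List.finRange n with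
  | nil => rfl
  | cons i l ih => simp only [List.foldr_cons]; rw [pdS_iter_coe, ih]

lemma mderivS_good (α : Fin n → ℕ) : ∃ k, GoodOp (mderivS (n := n) α) k := by
  unfold mderivS
  induction List.finRange n with
  | nil => exact ⟨0, GoodOp.id⟩
  | cons i l ih =>
    obtain ⟨k, hk⟩ := ih
    obtain ⟨k', hk'⟩ := (pdS_good i).iterate (α i)
    exact ⟨k' + k, hk'.comp hk⟩

lemma weight_le (K : ℕ) (z : Rn n) : (1 + ‖z‖ ^ 2) ^ ((K : ℝ) / 2) ≤ (1 + ‖z‖) ^ K := by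
  have h : (1 + ‖z‖ ^ 2) ≤ (1 + ‖z‖) ^ 2 := by nlinarith [norm_nonneg z]
  calc (1 + ‖z‖ ^ 2) ^ ((K : ℝ) / 2) ≤ ((1 + ‖z‖) ^ 2) ^ ((K : ℝ) / 2) := by
        gcongr
    _ = (1 + ‖z‖) ^ K := by
        rw [← Real.rpow_natCast _ 2, ← Real.rpow_mul (by positivity), ← Real.rpow_natCast _ K]
        congr 1; push_cast; ring

lemma decayS (θ : Sch n) (K : ℕ) : ∃ B : ℝ, 0 ≤ B ∧ ∀ z, (1 + ‖z‖) ^ K * ‖θ z‖ ≤ B := by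
  refine ⟨2 ^ K * (Finset.Iic (K, 0)).sup (fun m => SchwartzMap.seminorm ℝ m.1 m.2) θ, by positivity, fun z => ?_⟩
  have := SchwartzMap.one_add_le_sup_seminorm_apply (𝕜 := ℝ) (m := (K, 0)) (le_refl K) (le_refl 0) θ z
  simpa using this

theorem exists_ctl (f : TDist n E) : ∃ (ι : Type) (_ : Fintype ι) (D : ι → Sch n → Sch n)
    (k : ι → ℕ) (K : ℕ) (C : ℝ), (∀ i, GoodOp (D i) (k i)) ∧ (∃ i, D i = id) ∧ 0 ≤ C ∧
    ∀ φ B, 0 ≤ B → (∀ i z, (1 + ‖z‖) ^ K * ‖D i φ z‖ ≤ B) → ‖f.toFun φ‖ ≤ C * B := by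
  obtain ⟨c, K, L, hf⟩ := f.bound
  choose k hk using fun α : Fin n → ℕ => mderivS_good (n := n) α
  refine ⟨Option (Fin n → Fin (L + 1)), inferInstance,
    fun o => o.elim id (fun α => mderivS fun i => (α i : ℕ)),
    fun o => o.elim 0 (fun α => k fun i => (α i : ℕ)), K,
    |c| * Fintype.card (Fin n → Fin (L + 1)), ?_, ⟨none, rfl⟩, by positivity, ?_⟩
  · rintro (_ | α)
    · exact GoodOp.id
    · exact hk _
  · intro φ B hB h
    have hs0 : ∀ x : Rn n, (1 + ‖x‖ ^ 2) ^ ((K : ℝ) / 2) *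
      (∑ α : Fin n → Fin (L + 1), if mdeg (fun i => (α i : ℕ)) ≤ L
      then ‖mderiv (fun i => (α i : ℕ)) (fun y => φ y) x‖ else 0) ≤
        Fintype.card (Fin n → Fin (L + 1)) * B := by
      intro x
      rw [Finset.mul_sum, ← nsmul_eq_mul]
      refine Finset.sum_le_card_nsmul _ _ _ fun α _ => ?_
      split_ifs
      · refine le_trans ?_ (h (some α) x)
        have : ‖mderiv (fun i => (α i : ℕ)) (fun y => φ y) x‖ = ‖mderivS (fun i => (α i : ℕ)) φ x‖ := by
          rw [mderivS_coe]
        rw [this]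
        exact mul_le_mul_of_nonneg_right (weight_le K x) (norm_nonneg _)
      · simpa using hB
    have hs : schSemi K L φ ≤ Fintype.card (Fin n → Fin (L + 1)) * B := ciSup_le hs0
    have hs' : 0 ≤ schSemi K L φ := by
      apply Real.iSup_nonneg
      intro x
      apply mul_nonneg (by positivity)
      exact Finset.sum_nonneg fun α _ => by split_ifs <;> positivity
    calc ‖f.toFun φ‖ ≤ c * schSemi K L φ := hf φ
      _ ≤ |c| * schSemi K L φ := mul_le_mul_of_nonneg_right (le_abs_self c) hs'
      _ ≤ |c| * (Fintype.card (Fin n → Fin (L + 1)) * B) := by gcongr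
      _ = _ := by ring

end LM


namespace LM

open LineDeriv

lemma one_add_le_mul (x z : Rn n) : 1 + ‖z‖ ≤ (1 + ‖x‖) * (1 + ‖x - z‖) := by
  have h : ‖z‖ ≤ ‖x‖ + ‖x - z‖ := by
    have := norm_sub_le x (x - z); simpa using this
  nlinarith [norm_nonneg x, norm_nonneg (x - z), mul_nonneg (norm_nonneg x) (norm_nonneg (x - z))]

lemma one_add_pow_le (K : ℕ) (x z : Rn n) :
    (1 + ‖z‖) ^ K ≤ (1 + ‖x‖) ^ K * (1 + ‖x - z‖) ^ K := by
  rw [← mul_pow]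
  exact pow_le_pow_left₀ (by positivity) (one_add_le_mul x z) K

lemma GoodOp.norm_shift {D : Sch n → Sch n} {k : ℕ} (h : GoodOp D k) (ψ : Sch n) (x z : Rn n) :
    ‖D (shiftReflect ψ x) z‖ = ‖D ψ (x - z)‖ := by
  rw [h.shift]; simp [shiftReflect_apply]

lemma GoodOp.norm_dil {D : Sch n → Sch n} {k : ℕ} (h : GoodOp D k) (ψ : Sch n) {t : ℝ} (ht : 0 < t)
    (z : Rn n) : ‖D (dilate ψ t) z‖ = t ^ k * ‖D ψ (t • z)‖ := by
  rw [h.dil _ _ ht.ne']; simp [dilate_apply _ ht.ne', abs_of_pos ht]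

theorem growth0 (f : TDist n E) : ∃ K M : ℕ, ∀ ψ : Sch n, ∃ C : ℝ, 0 ≤ C ∧ ∀ t : ℝ, 1 ≤ t → ∀ x,
    ‖f.toFun (shiftReflect (dilate ψ t) x)‖ ≤ C * t ^ M * (1 + ‖x‖) ^ K := by
  obtain ⟨ι, _, D, k, K, C, hD, -, hC, hf⟩ := exists_ctl f
  refine ⟨K, ∑ i, k i, fun ψ => ?_⟩
  choose B hB0 hB using fun i => decayS (D i ψ) K
  refine ⟨C * ∑ i, B i, mul_nonneg hC (Finset.sum_nonneg fun i _ => hB0 i), fun t ht x => ?_⟩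
  have ht0 : 0 < t := by linarith
  have := hf (shiftReflect (dilate ψ t) x) ((∑ i, B i) * t ^ (∑ i, k i) * (1 + ‖x‖) ^ K)
    (by have := Finset.sum_nonneg fun i (_ : i ∈ Finset.univ) => hB0 i; positivity) ?_
  · linarith
  · intro i z
    rw [(hD i).norm_shift, (hD i).norm_dil _ ht0]
    have h1 := one_add_pow_le K x z
    have h2 : (1 + ‖x - z‖) ^ K ≤ (1 + ‖t • (x - z)‖) ^ K := by
      rw [norm_smul, Real.norm_eq_abs, abs_of_pos ht0]
      gcongr
      nlinarith [norm_nonneg (x - z)]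
    have h3 := hB i (t • (x - z))
    have h4 : B i ≤ ∑ i, B i := Finset.single_le_sum (fun i _ => hB0 i) (Finset.mem_univ i)
    have h5 : t ^ k i ≤ t ^ (∑ i, k i) :=
      pow_le_pow_right₀ ht (Finset.single_le_sum (f := k) (fun i _ => Nat.zero_le _) (Finset.mem_univ i))
    calc (1 + ‖z‖) ^ K * (t ^ k i * ‖D i ψ (t • (x - z))‖)
        ≤ ((1 + ‖x‖) ^ K * (1 + ‖t • (x - z)‖) ^ K) * (t ^ k i * ‖D i ψ (t • (x - z))‖) := by
          gcongr; exact h1.trans (by gcongr)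
      _ = ((1 + ‖t • (x - z)‖) ^ K * ‖D i ψ (t • (x - z))‖) * t ^ k i * (1 + ‖x‖) ^ K := by ring
      _ ≤ _ := by
        have := h3.trans h4
        have h0 : 0 ≤ ∑ i, B i := (hB0 i).trans h4
        gcongr

lemma lipS (θ : Sch n) (K : ℕ) : ∃ B : ℝ, 0 ≤ B ∧ ∀ x x0 z : Rn n, ‖x - x0‖ ≤ 1 →
    (1 + ‖z‖) ^ K * ‖θ (x - z) - θ (x0 - z)‖ ≤ B * (2 + ‖x0‖) ^ K * ‖x - x0‖ := by
  obtain ⟨B, hB⟩ : ∃ B : ℝ, ∀ v, (1 + ‖v‖) ^ K * ‖fderiv ℝ θ v‖ ≤ B := by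
    refine ⟨2 ^ K * (Finset.Iic (K, 1)).sup (fun m => SchwartzMap.seminorm ℝ m.1 m.2) θ, fun z => ?_⟩
    have := SchwartzMap.one_add_le_sup_seminorm_apply (𝕜 := ℝ) (m := (K, 1)) (le_refl K) (le_refl 1) θ z
    simpa using this
  have hB0 : 0 ≤ B := le_trans (by positivity) (hB 0)
  refine ⟨B, hB0, fun x x0 z hx => ?_⟩
  have hmv : ‖θ (x - z) - θ (x0 - z)‖ ≤ (B * (2 + ‖x0‖) ^ K / (1 + ‖z‖) ^ K) * ‖(x - z) - (x0 - z)‖ := by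
    apply Convex.norm_image_sub_le_of_norm_fderiv_le (𝕜 := ℝ) (s := Metric.closedBall (x0 - z) 1)
    · intro v _; exact θ.differentiableAt
    · intro v hv
      rw [le_div_iff₀ (by positivity)]
      have h1 := one_add_pow_le K (v + z) z
      simp only [add_sub_cancel_right] at h1
      have h2 : 1 + ‖v + z‖ ≤ 2 + ‖x0‖ := by
        have : ‖v + z - x0‖ ≤ 1 := by
          have := mem_closedBall_iff_norm.1 hv
          rwa [sub_sub_eq_add_sub] at this
        have h3 : ‖v + z‖ ≤ ‖v + z - x0‖ + ‖x0‖ := by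
          simpa using norm_add_le (v + z - x0) x0
        linarith
      calc ‖fderiv ℝ θ v‖ * (1 + ‖z‖) ^ K ≤ ‖fderiv ℝ θ v‖ * ((2 + ‖x0‖) ^ K * (1 + ‖v‖) ^ K) := by
            gcongr; exact h1.trans (by gcongr)
        _ = ((1 + ‖v‖) ^ K * ‖fderiv ℝ θ v‖) * (2 + ‖x0‖) ^ K := by ring
        _ ≤ _ := by gcongr; exact hB v
    · exact convex_closedBall _ _
    · simp
    · rw [mem_closedBall_iff_norm]; simpa using hx
  rw [sub_sub_sub_cancel_right] at hmv
  calc _ ≤ (1 + ‖z‖) ^ K * ((B * (2 + ‖x0‖) ^ K / (1 + ‖z‖) ^ K) * ‖x - x0‖) := by gcongr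
    _ = _ := by field_simp

lemma GoodOp.sub {D : Sch n → Sch n} {k : ℕ} (h : GoodOp D k) (φ ψ : Sch n) :
    D (φ - ψ) = D φ - D ψ := by
  have : φ - ψ = φ + (-1 : ℂ) • ψ := by simp [sub_eq_add_neg]
  rw [this, h.add, h.smul]; simp [sub_eq_add_neg]

lemma GoodOp.lip {D : Sch n → Sch n} {k : ℕ} (h : GoodOp D k) (χ : Sch n) (K : ℕ) :
    ∃ B : ℝ, 0 ≤ B ∧ ∀ x x0 z : Rn n, ‖x - x0‖ ≤ 1 →
    (1 + ‖z‖) ^ K * ‖D (shiftReflect χ x - shiftReflect χ x0) z‖ ≤ B * (2 + ‖x0‖) ^ K * ‖x - x0‖ := by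
  obtain ⟨B, hB0, hB⟩ := lipS (D χ) K
  refine ⟨B, hB0, fun x x0 z hx => ?_⟩
  rw [h.sub, h.shift, h.shift, ← smul_sub]
  simpa [shiftReflect_apply] using hB x x0 z hx

theorem toFun_cont (f : TDist n E) (χ : Sch n) : Continuous fun x => f.toFun (shiftReflect χ x) := by
  obtain ⟨ι, _, D, k, K, C, hD, -, hC, hf⟩ := exists_ctl f
  choose B hB0 hB using fun i => (hD i).lip χ K
  rw [continuous_iff_continuousAt]
  intro x0
  rw [ContinuousAt, tendsto_iff_norm_sub_tendsto_zero]
  have hlim : Tendsto (fun x => C * ((∑ i, B i) * (2 + ‖x0‖) ^ K * ‖x - x0‖)) (𝓝 x0) (𝓝 0) := by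
    have : Continuous (fun x => C * ((∑ i, B i) * (2 + ‖x0‖) ^ K * ‖x - x0‖)) := by fun_prop
    simpa using this.tendsto x0
  refine squeeze_zero_norm' ?_ hlim
  filter_upwards [Metric.closedBall_mem_nhds x0 one_pos] with x hx
  rw [norm_norm, ← map_sub]
  have hS := Finset.sum_nonneg fun i (_ : i ∈ Finset.univ) => hB0 i
  refine hf _ _ (by positivity) fun i z => ?_
  refine (hB i x x0 z (mem_closedBall_iff_norm.1 hx)).trans ?_
  gcongr
  exact Finset.single_le_sum (fun i _ => hB0 i) (Finset.mem_univ i)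

lemma integrable_decay (ψ : Sch n) (K : ℕ) : Integrable fun y => (1 + ‖y‖) ^ K * ‖ψ y‖ := by
  have h : ∀ y : Rn n, (1 + ‖y‖) ^ K * ‖ψ y‖ =
      ∑ m ∈ Finset.range (K + 1), (K.choose m : ℝ) * (‖y‖ ^ m * ‖ψ y‖) := by
    intro y
    rw [add_comm, add_pow, Finset.sum_mul]
    refine Finset.sum_congr rfl fun m _ => ?_
    simp; ring
  simp_rw [h]
  exact integrable_finsetSum _ fun m _ => (ψ.integrable_pow_mul volume m).const_mul _

/-- the embedding of Schwartz space into a Banach space -/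
def Jfun {ι : Type} [Fintype ι] (D : ι → Sch n → Sch n) (K : ℕ) (φ : Sch n) :
    BoundedContinuousFunction (Rn n) (ι → ℂ) :=
  BoundedContinuousFunction.ofNormedAddCommGroup
    (fun z i => (((1 + ‖z‖) ^ K : ℝ) : ℂ) * D i φ z)
    (by
      refine continuous_pi fun i => ?_
      have := (D i φ).continuous
      fun_prop)
    (∑ i, (decayS (D i φ) K).choose)
    (by
      intro z
      have h0 := Finset.sum_nonneg fun i (_ : i ∈ Finset.univ) => (decayS (D i φ) K).choose_spec.1
      rw [pi_norm_le_iff_of_nonneg h0]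
      intro i
      have := (decayS (D i φ) K).choose_spec.2 z
      rw [norm_mul, Complex.norm_real, Real.norm_of_nonneg (by positivity)]
      refine this.trans ?_
      exact Finset.single_le_sum (f := fun i => (decayS (D i φ) K).choose)
        (fun i _ => (decayS (D i φ) K).choose_spec.1) (Finset.mem_univ i))

lemma Jfun_apply {ι : Type} [Fintype ι] (D : ι → Sch n → Sch n) (K : ℕ) (φ : Sch n) (z : Rn n)
    (i : ι) : Jfun D K φ z i = (((1 + ‖z‖) ^ K : ℝ) : ℂ) * D i φ z := rfl

lemma norm_Jfun_apply {ι : Type} [Fintype ι] (D : ι → Sch n → Sch n) (K : ℕ) (φ : Sch n) (z : Rn n)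
    (i : ι) : ‖Jfun D K φ z i‖ = (1 + ‖z‖) ^ K * ‖D i φ z‖ := by
  rw [Jfun_apply, norm_mul, Complex.norm_real, Real.norm_of_nonneg (by positivity)]

lemma norm_Jfun_le {ι : Type} [Fintype ι] (D : ι → Sch n → Sch n) (K : ℕ) (φ : Sch n) {B : ℝ}
    (hB : 0 ≤ B) (h : ∀ i z, (1 + ‖z‖) ^ K * ‖D i φ z‖ ≤ B) : ‖Jfun D K φ‖ ≤ B := by
  rw [BoundedContinuousFunction.norm_le hB]
  intro z
  rw [pi_norm_le_iff_of_nonneg hB]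
  intro i
  rw [norm_Jfun_apply]; exact h i z

lemma le_norm_Jfun {ι : Type} [Fintype ι] (D : ι → Sch n → Sch n) (K : ℕ) (φ : Sch n) (i : ι)
    (z : Rn n) : (1 + ‖z‖) ^ K * ‖D i φ z‖ ≤ ‖Jfun D K φ‖ := by
  rw [← norm_Jfun_apply]
  exact (norm_le_pi_norm _ i).trans ((Jfun D K φ).norm_coe_le_norm z)

/-- linear version -/
def Jlin {ι : Type} [Fintype ι] (D : ι → Sch n → Sch n) {k : ι → ℕ} (hD : ∀ i, GoodOp (D i) (k i))
    (K : ℕ) : Sch n →ₗ[ℂ] BoundedContinuousFunction (Rn n) (ι → ℂ) where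
  toFun := Jfun D K
  map_add' φ ψ := by
    ext z i
    simp [Jfun_apply, (hD i).add, mul_add]
  map_smul' c φ := by
    ext z i
    simp [Jfun_apply, (hD i).smul]; ring

theorem toFun_conv [CompleteSpace E] (f : TDist n E) (ψ χ : Sch n) (x : Rn n) :
    f.toFun (shiftReflect (convS ψ χ) x) = ∫ y, ψ y • f.toFun (shiftReflect χ (x - y)) := by
  obtain ⟨ι, _, D, k, K, C, hD, ⟨i0, hi0⟩, hC, hf⟩ := exists_ctl f
  let J := Jlin D hD K
  have hJ : ∀ φ, J φ = Jfun D K φ := fun _ => rfl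
  have hfJ : ∀ φ, ‖f.toFun φ‖ ≤ C * ‖J φ‖ := fun φ =>
    hf φ _ (norm_nonneg _) fun i z => le_norm_Jfun D K φ i z
  have hinj : Function.Injective J := by
    intro φ φ' h
    ext z
    have h1 : J φ z i0 = J φ' z i0 := by rw [h]
    rw [hJ, hJ, Jfun_apply, Jfun_apply, hi0] at h1
    have : (((1 + ‖z‖) ^ K : ℝ) : ℂ) ≠ 0 := by
      rw [Complex.ofReal_ne_zero]; positivity
    exact mul_left_cancel₀ this h1
  -- Hahn--Banach
  have hHB : ∀ l : StrongDual ℂ E, ∃ g : StrongDual ℂ (BoundedContinuousFunction (Rn n) (ι → ℂ)),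
      ∀ φ, g (J φ) = l (f.toFun φ) := by
    intro l
    let e := LinearEquiv.ofInjective J hinj
    let e1 : LinearMap.range J →ₗ[ℂ] Sch n := e.symm
    let g1 : LinearMap.range J →ₗ[ℂ] ℂ := (l : E →ₗ[ℂ] ℂ) ∘ₗ f.toFun ∘ₗ e1
    have hb : ∀ v : LinearMap.range J, ‖g1 v‖ ≤ ‖l‖ * C * ‖v‖ := by
      intro v
      obtain ⟨φ, rfl⟩ := e.surjective v
      have : g1 (e φ) = l (f.toFun φ) := by simp [g1, e1]
      rw [this]
      calc ‖l (f.toFun φ)‖ ≤ ‖l‖ * ‖f.toFun φ‖ := l.le_opNorm _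
        _ ≤ ‖l‖ * (C * ‖J φ‖) := by gcongr; exact hfJ φ
        _ = ‖l‖ * C * ‖J φ‖ := by ring
    let p : Submodule ℂ (BoundedContinuousFunction (Rn n) (ι → ℂ)) := LinearMap.range J
    let g0 : p →L[ℂ] ℂ := LinearMap.mkContinuous (E := p) (F := ℂ) (σ := RingHom.id ℂ) g1 (‖l‖ * C) hb
    obtain ⟨g, hg, -⟩ := exists_extension_norm_eq (LinearMap.range J) g0
    refine ⟨g, fun φ => ?_⟩
    have := hg (e φ)
    rw [show ((e φ : LinearMap.range J) : BoundedContinuousFunction (Rn n) (ι → ℂ)) = J φ from rfl] at this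
    rw [this]
    simp [g0, g1, e1]
  -- continuity of the shift
  have hcont : Continuous fun w => J (shiftReflect χ w) := by
    choose B hB0 hB using fun i => (hD i).lip χ K
    rw [continuous_iff_continuousAt]
    intro x0
    rw [ContinuousAt, tendsto_iff_norm_sub_tendsto_zero]
    have hlim : Tendsto (fun x => ((∑ i, B i) * (2 + ‖x0‖) ^ K * ‖x - x0‖)) (𝓝 x0) (𝓝 0) := by
      have : Continuous (fun x => ((∑ i, B i) * (2 + ‖x0‖) ^ K * ‖x - x0‖)) := by fun_prop
      simpa using this.tendsto x0
    refine squeeze_zero_norm' ?_ hlim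
    filter_upwards [Metric.closedBall_mem_nhds x0 one_pos] with x hx
    rw [norm_norm, ← map_sub]
    have hS := Finset.sum_nonneg fun i (_ : i ∈ Finset.univ) => hB0 i
    refine norm_Jfun_le _ _ _ (by positivity) fun i z => ?_
    refine (hB i x x0 z (mem_closedBall_iff_norm.1 hx)).trans ?_
    gcongr
    exact Finset.single_le_sum (fun i _ => hB0 i) (Finset.mem_univ i)
  obtain ⟨B, hB0, hB⟩ : ∃ B : ℝ, 0 ≤ B ∧ ∀ w, ‖J (shiftReflect χ w)‖ ≤ B * (1 + ‖w‖) ^ K := by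
    choose B hB0 hB using fun i => decayS (D i χ) K
    have hS := Finset.sum_nonneg fun i (_ : i ∈ Finset.univ) => hB0 i
    refine ⟨∑ i, B i, hS, fun w => norm_Jfun_le _ _ _ (by positivity) fun i z => ?_⟩
    rw [(hD i).norm_shift]
    calc (1 + ‖z‖) ^ K * ‖D i χ (w - z)‖ ≤ ((1 + ‖w‖) ^ K * (1 + ‖w - z‖) ^ K) * ‖D i χ (w - z)‖ := by
          gcongr; exact one_add_pow_le K w z
      _ = ((1 + ‖w - z‖) ^ K * ‖D i χ (w - z)‖) * (1 + ‖w‖) ^ K := by ring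
      _ ≤ _ := by
        gcongr
        exact (hB i _).trans (Finset.single_le_sum (fun i _ => hB0 i) (Finset.mem_univ i))
  have hbd : ∀ y, ‖J (shiftReflect χ (x - y))‖ ≤ B * ((1 + ‖x‖) ^ K * (1 + ‖y‖) ^ K) := by
    intro y
    refine (hB (x - y)).trans ?_
    have := one_add_pow_le K x (x - y)
    rw [sub_sub_cancel] at this
    gcongr
  have hint : Integrable fun y => ψ y • J (shiftReflect χ (x - y)) := by
    refine Integrable.mono' ((integrable_decay ψ K).const_mul (B * (1 + ‖x‖) ^ K)) ?_ ?_
    · refine Continuous.aestronglyMeasurable ?_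
      exact ψ.continuous.smul (hcont.comp (continuous_const.sub continuous_id))
    · refine ae_of_all _ fun y => ?_
      rw [norm_smul]
      calc _ ≤ ‖ψ y‖ * (B * ((1 + ‖x‖) ^ K * (1 + ‖y‖) ^ K)) := by gcongr; exact hbd y
        _ = _ := by ring
  have hintE : Integrable fun y => ψ y • f.toFun (shiftReflect χ (x - y)) := by
    refine Integrable.mono' ((integrable_decay ψ K).const_mul (C * (B * (1 + ‖x‖) ^ K))) ?_ ?_
    · refine Continuous.aestronglyMeasurable ?_
      exact ψ.continuous.smul ((toFun_cont f χ).comp (continuous_const.sub continuous_id))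
    · refine ae_of_all _ fun y => ?_
      rw [norm_smul]
      calc _ ≤ ‖ψ y‖ * (C * (B * ((1 + ‖x‖) ^ K * (1 + ‖y‖) ^ K))) := by
              gcongr; exact (hfJ _).trans (by gcongr; exact hbd y)
        _ = _ := by ring
  have hIJ : ∫ y, ψ y • J (shiftReflect χ (x - y)) = J (shiftReflect (convS ψ χ) x) := by
    ext z i
    let ev : BoundedContinuousFunction (Rn n) (ι → ℂ) →L[ℂ] ℂ :=
      (ContinuousLinearMap.proj (R := ℂ) (φ := fun _ : ι => ℂ) i).comp (BoundedContinuousFunction.evalCLM ℂ z)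
    have hev : ∀ v, ev v = v z i := fun _ => rfl
    rw [← hev, ← hev, ← ContinuousLinearMap.integral_comp_comm _ hint]
    simp_rw [hev, hJ]
    rw [Jfun_apply, (hD i).shift, (hD i).conv]
    simp only [BoundedContinuousFunction.coe_smul, Pi.smul_apply, Jfun_apply, (hD i).shift,
      smul_eq_mul, _root_.smul_apply, shiftReflect_apply]
    rw [convS_apply, ← integral_const_mul, ← integral_const_mul]
    refine integral_congr_ae (ae_of_all _ fun y => ?_)
    simp only
    rw [sub_right_comm]; ring
  rw [SeparatingDual.eq_iff_forall_dual_eq (R := ℂ)]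
  intro l
  obtain ⟨g, hg⟩ := hHB l
  rw [← hg, ← hIJ, ← ContinuousLinearMap.integral_comp_comm _ hint,
    ← ContinuousLinearMap.integral_comp_comm _ hintE]
  refine integral_congr_ae (ae_of_all _ fun y => ?_)
  simp [hg]

end LM


namespace LM

open LineDeriv

lemma invFourierS_eq (φ : Sch n) : invFourierS φ = 𝓕⁻ φ := rfl
lemma fourierS_eq (φ : Sch n) : fourierS φ = 𝓕 φ := rfl

/-- the normalising constant -/
def cn (n : ℕ) : ℝ := (2 * π) ^ (-(n : ℝ) / 2)

lemma cn_nonneg (n : ℕ) : 0 ≤ cn n := by unfold cn; positivity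

lemma mOp_eq (φ : Sch n) (f : TDist n E) (x : Rn n) :
    mOp φ f x = cn n • f.toFun (shiftReflect (𝓕⁻ φ) x) := rfl

lemma shiftReflect_add (ψ χ : Sch n) (x : Rn n) :
    shiftReflect (ψ + χ) x = shiftReflect ψ x + shiftReflect χ x := by
  ext y; simp [shiftReflect_apply]

lemma mOp_add (μ ν : Sch n) (f : TDist n E) (x : Rn n) :
    mOp (μ + ν) f x = mOp μ f x + mOp ν f x := by
  have : 𝓕⁻ (μ + ν) = 𝓕⁻ μ + (𝓕⁻ ν : Sch n) := FourierTransform.fourierInv_add _ _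
  rw [mOp_eq, mOp_eq, mOp_eq, this, shiftReflect_add, map_add, smul_add]

lemma mOp_smul (c : ℂ) (ν : Sch n) (f : TDist n E) (x : Rn n) :
    mOp (c • ν) f x = c • mOp ν f x := by
  have : 𝓕⁻ (c • ν) = c • (𝓕⁻ ν : Sch n) := FourierTransform.fourierInv_smul _ _
  rw [mOp_eq, mOp_eq, this, shiftReflect_smul, map_smul, smul_comm]

lemma mOp_zero (f : TDist n E) (x : Rn n) : mOp 0 f x = 0 := by
  have := mOp_smul 0 0 f x
  simpa using this

lemma mOp_sum {ι : Type*} (s : Finset ι) (μ : ι → Sch n) (f : TDist n E) (x : Rn n) :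
    mOp (∑ i ∈ s, μ i) f x = ∑ i ∈ s, mOp (μ i) f x := by
  classical
  induction s using Finset.induction_on with
  | empty => simp [mOp_zero]
  | insert a s ha ih => rw [Finset.sum_insert ha, Finset.sum_insert ha, mOp_add, ih]

lemma mOp_cont (μ : Sch n) (f : TDist n E) : Continuous (mOp μ f) :=
  (toFun_cont f (𝓕⁻ μ)).const_smul (cn n)

lemma mOp_mul [CompleteSpace E] (μ ν : Sch n) (f : TDist n E) (x : Rn n) :
    mOp (mulS μ ν) f x = ∫ y, (𝓕⁻ μ : Sch n) y • mOp ν f (x - y) := by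
  rw [mOp_eq, ← convS_inv, toFun_conv, ← integral_smul]
  refine integral_congr_ae (ae_of_all _ fun y => ?_)
  simp only [mOp_eq]
  rw [smul_comm]

/-- dyadic dilation of a symbol -/
def dl (μ : Sch n) (m : ℕ) : Sch n := dilate μ ((2 : ℝ) ^ m)⁻¹

lemma dl_apply (μ : Sch n) (m : ℕ) (ξ : Rn n) : dl μ m ξ = μ (((2 : ℝ) ^ m)⁻¹ • ξ) :=
  dilate_apply _ (by positivity) _

lemma dl_zero (μ : Sch n) : dl μ 0 = μ := by ext; simp [dl_apply]

lemma inv_dl_apply (μ : Sch n) (m : ℕ) (y : Rn n) :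
    (𝓕⁻ (dl μ m) : Sch n) y = (((2 : ℝ) ^ m) ^ n : ℝ) • (𝓕⁻ μ : Sch n) ((2 : ℝ) ^ m • y) := by
  rw [SchwartzMap.fourierInv_coe, SchwartzMap.fourierInv_coe, Real.fourierInv_eq', Real.fourierInv_eq']
  have h := Measure.integral_comp_inv_smul (volume : Measure (Rn n))
    (fun v : Rn n => Complex.exp (↑(2 * π * inner ℝ v ((2 : ℝ) ^ m • y)) * Complex.I) • μ v) ((2 : ℝ) ^ m)
  rw [finrank_euclideanSpace_fin, abs_of_pos (by positivity)] at h
  rw [← h]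
  refine integral_congr_ae (ae_of_all _ fun v => ?_)
  simp only
  rw [dl_apply, real_inner_smul_left, real_inner_smul_right]
  congr 4
  field_simp

lemma inv_dl (μ : Sch n) (m : ℕ) :
    (𝓕⁻ (dl μ m) : Sch n) = (((2 : ℝ) ^ m) ^ n : ℝ) • dilate (𝓕⁻ μ : Sch n) ((2 : ℝ) ^ m) := by
  ext y
  rw [inv_dl_apply, _root_.smul_apply, dilate_apply _ (by positivity)]

/-- polynomial weight -/
def W (a m : ℕ) (z : Rn n) : ℝ≥0∞ := ENNReal.ofReal ((1 + 2 ^ m * ‖z‖) ^ a)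

lemma W_ne_top (a m : ℕ) (z : Rn n) : W a m z ≠ ∞ := ENNReal.ofReal_ne_top

lemma one_le_W (a m : ℕ) (z : Rn n) : 1 ≤ W a m z := by
  rw [W, ← ENNReal.ofReal_one]
  exact ENNReal.ofReal_le_ofReal (one_le_pow₀ (by nlinarith [norm_nonneg z, pow_pos (two_pos (α := ℝ)) m]))

lemma W_ne_zero (a m : ℕ) (z : Rn n) : W a m z ≠ 0 :=
  (zero_lt_one.trans_le (one_le_W a m z)).ne'

lemma W_neg (a m : ℕ) (z : Rn n) : W a m (-z) = W a m z := by simp [W]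

lemma W_zero (a m : ℕ) : W a m (0 : Rn n) = 1 := by simp [W]

lemma W_add (a m : ℕ) (y z : Rn n) : W a m (y + z) ≤ W a m y * W a m z := by
  rw [W, W, W, ← ENNReal.ofReal_mul (by positivity), ← mul_pow]
  apply ENNReal.ofReal_le_ofReal
  have h := norm_add_le y z
  have h2 : (0 : ℝ) < 2 ^ m := by positivity
  gcongr
  nlinarith [mul_nonneg (norm_nonneg y) (norm_nonneg z), norm_nonneg y, norm_nonneg z,
    mul_nonneg (mul_nonneg h2.le (norm_nonneg y)) (mul_nonneg h2.le (norm_nonneg z)),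
    mul_le_mul_of_nonneg_left h h2.le]

lemma W_cont (a m : ℕ) : Continuous (W a m : Rn n → ℝ≥0∞) := by
  unfold W
  exact ENNReal.continuous_ofReal.comp (by fun_prop)

lemma W_le (a m l : ℕ) (z : Rn n) : W a m z ≤ 2 ^ (a * (m - l)) * W a l z := by
  have h2 : (2 : ℝ≥0∞) ^ (a * (m - l)) = ENNReal.ofReal (2 ^ (a * (m - l))) := by
    rw [ENNReal.ofReal_pow (by norm_num)]; simp
  rw [h2, W, W, ← ENNReal.ofReal_mul (by positivity)]
  apply ENNReal.ofReal_le_ofReal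
  rw [mul_comm a, pow_mul, ← mul_pow]
  gcongr
  have h3 : (2 : ℝ) ^ m ≤ 2 ^ (m - l) * 2 ^ l := by
    rw [← pow_add]; exact pow_le_pow_right₀ (by norm_num) (by omega)
  have h4 : (1 : ℝ) ≤ 2 ^ (m - l) := one_le_pow₀ (by norm_num)
  nlinarith [norm_nonneg z, mul_le_mul_of_nonneg_right h3 (norm_nonneg z)]

lemma W_smul (a m l : ℕ) (z : Rn n) : W a l ((2 : ℝ) ^ m • z) = W a (l + m) z := by
  unfold W
  rw [norm_smul, Real.norm_of_nonneg (by positivity), pow_add]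
  ring_nf

/-- weighted kernel norm of a symbol -/
def AA (a l : ℕ) (μ : Sch n) : ℝ≥0∞ := ∫⁻ y, ‖(𝓕⁻ μ : Sch n) y‖ₑ * W a l y

lemma AA_le (a m l : ℕ) (μ : Sch n) : AA a m μ ≤ 2 ^ (a * (m - l)) * AA a l μ := by
  unfold AA
  rw [← lintegral_const_mul' _ _ (by simp)]
  refine lintegral_mono fun y => ?_
  calc _ ≤ ‖(𝓕⁻ μ : Sch n) y‖ₑ * (2 ^ (a * (m - l)) * W a l y) := by gcongr; exact W_le a m l y
    _ = _ := by ring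

lemma lint_scale (m : ℕ) (g : Rn n → ℝ≥0∞) (hg : Measurable g) :
    ∫⁻ y, ((2 : ℝ≥0∞) ^ m) ^ n * g ((2 : ℝ) ^ m • y) = ∫⁻ y, g y := by
  have h2 : (0 : ℝ) < 2 ^ m := by positivity
  have hm := Measure.map_addHaar_smul (volume : Measure (Rn n)) h2.ne'
  have h1 : ∫⁻ y, g ((2 : ℝ) ^ m • y) = ENNReal.ofReal (abs (((2 : ℝ) ^ m) ^ n)⁻¹) * ∫⁻ y, g y := by
    rw [← lintegral_map hg (by fun_prop : Measurable fun y : Rn n => (2 : ℝ) ^ m • y), hm,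
      lintegral_smul_measure, finrank_euclideanSpace_fin, smul_eq_mul]
  rw [lintegral_const_mul' _ _ (by simp), h1, ← mul_assoc]
  have h3 : ((2 : ℝ≥0∞) ^ m) ^ n = ENNReal.ofReal (((2 : ℝ) ^ m) ^ n) := by
    rw [ENNReal.ofReal_pow (by positivity), ENNReal.ofReal_pow (by norm_num)]; simp
  rw [h3, ← ENNReal.ofReal_mul (by positivity), abs_of_pos (by positivity),
    mul_inv_cancel₀ (by positivity), ENNReal.ofReal_one, one_mul]

lemma enorm_inv_dl (μ : Sch n) (m : ℕ) (y : Rn n) :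
    ‖(𝓕⁻ (dl μ m) : Sch n) y‖ₑ = ((2 : ℝ≥0∞) ^ m) ^ n * ‖(𝓕⁻ μ : Sch n) ((2 : ℝ) ^ m • y)‖ₑ := by
  rw [inv_dl_apply, enorm_smul, enorm_pow, enorm_pow, Real.enorm_of_nonneg (by norm_num)]
  simp

lemma AA_dl (a m : ℕ) (μ : Sch n) : AA a m (dl μ m) = AA a 0 μ := by
  unfold AA
  rw [← lint_scale m (fun y => ‖(𝓕⁻ μ : Sch n) y‖ₑ * W a 0 y)
    ((SchwartzMap.continuous _).enorm.measurable.mul (W_cont a 0).measurable)]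
  refine lintegral_congr fun y => ?_
  rw [enorm_inv_dl, W_smul, zero_add, mul_assoc]

lemma AA_zero_lt_top (a : ℕ) (μ : Sch n) : AA a 0 μ < ∞ := by
  have h := (integrable_decay (𝓕⁻ μ : Sch n) a).2
  rw [hasFiniteIntegral_iff_ofReal (ae_of_all _ fun y => by positivity)] at h
  refine lt_of_le_of_lt (lintegral_mono fun y => ?_) h
  rw [W, ← ofReal_norm, ← ENNReal.ofReal_mul (norm_nonneg _)]
  simp [mul_comm]

lemma AA_lt_top (a l : ℕ) (μ : Sch n) : AA a l μ < ∞ :=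
  (AA_le a l 0 μ).trans_lt (ENNReal.mul_lt_top (by simp) (AA_zero_lt_top a μ))

/-- Peetre maximal function -/
def star (a l : ℕ) (g : Rn n → E) (x : Rn n) : ℝ≥0∞ := ⨆ y, ‖g y‖ₑ * (W a l (x - y))⁻¹

lemma le_star (a l : ℕ) (g : Rn n → E) (x y : Rn n) : ‖g y‖ₑ ≤ star a l g x * W a l (x - y) := by
  rw [← ENNReal.div_le_iff (W_ne_zero _ _ _) (W_ne_top _ _ _), ENNReal.div_eq_inv_mul, mul_comm]
  exact le_iSup (fun y => ‖g y‖ₑ * (W a l (x - y))⁻¹) y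

lemma le_star_self (a l : ℕ) (g : Rn n → E) (x : Rn n) : ‖g x‖ₑ ≤ star a l g x := by
  have := le_star a l g x x
  simpa [W_zero] using this

lemma star_le {a l : ℕ} {g : Rn n → E} {x : Rn n} {B : ℝ≥0∞}
    (h : ∀ y, ‖g y‖ₑ ≤ B * W a l (x - y)) : star a l g x ≤ B := by
  refine iSup_le fun y => ?_
  rw [← ENNReal.div_eq_inv_mul.trans (mul_comm _ _), ENNReal.div_le_iff (W_ne_zero _ _ _) (W_ne_top _ _ _)]
  exact h y

lemma star_scale (a m l : ℕ) (g : Rn n → E) (x : Rn n) :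
    star a l g x ≤ 2 ^ (a * (m - l)) * star a m g x := by
  refine star_le fun y => (le_star a m g x y).trans ?_
  calc _ ≤ star a m g x * (2 ^ (a * (m - l)) * W a l (x - y)) := by gcongr; exact W_le a m l _
    _ = _ := by ring

lemma star_conv (a l : ℕ) (ψ : Sch n) (g G : Rn n → E)
    (h : ∀ x, g x = ∫ y, ψ y • G (x - y)) (x : Rn n) :
    star a l g x ≤ (∫⁻ y, ‖ψ y‖ₑ * W a l y) * star a l G x := by
  refine star_le fun z => ?_
  rw [h z, mul_assoc]
  refine (enorm_integral_le_lintegral_enorm _).trans ?_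
  rw [← lintegral_mul_const _ (by
    exact (ψ.continuous.enorm.measurable).mul (W_cont a l).measurable)]
  refine lintegral_mono fun y => ?_
  rw [enorm_smul]
  have h1 := le_star a l G x (z - y)
  have h2 : W a l (x - (z - y)) ≤ W a l (x - z) * W a l y := by
    rw [show x - (z - y) = (x - z) + y by abel]; exact W_add _ _ _ _
  calc ‖ψ y‖ₑ * ‖G (z - y)‖ₑ ≤ ‖ψ y‖ₑ * (star a l G x * (W a l (x - z) * W a l y)) := by
        gcongr; exact h1.trans (by gcongr)
    _ = _ := by ring

lemma star_mul [CompleteSpace E] (a l : ℕ) (μ ν : Sch n) (f : TDist n E) (x : Rn n) :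
    star a l (mOp (mulS μ ν) f) x ≤ AA a l μ * star a l (mOp ν f) x :=
  star_conv a l (𝓕⁻ μ) _ _ (mOp_mul μ ν f) x

lemma star_smul (a l : ℕ) (c : ℂ) (ν : Sch n) (f : TDist n E) (x : Rn n) :
    star a l (mOp (c • ν) f) x = ‖c‖ₑ * star a l (mOp ν f) x := by
  unfold star
  rw [ENNReal.mul_iSup]
  simp_rw [mOp_smul, enorm_smul, mul_assoc]

lemma star_add (a l : ℕ) (μ ν : Sch n) (f : TDist n E) (x : Rn n) :
    star a l (mOp (μ + ν) f) x ≤ star a l (mOp μ f) x + star a l (mOp ν f) x := by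
  refine star_le fun y => ?_
  rw [mOp_add, add_mul]
  exact (enorm_add_le _ _).trans (add_le_add (le_star _ _ _ _ _) (le_star _ _ _ _ _))

lemma star_sum {ι : Type*} (s : Finset ι) (a l : ℕ) (μ : ι → Sch n) (f : TDist n E) (x : Rn n) :
    star a l (mOp (∑ i ∈ s, μ i) f) x ≤ ∑ i ∈ s, star a l (mOp (μ i) f) x := by
  refine star_le fun y => ?_
  rw [mOp_sum, Finset.sum_mul]
  exact (enorm_sum_le _ _).trans (Finset.sum_le_sum fun i _ => le_star _ _ _ _ _)

/-- the basic estimate for a product of dyadic symbols -/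
lemma star_two [CompleteSpace E] (a l m : ℕ) (μ ν ρ : Sch n) (f : TDist n E) (x : Rn n) :
    star a l (mOp (mulS (dl μ l) (mulS (dl ν m) ρ)) f) x ≤
      AA a 0 μ * AA a 0 ν * 2 ^ (a * (m - l)) * star a m (mOp ρ f) x := by
  refine (star_mul a l _ _ f x).trans ?_
  rw [AA_dl]
  refine (mul_le_mul_right ((star_scale a m l _ x).trans
    (mul_le_mul_right (star_mul a m _ _ f x) _)) _).trans ?_
  rw [AA_dl]
  apply le_of_eq; ring

theorem growth (f : TDist n E) : ∃ K M : ℕ, ∀ μ : Sch n, ∃ C : ℝ≥0∞, C < ∞ ∧ ∀ m x,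
    ‖mOp (dl μ m) f x‖ₑ ≤ C * 2 ^ (m * M) * W K 0 x := by
  obtain ⟨K, M, h⟩ := growth0 f
  refine ⟨K, M + n, fun μ => ?_⟩
  obtain ⟨C, hC, h⟩ := h (𝓕⁻ μ)
  refine ⟨ENNReal.ofReal (cn n * C), ENNReal.ofReal_lt_top, fun m x => ?_⟩
  have h2 : (2 : ℝ≥0∞) ^ (m * (M + n)) = ENNReal.ofReal (2 ^ (m * (M + n))) := by
    rw [ENNReal.ofReal_pow (by norm_num)]; simp
  have hcn := cn_nonneg n
  rw [h2, W, ← ENNReal.ofReal_mul (by positivity), ← ENNReal.ofReal_mul (by positivity),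
    ← ofReal_norm]
  apply ENNReal.ofReal_le_ofReal
  rw [mOp_eq, inv_dl, show ((((2 : ℝ) ^ m) ^ n : ℝ) • dilate (𝓕⁻ μ : Sch n) ((2 : ℝ) ^ m) : Sch n) =
    ((((2 : ℝ) ^ m) ^ n : ℝ) : ℂ) • dilate (𝓕⁻ μ : Sch n) ((2 : ℝ) ^ m) from by ext; simp,
    shiftReflect_smul, map_smul, norm_smul, norm_smul, Complex.norm_real,
    Real.norm_of_nonneg hcn, Real.norm_of_nonneg (by positivity)]
  have := h ((2 : ℝ) ^ m) (one_le_pow₀ (by norm_num)) x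
  calc _ ≤ cn n * (((2 : ℝ) ^ m) ^ n * (C * ((2 : ℝ) ^ m) ^ M * (1 + ‖x‖) ^ K)) := by gcongr
    _ = _ := by rw [pow_zero, one_mul, pow_mul, pow_add]; ring

end LM


namespace LM

open LineDeriv
open scoped ContDiff

/-- powers of two in the extended reals -/
def two (t : ℝ) : ℝ≥0∞ := (2 : ℝ≥0∞) ^ t

lemma two_add (s t : ℝ) : two (s + t) = two s * two t :=
  ENNReal.rpow_add _ _ (by simp) (by simp)

lemma two_zero : two 0 = 1 := by simp [two]

lemma two_mono {s t : ℝ} (h : s ≤ t) : two s ≤ two t :=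
  ENNReal.rpow_le_rpow_of_exponent_le (by norm_num) h

lemma two_ne_top (t : ℝ) : two t ≠ ⊤ := by
  unfold two; exact ENNReal.rpow_ne_top_of_ne_zero (by norm_num) (by norm_num)

lemma two_ne_zero' (t : ℝ) : two t ≠ 0 := by
  unfold two
  simp [ENNReal.rpow_eq_zero_iff]

lemma two_rpow (t u : ℝ) : two t ^ u = two (t * u) := (ENNReal.rpow_mul _ _ _).symm

lemma two_nat (m : ℕ) : two (m : ℝ) = 2 ^ m := by simp [two]

lemma two_eq_ofReal (t : ℝ) : two t = ENNReal.ofReal (2 ^ t) := by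
  unfold two
  rw [← ENNReal.ofReal_rpow_of_pos (by norm_num)]; simp

lemma enorm_two (t : ℝ) : ‖(((2 : ℝ) ^ t : ℝ) : ℂ)‖ₑ = two t := by
  rw [two_eq_ofReal, ← ofReal_norm, Complex.norm_real, Real.norm_of_nonneg (by positivity)]

lemma exists_div (u v : Rn n → ℂ) (hu : ContDiff ℝ ∞ u) (hc : HasCompactSupport u)
    (hv : ContDiff ℝ ∞ v) (hne : ∀ x ∈ tsupport u, v x ≠ 0) :
    ∃ w : Sch n, ∀ x, w x = u x / v x := by
  have h1 : ContDiff ℝ ∞ fun x => u x / v x := by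
    rw [contDiff_iff_contDiffAt]
    intro x
    by_cases hx : x ∈ tsupport u
    · simp_rw [div_eq_mul_inv]
      exact hu.contDiffAt.mul (hv.contDiffAt.inv (hne x hx))
    · have : (fun x => u x / v x) =ᶠ[𝓝 x] fun _ => 0 := by
        filter_upwards [(isClosed_tsupport u).isOpen_compl.mem_nhds hx] with y hy
        rw [image_eq_zero_of_notMem_tsupport hy, zero_div]
      exact contDiffAt_const.congr_of_eventuallyEq this
  have h2 : HasCompactSupport fun x => u x / v x := by
    refine hc.mono fun x hx => ?_
    intro h0
    exact hx (by simp [h0])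
  exact ⟨h2.toSchwartzMap h1, fun x => rfl⟩

lemma exists_chi0 {ρ : ℝ} (hρ : 0 < ρ) : ∃ χ : Rn n → ℂ, ContDiff ℝ ∞ χ ∧ HasCompactSupport χ ∧
    (∀ x, ‖x‖ ≤ ρ → χ x = 1) ∧ (∀ x ∈ tsupport χ, ‖x‖ ≤ 2 * ρ) := by
  let b : ContDiffBump (0 : Rn n) := ⟨ρ, 2 * ρ, hρ, by linarith⟩
  have ht : tsupport (fun x => ((b x : ℝ) : ℂ)) ⊆ tsupport b := by
    apply closure_mono
    intro x hx h0
    exact hx (by simp [h0])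
  refine ⟨fun x => ((b x : ℝ) : ℂ), Complex.ofRealCLM.contDiff.comp b.contDiff, ?_, ?_, ?_⟩
  · exact IsCompact.of_isClosed_subset b.hasCompactSupport (isClosed_tsupport _) ht
  · intro x hx
    have : b x = 1 := b.one_of_mem_closedBall (by simpa using hx)
    simp [this]
  · intro x hx
    have := ht hx
    rw [b.tsupport_eq] at this
    simpa using this

lemma exists_chi : ∃ χ : Rn n → ℂ, ContDiff ℝ ∞ χ ∧ HasCompactSupport χ ∧
    (∀ x, 1 / 2 ≤ ‖x‖ → ‖x‖ ≤ 2 → χ x = 1) ∧ (∀ x ∈ tsupport χ, 1 / 4 ≤ ‖x‖ ∧ ‖x‖ ≤ 4) := by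
  obtain ⟨b1, h1, c1, o1, s1⟩ := exists_chi0 (n := n) (ρ := 2) (by norm_num)
  let b : ContDiffBump (0 : Rn n) := ⟨1 / 4, 1 / 2, by norm_num, by norm_num⟩
  refine ⟨fun x => b1 x * (1 - ((b x : ℝ) : ℂ)), ?_, c1.mul_right, ?_, ?_⟩
  · exact h1.mul (contDiff_const.sub (Complex.ofRealCLM.contDiff.comp b.contDiff))
  · intro x hx hx'
    have : b x = 0 := b.zero_of_le_dist (by rw [dist_zero_right]; exact hx)
    simp [this, o1 x hx']
  · intro x hx
    constructor
    · have hcl : IsClosed {x : Rn n | 1 / 4 ≤ ‖x‖} := isClosed_le continuous_const continuous_norm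
      refine closure_minimal ?_ hcl hx
      intro y hy
      by_contra hlt
      simp only [mem_setOf_eq, not_le] at hlt
      have : b y = 1 := b.one_of_mem_closedBall (by rw [mem_closedBall_zero_iff]; exact hlt.le)
      exact hy (by simp [this])
    · have := s1 x (tsupport_mul_subset_left hx)
      linarith

lemma exists_weight (κ : Sch n) (M : ℕ) : ∃ μ : Sch n, ∀ x, μ x = ((‖x‖ ^ 2) ^ M : ℝ) * κ x := by
  have hg : (fun x : Rn n => ((‖x‖ ^ 2) ^ M : ℝ)).HasTemperateGrowth := by fun_prop
  exact ⟨smulLeftCLM ℂ (fun x : Rn n => ((‖x‖ ^ 2) ^ M : ℝ)) κ, fun x => by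
    rw [smulLeftCLM_apply_apply hg]; simp⟩

lemma contDiff_weight (M : ℕ) : ContDiff ℝ ∞ (fun x : Rn n => (((‖x‖ ^ 2) ^ M : ℝ) : ℂ)) :=
  Complex.ofRealCLM.contDiff.comp ((contDiff_norm_sq ℝ).pow M)

end LM


namespace LM

open LineDeriv
open scoped ContDiff

lemma pdS_iter_good (i : Fin n) (L : ℕ) : GoodOp ((pdS (n := n) i)^[L]) L := by
  induction L with
  | zero => exact GoodOp.id
  | succ L ih => exact ih.comp (pdS_good i)

lemma tsupport_pdS (i : Fin n) (μ : Sch n) : tsupport (pdS i μ) ⊆ tsupport μ := by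
  refine closure_minimal ?_ (isClosed_tsupport _)
  intro x hx
  apply support_fderiv_subset ℝ (f := μ)
  intro h0
  exact hx (by rw [pdS_apply, h0]; simp)

lemma tsupport_pdS_iter (i : Fin n) (L : ℕ) (μ : Sch n) : tsupport ((pdS i)^[L] μ) ⊆ tsupport μ := by
  induction L generalizing μ with
  | zero => exact subset_rfl
  | succ L ih => exact (ih _).trans (tsupport_pdS i μ)

lemma norm_inv_pdS (i : Fin n) (μ : Sch n) (x : Rn n) :
    ‖(𝓕⁻ (pdS i μ) : Sch n) x‖ = 2 * π * |x i| * ‖(𝓕⁻ μ : Sch n) x‖ := by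
  have hg : (fun x : Rn n => inner ℝ x (EuclideanSpace.single i (1 : ℝ))).HasTemperateGrowth := by
    fun_prop
  have e : (𝓕⁻ (pdS i μ) : Sch n) = _ := fourierInv_lineDerivOp_eq μ _
  rw [e, _root_.smul_apply, smulLeftCLM_apply_apply hg]
  simp [abs_of_pos Real.pi_pos, EuclideanSpace.inner_single_right]
  ring

lemma norm_inv_pdS_iter (i : Fin n) (L : ℕ) (μ : Sch n) (x : Rn n) :
    ‖(𝓕⁻ ((pdS i)^[L] μ) : Sch n) x‖ = (2 * π * |x i|) ^ L * ‖(𝓕⁻ μ : Sch n) x‖ := by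
  induction L generalizing μ with
  | zero => simp
  | succ L ih => rw [Function.iterate_succ_apply, ih, norm_inv_pdS]; ring

lemma norm_inv_le (μ : Sch n) (x : Rn n) : ‖(𝓕⁻ μ : Sch n) x‖ ≤ ∫ v, ‖μ v‖ := by
  rw [SchwartzMap.fourierInv_coe, Real.fourierInv_eq']
  refine (norm_integral_le_integral_norm _).trans (le_of_eq ?_)
  refine integral_congr_ae (ae_of_all _ fun v => ?_)
  simp only [norm_smul]
  rw [Complex.norm_exp_ofReal_mul_I, one_mul]

lemma integral_norm_le (μ : Sch n) {B : ℝ} (hB : 0 ≤ B) (hs : tsupport μ ⊆ closedBall 0 2)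
    (h : ∀ x, ‖μ x‖ ≤ B) : ∫ v, ‖μ v‖ ≤ B * (volume : Measure (Rn n)).real (closedBall 0 2) := by
  have h1 : ∫ v, ‖μ v‖ = ∫ v in closedBall 0 2, ‖μ v‖ := by
    refine (setIntegral_eq_integral_of_forall_compl_eq_zero fun x hx => ?_).symm
    rw [norm_eq_zero]
    exact image_eq_zero_of_notMem_tsupport fun hx' => hx (hs hx')
  rw [h1]
  have := norm_setIntegral_le_of_norm_le_const (μ := volume) (s := closedBall (0 : Rn n) 2)
    (f := fun v => ‖μ v‖) (C := B) (isCompact_closedBall _ _).measure_lt_top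
    (fun x _ => by simpa using h x)
  exact (le_abs_self _).trans this

lemma one_add_norm_pow (L : ℕ) (x : Rn n) :
    (1 + ‖x‖) ^ (L + 1) ≤ 2 ^ L * (1 + n ^ L * ∑ i, |x i| ^ (L + 1)) := by
  have h1 : ‖x‖ ≤ ∑ i, |x i| := by
    have h0 : 0 ≤ ∑ i, |x i| := Finset.sum_nonneg fun i _ => abs_nonneg _
    rw [EuclideanSpace.norm_eq, Real.sqrt_le_iff]
    refine ⟨h0, ?_⟩
    simpa using Finset.sum_sq_le_sq_sum_of_nonneg (s := Finset.univ) (f := fun i => |x i|) (fun i _ => abs_nonneg _)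
  have h2 : (∑ i, |x i|) ^ (L + 1) ≤ n ^ L * ∑ i, |x i| ^ (L + 1) := by
    rcases Nat.eq_zero_or_pos n with rfl | hn
    · simp
    have := pow_sum_div_card_le_sum_pow (s := Finset.univ) (f := fun i => |x i|) (fun i _ => abs_nonneg _) L
    rw [div_le_iff₀ (by simp; positivity)] at this
    simpa [mul_comm] using this
  calc (1 + ‖x‖) ^ (L + 1) ≤ (1 + ∑ i, |x i|) ^ (L + 1) := by gcongr
    _ ≤ 2 ^ (L + 1 - 1) * (1 ^ (L + 1) + (∑ i, |x i|) ^ (L + 1)) :=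
        add_pow_le zero_le_one (Finset.sum_nonneg fun i _ => abs_nonneg _) _
    _ ≤ _ := by simp only [one_pow, add_tsub_cancel_right]; gcongr

lemma AA_bound (a : ℕ) : ∃ C : ℝ≥0∞, C ≠ ⊤ ∧ ∀ (μ : Sch n) (B : ℝ), 0 ≤ B →
    tsupport μ ⊆ closedBall 0 2 → (∀ x, ‖μ x‖ ≤ B) →
    (∀ i x, ‖(pdS i)^[a + n + 1] μ x‖ ≤ B) → AA a 0 μ ≤ C * ENNReal.ofReal B := by
  let V := (volume : Measure (Rn n)).real (closedBall 0 2)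
  have hV : 0 ≤ V := measureReal_nonneg
  let C0 : ℝ := 2 ^ (a + n) * (1 + n ^ (a + n) * n) * V
  have hint : Integrable (fun x : Rn n => (1 + ‖x‖) ^ (-((n : ℝ) + 1))) volume :=
    integrable_one_add_norm (by simp)
  refine ⟨ENNReal.ofReal C0 * ∫⁻ x : Rn n, ENNReal.ofReal ((1 + ‖x‖) ^ (-((n : ℝ) + 1))), ?_, ?_⟩
  · have := hint.2
    rw [hasFiniteIntegral_iff_ofReal (ae_of_all _ fun y => by positivity)] at this
    exact ENNReal.mul_ne_top ENNReal.ofReal_ne_top this.ne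
  intro μ B hB hs h0 h1
  have key : ∀ x, (1 + ‖x‖) ^ (a + n + 1) * ‖(𝓕⁻ μ : Sch n) x‖ ≤ C0 * B := by
    intro x
    have e0 : ‖(𝓕⁻ μ : Sch n) x‖ ≤ B * V := (norm_inv_le μ x).trans (integral_norm_le μ hB hs h0)
    have e1 : ∀ i, |x i| ^ (a + n + 1) * ‖(𝓕⁻ μ : Sch n) x‖ ≤ B * V := by
      intro i
      have := (norm_inv_le ((pdS i)^[a + n + 1] μ) x).trans
        (integral_norm_le _ hB ((tsupport_pdS_iter i _ μ).trans hs) (h1 i))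
      rw [norm_inv_pdS_iter] at this
      refine le_trans ?_ this
      gcongr
      have := abs_nonneg (x i)
      nlinarith [Real.pi_gt_three]
    calc _ ≤ (2 ^ (a + n) * (1 + n ^ (a + n) * ∑ i, |x i| ^ (a + n + 1))) * ‖(𝓕⁻ μ : Sch n) x‖ := by
          gcongr; exact one_add_norm_pow (a + n) x
      _ = 2 ^ (a + n) * (‖(𝓕⁻ μ : Sch n) x‖ + n ^ (a + n) * ∑ i, |x i| ^ (a + n + 1) * ‖(𝓕⁻ μ : Sch n) x‖) := by
          rw [← Finset.sum_mul]; ring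
      _ ≤ 2 ^ (a + n) * (B * V + n ^ (a + n) * ∑ i : Fin n, B * V) := by
          have := Finset.sum_le_sum fun i (_ : i ∈ Finset.univ) => e1 i
          gcongr
      _ = _ := by simp only [Finset.sum_const, Finset.card_univ, Fintype.card_fin, nsmul_eq_mul, C0]; ring
  unfold AA
  have hC0 : 0 ≤ C0 := by positivity
  rw [mul_right_comm, ← ENNReal.ofReal_mul hC0, ← lintegral_const_mul' _ _ ENNReal.ofReal_ne_top]
  refine lintegral_mono fun x => ?_
  rw [W, ← ofReal_norm, ← ENNReal.ofReal_mul (norm_nonneg _), ← ENNReal.ofReal_mul (by positivity)]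
  apply ENNReal.ofReal_le_ofReal
  rw [Real.rpow_neg (by positivity), ← div_eq_mul_inv, le_div_iff₀ (by positivity)]
  have e : (1 + ‖x‖) ^ ((n : ℝ) + 1) = (1 + ‖x‖) ^ (n + 1) := by
    rw [← Real.rpow_natCast]; push_cast; rfl
  rw [e]
  refine le_trans (le_of_eq ?_) (key x)
  rw [pow_zero, one_mul, add_assoc, pow_add]; ring

lemma mderiv_single (i : Fin n) (L : ℕ) (g : Rn n → ℂ) : mderiv (Pi.single i L) g = (pd i)^[L] g := by
  have key : ∀ l : List (Fin n), l.Nodup →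
      l.foldr (fun k h => (pd k)^[(Pi.single i L : Fin n → ℕ) k] h) g = (pd i)^[if i ∈ l then L else 0] g := by
    intro l
    induction l with
    | nil => simp
    | cons k l ih =>
      intro hl
      rw [List.nodup_cons] at hl
      rw [List.foldr_cons, ih hl.2]
      by_cases hk : k = i
      · subst hk
        simp [hl.1]
      · have : i ≠ k := fun h => hk h.symm
        simp [hk, this]
  have := key (List.finRange n) (List.nodup_finRange n)
  simpa [mderiv] using this

lemma mderiv_zero (g : Rn n → ℂ) : mderiv 0 g = g := by
  unfold mderiv
  induction List.finRange n with
  | nil => rfl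
  | cons k l ih => rw [List.foldr_cons, ih]; rfl

lemma phi_norm_le {φ : ℕ → Sch n} (hφ : SmoothResolution n φ) {m : ℕ} {ξ : Rn n}
    (h : φ m ξ ≠ 0) : ‖ξ‖ ≤ 2 * 2 ^ m := by
  rcases Nat.eq_zero_or_pos m with rfl | hm
  · simpa using hφ.supp0 h
  · have := (hφ.suppj m hm h).2
    rw [Real.rpow_add (by norm_num), Real.rpow_natCast] at this
    simpa [mul_comm] using this

lemma phi_le_norm {φ : ℕ → Sch n} (hφ : SmoothResolution n φ) {m : ℕ} (hm : 0 < m) {ξ : Rn n}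
    (h : φ m ξ ≠ 0) : 2 ^ m / 2 ≤ ‖ξ‖ := by
  have := (hφ.suppj m hm h).1
  rw [Real.rpow_sub (by norm_num), Real.rpow_natCast] at this
  simpa using this

theorem AA_phi {φ : ℕ → Sch n} (hφ : SmoothResolution n φ) (a : ℕ) :
    ∃ C : ℝ≥0∞, C ≠ ⊤ ∧ ∀ j, AA a j (φ j) ≤ C := by
  obtain ⟨C, hC, h⟩ := AA_bound (n := n) a
  obtain ⟨c0, hc0⟩ := hφ.deriv_bound 0
  choose c hc using fun i : Fin n => hφ.deriv_bound (Pi.single i (a + n + 1))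
  let B := |c0| + ∑ i, |c i|
  have hB : 0 ≤ B := by positivity
  have hB0 : c0 ≤ B := (le_abs_self c0).trans (le_add_of_nonneg_right (by positivity))
  have hBi : ∀ i, c i ≤ B := fun i => (le_abs_self _).trans
    ((Finset.single_le_sum (f := fun i => |c i|) (fun i _ => abs_nonneg _) (Finset.mem_univ i)).trans
      (le_add_of_nonneg_left (abs_nonneg _)))
  refine ⟨C * ENNReal.ofReal B, ENNReal.mul_ne_top hC ENNReal.ofReal_ne_top, fun j => ?_⟩
  have h2 : (0 : ℝ) < 2 ^ j := by positivity
  have e : φ j = dl (dilate (φ j) (2 ^ j)) j := by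
    ext ξ
    rw [dl_apply, dilate_apply _ h2.ne', smul_smul, mul_inv_cancel₀ h2.ne', one_smul]
  rw [e, AA_dl]
  refine h _ B hB ?_ ?_ ?_
  · refine closure_minimal ?_ isClosed_closedBall
    intro x hx
    rw [Function.mem_support, dilate_apply _ h2.ne'] at hx
    have := phi_norm_le hφ hx
    rw [norm_smul, Real.norm_of_nonneg h2.le] at this
    rw [mem_closedBall_zero_iff]
    nlinarith
  · intro x
    rw [dilate_apply _ h2.ne']
    have := hc0 j ((2 : ℝ) ^ j • x)
    rw [mderiv_zero] at this
    simp [mdeg] at this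
    exact this.trans hB0
  · intro i x
    rw [(pdS_iter_good i _).norm_dil _ h2, pdS_iter_coe]
    have := hc i j ((2 : ℝ) ^ j • x)
    rw [mderiv_single] at this
    have hm : mdeg (Pi.single i (a + n + 1)) = a + n + 1 := by simp [mdeg]
    rw [hm] at this
    have e2 : (2 : ℝ) ^ (-(j : ℝ) * ((a + n + 1 : ℕ) : ℝ)) = (((2 : ℝ) ^ j) ^ (a + n + 1))⁻¹ := by
      rw [neg_mul, Real.rpow_neg (by norm_num), ← Nat.cast_mul, Real.rpow_natCast, pow_mul]
    rw [e2] at this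
    calc _ ≤ ((2 : ℝ) ^ j) ^ (a + n + 1) * (c i * (((2 : ℝ) ^ j) ^ (a + n + 1))⁻¹) := by gcongr
      _ = c i := by field_simp
      _ ≤ B := hBi i

end LM


namespace LM

open LineDeriv
open scoped ContDiff

/-- the family of symbols of the local means -/
def kap (κ0 κ : Sch n) (l : ℕ) : Sch n := if l = 0 then κ0 else dl κ l

lemma pow_ratio (K l m : ℕ) : (2 : ℝ) ^ ((K : ℝ) * ((l : ℝ) - m)) = ((2 : ℝ) ^ l) ^ K / (2 ^ m) ^ K := by
  rw [mul_sub, Real.rpow_sub (by norm_num), ← Nat.cast_mul, ← Nat.cast_mul, Real.rpow_natCast,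
    Real.rpow_natCast, mul_comm K l, mul_comm K m, pow_mul, pow_mul]

lemma fac_aux [CompleteSpace E] (K φ μ ν : Sch n) (a l m : ℕ) (t : ℝ)
    (h : ∀ ξ, φ ξ ≠ 0 → K ξ = (((2 : ℝ) ^ t : ℝ) : ℂ) * (dl μ l ξ * dl ν m ξ))
    (f : TDist n E) (x : Rn n) :
    star a l (mOp (mulS K φ) f) x ≤
      AA a 0 μ * AA a 0 ν * (two t * 2 ^ (a * (m - l))) * star a m (mOp φ f) x := by
  have e : mulS K φ = (((2 : ℝ) ^ t : ℝ) : ℂ) • mulS (dl μ l) (mulS (dl ν m) φ) := by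
    ext ξ
    rw [mulS_apply, _root_.smul_apply, mulS_apply, mulS_apply, smul_eq_mul]
    by_cases h0 : φ ξ = 0
    · simp [h0]
    · rw [h ξ h0]; ring
  rw [e, star_smul, enorm_two]
  refine (mul_le_mul_right (star_two a l m μ ν φ f x) _).trans (le_of_eq ?_)
  ring

lemma two_pow_nat (a m l : ℕ) : (2 : ℝ≥0∞) ^ (a * (m - l)) = two (a * max ((m : ℝ) - l) 0) := by
  rw [← two_nat]
  congr 1
  push_cast
  rcases le_total l m with h | h
  · rw [Nat.cast_sub h, max_eq_left]
    simpa using h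
  · rw [Nat.sub_eq_zero_of_le h, max_eq_right]
    · simp
    · simpa using h

theorem factor [CompleteSpace E] {φ : ℕ → Sch n} (hφ : SmoothResolution n φ) (κ0 κ κ' : Sch n) (N : ℕ)
    (hκ : ∀ x, κ x = ((‖x‖ ^ 2) ^ N : ℝ) * κ' x) (a M : ℕ) (ha : a ≤ 2 * M) :
    ∃ C : ℝ≥0∞, C ≠ ⊤ ∧ ∀ (f : TDist n E) (l m : ℕ) (x : Rn n),
      star a l (mOp (mulS (kap κ0 κ l) (φ m)) f) x ≤
        C * two (min (-((2 * M : ℝ) - a) * ((m : ℝ) - l)) ((2 * N : ℝ) * ((m : ℝ) - l))) *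
          star a m (mOp (φ m) f) x := by
  obtain ⟨χ, χs, χc, χ1, χt⟩ := exists_chi (n := n)
  obtain ⟨χ0, χ0s, χ0c, χ01, χ0t⟩ := exists_chi0 (n := n) (ρ := 2) (by norm_num)
  obtain ⟨ν1, hν1⟩ := exists_div χ _ χs χc (contDiff_weight M) (by
    intro x hx
    have : 0 < ‖x‖ := by have := (χt x hx).1; linarith
    rw [Complex.ofReal_ne_zero]; positivity)
  obtain ⟨ν2, hν2⟩ := exists_div χ (fun _ => 1) χs χc contDiff_const (by simp)
  obtain ⟨ν3, hν3⟩ := exists_div χ0 (fun _ => 1) χ0s χ0c contDiff_const (by simp)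
  obtain ⟨ν4, hν4⟩ := exists_weight ν2 N
  obtain ⟨ν5, hν5⟩ := exists_weight ν3 N
  obtain ⟨μ1, hμ1⟩ := exists_weight κ0 M
  obtain ⟨μ2, hμ2⟩ := exists_weight κ M
  let Cμ := AA a 0 μ1 + AA a 0 μ2 + AA a 0 κ' + AA a 0 κ0
  let Cν := AA a 0 ν1 + AA a 0 ν4 + AA a 0 ν3 + AA a 0 ν5
  have nt : ∀ μ : Sch n, AA a 0 μ ≠ ⊤ := fun μ => (AA_lt_top a 0 μ).ne
  have haM : (a : ℝ) ≤ 2 * M := by exact_mod_cast ha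
  -- pointwise
  have hχm : ∀ m, 0 < m → ∀ ξ, φ m ξ ≠ 0 → χ (((2 : ℝ) ^ m)⁻¹ • ξ) = 1 ∧ 0 < ‖ξ‖ := by
    intro m hm ξ h
    have h1 := phi_norm_le hφ h
    have h2 := phi_le_norm hφ hm h
    have h3 : (0 : ℝ) < 2 ^ m := by positivity
    refine ⟨χ1 _ ?_ ?_, lt_of_lt_of_le (by positivity) h2⟩
    · rw [norm_smul, norm_inv, Real.norm_of_nonneg h3.le, inv_mul_eq_div, le_div_iff₀ h3]; linarith
    · rw [norm_smul, norm_inv, Real.norm_of_nonneg h3.le, inv_mul_eq_div, div_le_iff₀ h3]; linarith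
  have hχ0' : ∀ ξ, φ 0 ξ ≠ 0 → χ0 ξ = 1 := fun ξ h => χ01 ξ (by simpa using phi_norm_le hφ h)
  -- case 1
  have case1 : ∀ (κs μs : Sch n) (_ : ∀ x, μs x = ((‖x‖ ^ 2) ^ M : ℝ) * κs x) (l m : ℕ), 0 < m →
      ∀ ξ, φ m ξ ≠ 0 → dl κs l ξ =
        (((2 : ℝ) ^ (((2 * M : ℕ) : ℝ) * ((l : ℝ) - m)) : ℝ) : ℂ) * (dl μs l ξ * dl ν1 m ξ) := by
    intro κs μs hμs l m hm ξ hξ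
    obtain ⟨e1, e2⟩ := hχm m hm ξ hξ
    simp only [dl_apply, hμs, hν1, e1, pow_ratio, norm_smul, norm_inv, norm_pow, Real.norm_ofNat]
    have e3 : (‖ξ‖ : ℂ) ≠ 0 := by rw [Complex.ofReal_ne_zero]; exact e2.ne'
    push_cast
    generalize κs (((2 : ℝ) ^ l)⁻¹ • ξ) = z
    have hA : (2 : ℂ) ^ l ≠ 0 := by simp
    have hB : (2 : ℂ) ^ m ≠ 0 := by simp
    revert hA hB
    generalize (2 : ℂ) ^ l = A
    generalize (2 : ℂ) ^ m = B
    intro hA hB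
    simp only [mul_pow, inv_pow, ← pow_mul]
    field_simp
  have case2 : ∀ (ν : Sch n) (om : Rn n → ℂ) (_ : ∀ x, ν x = ((‖x‖ ^ 2) ^ N : ℝ) * om x) (l m : ℕ) ξ,
      om (((2 : ℝ) ^ m)⁻¹ • ξ) = 1 → dl κ l ξ =
        (((2 : ℝ) ^ (((2 * N : ℕ) : ℝ) * ((m : ℝ) - l)) : ℝ) : ℂ) * (dl κ' l ξ * dl ν m ξ) := by
    intro ν om hν l m ξ e1
    simp only [dl_apply, hκ, hν, e1, pow_ratio, norm_smul, norm_inv, norm_pow, Real.norm_ofNat]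
    push_cast
    generalize κ' (((2 : ℝ) ^ l)⁻¹ • ξ) = z
    have hA : (2 : ℂ) ^ l ≠ 0 := by simp
    have hB : (2 : ℂ) ^ m ≠ 0 := by simp
    revert hA hB
    generalize (2 : ℂ) ^ l = A
    generalize (2 : ℂ) ^ m = B
    intro hA hB
    simp only [mul_pow, inv_pow, ← pow_mul]
    field_simp
  have fin : ∀ (f : TDist n E) (l m : ℕ) (x : Rn n) (μ ν : Sch n) (t : ℝ),
      AA a 0 μ ≤ Cμ → AA a 0 ν ≤ Cν →
      t + a * max ((m : ℝ) - l) 0 ≤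
        (min (-((2 * M : ℝ) - a) * ((m : ℝ) - l)) ((2 * N : ℝ) * ((m : ℝ) - l))) →
      (∀ ξ, φ m ξ ≠ 0 → kap κ0 κ l ξ = (((2 : ℝ) ^ t : ℝ) : ℂ) * (dl μ l ξ * dl ν m ξ)) →
      star a l (mOp (mulS (kap κ0 κ l) (φ m)) f) x ≤
        Cμ * Cν * two (min (-((2 * M : ℝ) - a) * ((m : ℝ) - l)) ((2 * N : ℝ) * ((m : ℝ) - l))) *
          star a m (mOp (φ m) f) x := by
    intro f l m x μ ν t h1 h2 h3 h4
    refine (fac_aux _ _ μ ν a l m t h4 f x).trans ?_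
    rw [two_pow_nat, ← two_add]
    gcongr
    exact two_mono h3
  refine ⟨Cμ * Cν, ENNReal.mul_ne_top (by simp [Cμ, nt]) (by simp [Cν, nt]), fun f l m x => ?_⟩
  have le1 : AA a 0 ν1 ≤ Cν := by simp only [Cν, add_assoc]; exact le_self_add
  have le4 : AA a 0 ν4 ≤ Cν := by simp only [Cν]; rw [add_assoc, add_assoc, add_left_comm]; exact le_self_add
  have le3 : AA a 0 ν3 ≤ Cν := by simp only [Cν]; exact le_add_self.trans le_self_add
  have le5 : AA a 0 ν5 ≤ Cν := le_add_self
  have ke1 : AA a 0 μ1 ≤ Cμ := by simp only [Cμ, add_assoc]; exact le_self_add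
  have ke2 : AA a 0 μ2 ≤ Cμ := by simp only [Cμ]; rw [add_assoc, add_assoc, add_left_comm]; exact le_self_add
  have ke3 : AA a 0 κ' ≤ Cμ := by simp only [Cμ]; exact le_add_self.trans le_self_add
  have ke4 : AA a 0 κ0 ≤ Cμ := le_add_self
  rcases Nat.lt_or_ge m l with hml | hml
  · have hl : l ≠ 0 := by omega
    have hml' : (m : ℝ) - l ≤ 0 := by
      have : (m : ℝ) ≤ l := by exact_mod_cast hml.le
      linarith
    have ht : (((2 * N : ℕ) : ℝ) * ((m : ℝ) - l)) + a * max ((m : ℝ) - l) 0 ≤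
        (min (-((2 * M : ℝ) - a) * ((m : ℝ) - l)) ((2 * N : ℝ) * ((m : ℝ) - l))) := by
      rw [max_eq_right hml', le_min_iff]
      push_cast
      constructor
      · have h1 : (0 : ℝ) ≤ 2 * N := by positivity
        nlinarith [mul_nonneg h1 (neg_nonneg.2 hml'), mul_nonneg (sub_nonneg.2 haM) (neg_nonneg.2 hml')]
      · simp
    rcases Nat.eq_zero_or_pos m with rfl | hm
    · refine fin f l 0 x κ' ν5 _ ke3 le5 ht fun ξ hξ => ?_
      rw [kap, if_neg hl]
      exact case2 ν5 ν3 hν5 l 0 ξ (by simp [hν3, hχ0' ξ hξ])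
    · refine fin f l m x κ' ν4 _ ke3 le4 ht fun ξ hξ => ?_
      rw [kap, if_neg hl]
      exact case2 ν4 ν2 hν4 l m ξ (by simp [hν2, (hχm m hm ξ hξ).1])
  · have hml' : (0 : ℝ) ≤ (m : ℝ) - l := by
      have : (l : ℝ) ≤ m := by exact_mod_cast hml
      linarith
    rcases Nat.eq_zero_or_pos m with rfl | hm
    · obtain rfl : l = 0 := by omega
      refine fin f 0 0 x κ0 ν3 0 ke4 le3 (by simp) fun ξ hξ => ?_
      simp [kap, dl_zero, hν3, hχ0' ξ hξ]
    have ht : (((2 * M : ℕ) : ℝ) * ((l : ℝ) - m)) + a * max ((m : ℝ) - l) 0 ≤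
        (min (-((2 * M : ℝ) - a) * ((m : ℝ) - l)) ((2 * N : ℝ) * ((m : ℝ) - l))) := by
      rw [max_eq_left hml', le_min_iff]
      push_cast
      have h1 : (0 : ℝ) ≤ 2 * N := by positivity
      constructor
      · nlinarith
      · nlinarith [mul_nonneg h1 hml', mul_nonneg (sub_nonneg.2 haM) hml']
    rcases Nat.eq_zero_or_pos l with rfl | hl
    · refine fin f 0 m x μ1 ν1 _ ke1 le1 ht fun ξ hξ => ?_
      rw [kap, if_pos rfl, ← dl_zero κ0]
      exact case1 κ0 μ1 hμ1 0 m hm ξ hξ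
    · refine fin f l m x μ2 ν1 _ ke2 le1 ht fun ξ hξ => ?_
      rw [kap, if_neg hl.ne']
      exact case1 κ μ2 hμ2 l m hm ξ hξ

end LM


namespace LM

open LineDeriv
open scoped ContDiff

lemma growth_one (f : TDist n E) (ν : Sch n) : ∃ (K : ℕ) (C : ℝ), 0 ≤ C ∧
    ∀ x, ‖mOp ν f x‖ ≤ C * (1 + ‖x‖) ^ K := by
  obtain ⟨K, M, h⟩ := growth f
  obtain ⟨C, hC, h⟩ := h ν
  refine ⟨K, C.toReal, ENNReal.toReal_nonneg, fun x => ?_⟩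
  have h1 := h 0 x
  rw [dl_zero, zero_mul, pow_zero, mul_one, W, ← ENNReal.ofReal_toReal hC.ne,
    ← ENNReal.ofReal_mul ENNReal.toReal_nonneg, ← ofReal_norm,
    ENNReal.ofReal_le_ofReal_iff (by positivity)] at h1
  simpa using h1

lemma tendsto_X [CompleteSpace E] (X : Sch n) (hX : X 0 = 1) (ν : Sch n) (f : TDist n E) (z : Rn n) :
    Tendsto (fun i => mOp (mulS (dl X i) ν) f z) atTop (𝓝 (mOp ν f z)) := by
  obtain ⟨K, C, hC, hb⟩ := growth_one f ν
  have e1 : ∀ i, mOp (mulS (dl X i) ν) f z =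
      ∫ y, (𝓕⁻ X : Sch n) y • mOp ν f (z - ((2 : ℝ) ^ i)⁻¹ • y) := by
    intro i
    rw [mOp_mul]
    have h := Measure.integral_comp_smul (volume : Measure (Rn n))
      (fun y : Rn n => (𝓕⁻ X : Sch n) y • mOp ν f (z - ((2 : ℝ) ^ i)⁻¹ • y)) ((2 : ℝ) ^ i)
    have h2 : (0 : ℝ) < 2 ^ i := by positivity
    rw [finrank_euclideanSpace_fin, abs_of_pos (by positivity)] at h
    have h3 : ∫ y, (𝓕⁻ (dl X i) : Sch n) y • mOp ν f (z - y) =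
       (((2 : ℝ) ^ i) ^ n : ℝ) • ∫ y, (𝓕⁻ X : Sch n) ((2 : ℝ) ^ i • y) •
          mOp ν f (z - ((2 : ℝ) ^ i)⁻¹ • (2 : ℝ) ^ i • y) := by
      rw [← integral_smul]
      refine integral_congr_ae (ae_of_all _ fun y => ?_)
      simp only [inv_dl_apply, smul_smul, inv_mul_cancel₀ h2.ne', one_smul, smul_assoc]
    rw [h3, h, smul_smul, mul_inv_cancel₀ (by positivity), one_smul]
  have e2 : mOp ν f z = ∫ y, (𝓕⁻ X : Sch n) y • mOp ν f z := by
    rw [integral_smul_const]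
    have : ∫ y, (𝓕⁻ X : Sch n) y = 1 := by
      have h1 : (𝓕 (𝓕⁻ X : Sch n) : Sch n) 0 = 1 := by
        rw [FourierTransform.fourier_fourierInv_eq, hX]
      rw [SchwartzMap.fourier_coe, Real.fourier_eq'] at h1
      simpa using h1
    rw [this, one_smul]
  simp_rw [e1]
  rw [e2]
  refine tendsto_integral_of_dominated_convergence
    (fun y => C * (1 + ‖z‖) ^ K * ((1 + ‖y‖) ^ K * ‖(𝓕⁻ X : Sch n) y‖)) ?_ ?_ ?_ ?_
  · intro i
    refine Continuous.aestronglyMeasurable ?_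
    exact (SchwartzMap.continuous _).smul ((mOp_cont ν f).comp (by fun_prop))
  · exact (integrable_decay _ K).const_mul _
  · intro i
    refine ae_of_all _ fun y => ?_
    rw [norm_smul]
    have h1 : ‖z - ((2 : ℝ) ^ i)⁻¹ • y‖ ≤ ‖z‖ + ‖y‖ := by
      refine (norm_sub_le _ _).trans ?_
      rw [norm_smul, norm_inv, norm_pow, Real.norm_ofNat]
      have : ((2 : ℝ) ^ i)⁻¹ ≤ 1 := inv_le_one_of_one_le₀ (one_le_pow₀ (by norm_num))
      nlinarith [norm_nonneg y]
    calc _ ≤ ‖(𝓕⁻ X : Sch n) y‖ * (C * ((1 + ‖z‖) * (1 + ‖y‖)) ^ K) := by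
          gcongr
          refine (hb _).trans ?_
          gcongr
          nlinarith [mul_nonneg (norm_nonneg z) (norm_nonneg y)]
      _ = _ := by rw [mul_pow]; ring
  · refine ae_of_all _ fun y => ?_
    refine Tendsto.const_smul ?_ _
    refine ((mOp_cont ν f).tendsto z).comp ?_
    have h1 : Tendsto (fun i : ℕ => ((2 : ℝ) ^ i)⁻¹) atTop (𝓝 0) :=
      tendsto_inv_atTop_zero.comp (tendsto_pow_atTop_atTop_of_one_lt (by norm_num))
    have h2 := (tendsto_const_nhds (x := z)).sub (h1.smul_const y)
    simpa using h2

lemma phi_sum {φ : ℕ → Sch n} (hφ : SmoothResolution n φ) (i : ℕ) (ξ : Rn n) (h : ‖ξ‖ ≤ 2 * 2 ^ i) :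
    ∑ m ∈ Finset.range (i + 3), φ m ξ = 1 := by
  rw [← hφ.sum_eq ξ, tsum_eq_sum]
  intro m hm
  by_contra h0
  have hm' : i + 3 ≤ m := by simpa using hm
  have h1 := phi_le_norm hφ (by omega) h0
  have h2 : (2 : ℝ) ^ (i + 3) ≤ 2 ^ m := pow_le_pow_right₀ (by norm_num) hm'
  rw [pow_add] at h2
  have : (0 : ℝ) < 2 ^ i := by positivity
  linarith

theorem M1 [CompleteSpace E] {φ : ℕ → Sch n} (hφ : SmoothResolution n φ) (κ0 κ κ' : Sch n) (N : ℕ)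
    (hκ : ∀ x, κ x = ((‖x‖ ^ 2) ^ N : ℝ) * κ' x) (a M : ℕ) (ha : a ≤ 2 * M) :
    ∃ C : ℝ≥0∞, C ≠ ⊤ ∧ ∀ (f : TDist n E) (l : ℕ) (x : Rn n),
      star a l (mOp (kap κ0 κ l) f) x ≤
        C * ∑' m : ℕ, two (min (-((2 * M : ℝ) - a) * ((m : ℝ) - l)) ((2 * N : ℝ) * ((m : ℝ) - l))) *
          star a m (mOp (φ m) f) x := by
  obtain ⟨C, hC, h⟩ := factor (E := E) hφ κ0 κ κ' N hκ a M ha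
  obtain ⟨χ0, χ0s, χ0c, χ01, χ0t⟩ := exists_chi0 (n := n) (ρ := 1) (by norm_num)
  obtain ⟨X, hX⟩ := exists_div χ0 (fun _ => 1) χ0s χ0c contDiff_const (by simp)
  have X0 : X 0 = 1 := by rw [hX, χ01 0 (by simp)]; simp
  have Xs : ∀ i ξ, dl X i ξ ≠ 0 → ‖ξ‖ ≤ 2 * 2 ^ i := by
    intro i ξ h
    rw [dl_apply, hX, div_one] at h
    have h1 := χ0t _ (subset_tsupport _ h)
    rw [norm_smul, norm_inv, norm_pow, Real.norm_ofNat, inv_mul_eq_div, div_le_iff₀ (by positivity)] at h1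
    linarith
  refine ⟨AA a 0 X * C, ENNReal.mul_ne_top (AA_lt_top _ _ _).ne hC, fun f l x => star_le fun y => ?_⟩
  have hlim := (tendsto_X X X0 (kap κ0 κ l) f y).enorm
  refine le_of_tendsto hlim ?_
  filter_upwards [eventually_ge_atTop l] with i hi
  have e : mulS (dl X i) (kap κ0 κ l) =
      mulS (dl X i) (∑ m ∈ Finset.range (i + 3), mulS (kap κ0 κ l) (φ m)) := by
    ext ξ
    rw [mulS_apply, mulS_apply]
    by_cases h0 : dl X i ξ = 0
    · simp [h0]
    · rw [_root_.sum_apply]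
      simp only [mulS_apply]
      rw [← Finset.mul_sum, phi_sum hφ i ξ (Xs i ξ h0), mul_one]
  refine (le_star a l _ x y).trans ?_
  gcongr
  rw [e]
  refine (star_mul a l _ _ f x).trans ?_
  rw [mul_assoc]
  gcongr
  · refine (AA_le a l i _).trans ?_
    rw [Nat.sub_eq_zero_of_le hi, AA_dl]; simp
  · refine (star_sum _ a l _ f x).trans ?_
    rw [← ENNReal.tsum_mul_left]
    refine (Finset.sum_le_sum fun m _ => ?_).trans (ENNReal.sum_le_tsum (Finset.range (i + 3)))
    rw [← mul_assoc]
    exact h f l m x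

/-- decay exponent -/
def ee (A B : ℝ) (d : ℝ) : ℝ := min (-A * d) (B * d)

lemma ee_add (A B d d' : ℝ) : ee A B d + ee A B d' ≤ ee A B (d + d') := by
  unfold ee
  refine le_min ?_ ?_
  · rw [mul_add]; exact add_le_add (min_le_left _ _) (min_le_left _ _)
  · rw [mul_add]; exact add_le_add (min_le_right _ _) (min_le_right _ _)

lemma ee_zero (A B : ℝ) : ee A B 0 = 0 := by simp [ee]

/-- geometric sum -/
lemma geo (ε : ℝ) (hε : 0 < ε) : ∃ C : ℝ≥0∞, C ≠ ⊤ ∧ ∀ l : ℕ,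
    ∑' m : ℕ, two (-ε * |(m : ℝ) - l|) ≤ C := by
  obtain ⟨r, hr0⟩ : ∃ r, r = two (-ε) := ⟨_, rfl⟩
  have hr : r < 1 := by
    rw [hr0]
    exact ENNReal.rpow_lt_one_of_one_lt_of_neg (by norm_num) (by linarith)
  have tw : ∀ k : ℕ, two (-ε * k) = r ^ k := by
    intro k
    rw [hr0, ← ENNReal.rpow_natCast, two_rpow]
  have h1 : ∀ l m : ℕ, two (-ε * |(m : ℝ) - l|) ≤ r ^ (m - l) * r ^ (l - m) := by
    intro l m
    rw [← pow_add, ← tw]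
    apply two_mono
    rcases le_total l m with h | h
    · rw [Nat.sub_eq_zero_of_le h, add_zero, Nat.cast_sub h, abs_of_nonneg]
      simpa using h
    · rw [Nat.sub_eq_zero_of_le h, zero_add, Nat.cast_sub h, abs_of_nonpos]
      · simp
      · simpa using h
  have h2 : ∀ l : ℕ, ∑ m ∈ Finset.range l, r ^ (l - m) ≤ (1 - r)⁻¹ := by
    intro l
    rw [← ENNReal.tsum_geometric]
    have : ∑ m ∈ Finset.range l, r ^ (l - m) ≤ ∑ m ∈ Finset.range (l + 1), r ^ m := by
      rw [← Finset.sum_range_reflect _ (l + 1)]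
      refine (Finset.sum_le_sum_of_subset (Finset.range_mono (Nat.le_succ l))).trans ?_
      refine Finset.sum_le_sum fun m _ => le_of_eq ?_
      congr 1
    exact this.trans (ENNReal.sum_le_tsum _)
  refine ⟨2 * (1 - r)⁻¹, ?_, fun l => ?_⟩
  · refine ENNReal.mul_ne_top (by simp) ?_
    rw [Ne, ENNReal.inv_eq_top, tsub_eq_zero_iff_le]
    exact not_le.2 hr
  refine (ENNReal.tsum_le_tsum fun m => h1 l m).trans ?_
  rw [← Summable.sum_add_tsum_nat_add' (f := fun m => r ^ (m - l) * r ^ (l - m)) (k := l) ENNReal.summable, two_mul]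
  refine add_le_add ?_ ?_
  · refine le_trans (Finset.sum_le_sum fun m _ => ?_) (h2 l)
    exact mul_le_of_le_one_left (by simp) (pow_le_one₀ (by simp) hr.le)
  · rw [← ENNReal.tsum_geometric]
    refine ENNReal.tsum_le_tsum fun k => ?_
    simp

/-- supremum form -/
theorem M1' [CompleteSpace E] {φ : ℕ → Sch n} (hφ : SmoothResolution n φ) (κ0 κ κ' : Sch n) (N : ℕ)
    (hκ : ∀ x, κ x = ((‖x‖ ^ 2) ^ N : ℝ) * κ' x) (a : ℕ) (A B : ℝ) (hAB : 0 ≤ A + B) (hB : B < 2 * N) :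
    ∃ C : ℝ≥0∞, C ≠ ⊤ ∧ ∀ (f : TDist n E) (l : ℕ) (x : Rn n),
      star a l (mOp (kap κ0 κ l) f) x ≤
        C * ⨆ m : ℕ, two (ee A B ((m : ℝ) - l)) * star a m (mOp (φ m) f) x := by
  obtain ⟨M, hM⟩ := exists_nat_ge (max (max (a : ℝ) (a + (2 * N - B) - B)) (A + a + (2 * N - B)))
  have hM1 := ((le_max_left _ _).trans (le_max_left _ _)).trans hM
  have hM3 := ((le_max_right _ _).trans (le_max_left _ _)).trans hM
  have hM2 := (le_max_right _ _).trans hM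
  have hM0 : (0 : ℝ) ≤ M := by positivity
  obtain ⟨C, hC, h⟩ := M1 (E := E) hφ κ0 κ κ' N hκ a M (by
    have : a ≤ M := by exact_mod_cast hM1
    omega)
  obtain ⟨G, hG, hg⟩ := geo (2 * N - B) (by linarith)
  refine ⟨C * G, ENNReal.mul_ne_top hC hG, fun f l x => (h f l x).trans ?_⟩
  rw [mul_assoc]
  gcongr
  refine le_trans ?_ (mul_le_mul_left (hg l) _)
  rw [← ENNReal.tsum_mul_right]
  refine ENNReal.tsum_le_tsum fun m => ?_
  refine le_trans ?_ (mul_le_mul_right (le_iSup (fun m : ℕ => two (ee A B ((m : ℝ) - l)) *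
    star a m (mOp (φ m) f) x) m) _)
  rw [← mul_assoc, ← two_add]
  gcongr
  apply two_mono
  unfold ee
  rcases le_total 0 ((m : ℝ) - l) with hd | hd
  · rw [abs_of_nonneg hd, ← sub_le_iff_le_add']
    refine le_min ?_ ?_
    · have := min_le_left (-((2 * M : ℝ) - a) * ((m : ℝ) - l)) ((2 * N : ℝ) * ((m : ℝ) - l))
      nlinarith
    · have := min_le_right (-((2 * M : ℝ) - a) * ((m : ℝ) - l)) ((2 * N : ℝ) * ((m : ℝ) - l))
      have := min_le_left (-((2 * M : ℝ) - a) * ((m : ℝ) - l)) ((2 * N : ℝ) * ((m : ℝ) - l))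
      nlinarith
  · rw [abs_of_nonpos hd, ← sub_le_iff_le_add']
    refine le_min ?_ ?_
    · have := min_le_right (-((2 * M : ℝ) - a) * ((m : ℝ) - l)) ((2 * N : ℝ) * ((m : ℝ) - l))
      have := min_le_left (-((2 * M : ℝ) - a) * ((m : ℝ) - l)) ((2 * N : ℝ) * ((m : ℝ) - l))
      nlinarith
    · have := min_le_right (-((2 * M : ℝ) - a) * ((m : ℝ) - l)) ((2 * N : ℝ) * ((m : ℝ) - l))
      linarith

end LM


namespace LM

open LineDeriv
open scoped ContDiff

/-- the averaged quantity -/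
def II (a l : ℕ) (r : ℝ) (g : Rn n → E) (x : Rn n) : ℝ≥0∞ :=
  ∫⁻ y, (2 ^ l) ^ n * ((W a l (x - y))⁻¹ ^ r * ‖g y‖ₑ ^ r)

lemma kernel_bd (β : Sch n) (a : ℕ) : ∃ C : ℝ≥0∞, C ≠ ⊤ ∧ ∀ l y,
    ‖(𝓕⁻ (dl β l) : Sch n) y‖ₑ ≤ C * (2 ^ l) ^ n * (W a l y)⁻¹ := by
  obtain ⟨C, hC, h⟩ := decayS (𝓕⁻ β : Sch n) a
  refine ⟨ENNReal.ofReal C, ENNReal.ofReal_ne_top, fun l y => ?_⟩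
  rw [← ENNReal.div_eq_inv_mul.trans (mul_comm _ _),
    ENNReal.le_div_iff_mul_le (Or.inl (W_ne_zero _ _ _)) (Or.inl (W_ne_top _ _ _)), enorm_inv_dl]
  have : ‖(𝓕⁻ β : Sch n) ((2 : ℝ) ^ l • y)‖ₑ * W a l y ≤ ENNReal.ofReal C := by
    have e := W_smul a l 0 y
    rw [zero_add] at e
    rw [← e, W, ← ofReal_norm, ← ENNReal.ofReal_mul (norm_nonneg _)]
    apply ENNReal.ofReal_le_ofReal
    have := h ((2 : ℝ) ^ l • y)
    rw [pow_zero, one_mul]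
    linarith
  calc _ = (2 ^ l) ^ n * (‖(𝓕⁻ β : Sch n) ((2 : ℝ) ^ l • y)‖ₑ * W a l y) := by ring
    _ ≤ (2 ^ l) ^ n * ENNReal.ofReal C := by gcongr
    _ = _ := by ring

lemma split_rpow {r : ℝ} (h0 : 0 ≤ r) (h1 : r ≤ 1) (t : ℝ≥0∞) : t = t ^ (1 - r) * t ^ r := by
  rw [← ENNReal.rpow_add_of_nonneg _ _ (by linarith) h0]; simp

lemma M2 [CompleteSpace E] (μ ν : Sch n) (a l : ℕ) (C : ℝ≥0∞)
    (hk : ∀ y, ‖(𝓕⁻ μ : Sch n) y‖ₑ ≤ C * (2 ^ l) ^ n * (W a l y)⁻¹) {r : ℝ} (h0 : 0 ≤ r) (h1 : r ≤ 1)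
    (f : TDist n E) (x : Rn n) :
    star a l (mOp (mulS μ ν) f) x ≤ C * ((star a l (mOp ν f) x) ^ (1 - r) * II a l r (mOp ν f) x) := by
  refine star_le fun z => ?_
  rw [mOp_mul]
  refine (enorm_integral_le_lintegral_enorm _).trans ?_
  rw [← lintegral_sub_left_eq_self _ z]
  set G := mOp ν f with hG
  set S := star a l G x with hS
  have hGm : Measurable fun y => ‖G y‖ₑ := (mOp_cont ν f).enorm.measurable
  calc ∫⁻ y, ‖(𝓕⁻ μ : Sch n) (z - y) • G (z - (z - y))‖ₑ
      ≤ ∫⁻ y, (C * S ^ (1 - r) * W a l (x - z)) *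
          ((2 ^ l) ^ n * ((W a l (x - y))⁻¹ ^ r * ‖G y‖ₑ ^ r)) := by
        refine lintegral_mono fun y => ?_
        rw [enorm_smul, sub_sub_cancel]
        have e1 : (W a l (z - y))⁻¹ ≤ W a l (x - z) * (W a l (x - y))⁻¹ := by
          rw [← ENNReal.div_eq_inv_mul.trans (mul_comm _ _), ENNReal.le_div_iff_mul_le
            (Or.inl (W_ne_zero _ _ _)) (Or.inl (W_ne_top _ _ _)), mul_comm, ← ENNReal.div_eq_inv_mul.trans (mul_comm _ _),
            ENNReal.div_le_iff (W_ne_zero _ _ _) (W_ne_top _ _ _)]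
          have := W_add a l (x - z) (z - y)
          rwa [sub_add_sub_cancel] at this
        have e2 : ‖G y‖ₑ ≤ (S ^ (1 - r) * (W a l (x - y)) ^ (1 - r)) * ‖G y‖ₑ ^ r := by
          conv_lhs => rw [split_rpow h0 h1 ‖G y‖ₑ]
          rw [← ENNReal.mul_rpow_of_nonneg _ _ (by linarith)]
          gcongr
          exact le_star a l G x y
        have e3 : (W a l (x - y))⁻¹ * (W a l (x - y)) ^ (1 - r) = (W a l (x - y))⁻¹ ^ r := by
          conv_lhs => rw [split_rpow h0 h1 (W a l (x - y))⁻¹]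
          rw [mul_right_comm, ← ENNReal.mul_rpow_of_nonneg _ _ (by linarith : (0:ℝ) ≤ 1 - r),
            ENNReal.inv_mul_cancel (W_ne_zero _ _ _) (W_ne_top _ _ _), ENNReal.one_rpow, one_mul]
        calc _ ≤ (C * (2 ^ l) ^ n * (W a l (x - z) * (W a l (x - y))⁻¹)) *
              ((S ^ (1 - r) * (W a l (x - y)) ^ (1 - r)) * ‖G y‖ₑ ^ r) := by
                gcongr
                exact (hk _).trans (by gcongr)
          _ = (C * S ^ (1 - r) * W a l (x - z)) * ((2 ^ l) ^ n *
              (((W a l (x - y))⁻¹ * (W a l (x - y)) ^ (1 - r)) * ‖G y‖ₑ ^ r)) := by ring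
          _ = _ := by rw [e3]
    _ = (C * S ^ (1 - r) * W a l (x - z)) * II a l r G x := by
        rw [lintegral_const_mul]
        · rfl
        · refine measurable_const.mul (Measurable.mul ?_ (hGm.pow_const r))
          exact (((W_cont a l).measurable.comp (measurable_const.sub measurable_id)).inv).pow_const r
    _ = _ := by ring

lemma absorb {S C T : ℝ≥0∞} {r : ℝ} (h0 : 0 < r) (h1 : r ≤ 1) (h : S ≤ C * (S ^ (1 - r) * T))
    (hS : S ≠ ⊤ ∨ r = 1) : S ≤ (C * T) ^ (1 / r) := by
  rcases eq_or_ne S 0 with rfl | hS0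
  · simp
  rw [one_div, ENNReal.le_rpow_inv_iff h0]
  rcases hS with hS | rfl
  · have e := split_rpow h0.le h1 S
    have p0 : S ^ (1 - r) ≠ 0 := by
      rw [Ne, ENNReal.rpow_eq_zero_iff]; push Not; exact ⟨fun h => absurd h hS0, fun h => absurd h hS⟩
    have p1 : S ^ (1 - r) ≠ ⊤ := ENNReal.rpow_ne_top_of_nonneg (by linarith) hS
    rw [← ENNReal.mul_le_mul_iff_right p0 p1, ← e]
    calc S ≤ _ := h
      _ = _ := by ring
  · simpa using h

/-- Peetre type estimate -/
theorem peetre [CompleteSpace E] {φ : ℕ → Sch n} (hφ : SmoothResolution n φ) (a : ℕ) :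
    ∃ C : ℝ≥0∞, C ≠ ⊤ ∧ ∀ (f : TDist n E) (m : ℕ) (x : Rn n) (r : ℝ), 0 ≤ r → r ≤ 1 →
      star a m (mOp (φ m) f) x ≤
        C * ((star a m (mOp (φ m) f) x) ^ (1 - r) * II a m r (mOp (φ m) f) x) := by
  obtain ⟨χ, χs, χc, χ1, χt⟩ := exists_chi (n := n)
  obtain ⟨χ0, χ0s, χ0c, χ01, χ0t⟩ := exists_chi0 (n := n) (ρ := 2) (by norm_num)
  obtain ⟨ν2, hν2⟩ := exists_div χ (fun _ => 1) χs χc contDiff_const (by simp)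
  obtain ⟨ν3, hν3⟩ := exists_div χ0 (fun _ => 1) χ0s χ0c contDiff_const (by simp)
  obtain ⟨C2, hC2, k2⟩ := kernel_bd ν2 a
  obtain ⟨C3, hC3, k3⟩ := kernel_bd ν3 a
  refine ⟨C2 + C3, by simp [hC2, hC3], fun f m x r h0 h1 => ?_⟩
  rcases Nat.eq_zero_or_pos m with rfl | hm
  · have e : φ 0 = mulS (dl ν3 0) (φ 0) := by
      ext ξ
      rw [mulS_apply, dl_zero, hν3]
      by_cases h : φ 0 ξ = 0
      · simp [h]
      · rw [χ01 ξ (by simpa using phi_norm_le hφ h)]; simp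
    have := M2 (dl ν3 0) (φ 0) a 0 C3 (k3 0) h0 h1 f x
    rw [← e] at this
    exact this.trans (by gcongr; exact le_add_self)
  · have e : φ m = mulS (dl ν2 m) (φ m) := by
      ext ξ
      rw [mulS_apply, dl_apply, hν2]
      by_cases h : φ m ξ = 0
      · simp [h]
      · have h1 := phi_norm_le hφ h
        have h2 := phi_le_norm hφ hm h
        have h3 : (0 : ℝ) < 2 ^ m := by positivity
        rw [χ1]
        · simp
        · rw [norm_smul, norm_inv, Real.norm_of_nonneg h3.le, inv_mul_eq_div, le_div_iff₀ h3]; linarith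
        · rw [norm_smul, norm_inv, Real.norm_of_nonneg h3.le, inv_mul_eq_div, div_le_iff₀ h3]; linarith
    have := M2 (dl ν2 m) (φ m) a m C2 (k2 m) h0 h1 f x
    rw [← e] at this
    exact this.trans (by gcongr; exact le_self_add)

end LM


namespace LM

open LineDeriv
open scoped ContDiff

lemma ts_le {u : Rn n → ℂ} {S : Set (Rn n)} (hS : IsClosed S) (h : ∀ x, u x ≠ 0 → x ∈ S) :
    tsupport u ⊆ S := closure_minimal (fun x hx => h x hx) hS

lemma ball_ne {κ : Sch n} (h : κ 0 ≠ 0) : ∃ δ > 0, ∀ x : Rn n, ‖x‖ ≤ δ → κ x ≠ 0 := by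
  have := (κ.continuous.continuousAt (x := 0)).eventually_ne h
  obtain ⟨δ, hδ, h⟩ := Metric.eventually_nhds_iff.1 this
  refine ⟨δ / 2, by positivity, fun x hx => h ?_⟩
  rw [dist_zero_right]; linarith

theorem Bpart [CompleteSpace E] {φ : ℕ → Sch n} (hφ : SmoothResolution n φ) (κ0 κ κ' : Sch n) (N : ℕ)
    (hκ : ∀ x, κ x = ((‖x‖ ^ 2) ^ N : ℝ) * κ' x) (h00 : κ0 0 ≠ 0) (h00' : κ' 0 ≠ 0) (a : ℕ) :
    ∃ c0 : ℕ, ∃ C : ℝ≥0∞, C ≠ ⊤ ∧ ∀ (f : TDist n E) (m : ℕ) (x : Rn n) (r : ℝ), 0 ≤ r → r ≤ 1 →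
      ∃ l, m ≤ l ∧ l ≤ m + c0 ∧ star a m (mOp (φ m) f) x ≤
        C * ((star a l (mOp (kap κ0 κ l) f) x) ^ (1 - r) * II a l r (mOp (kap κ0 κ l) f) x) := by
  obtain ⟨χ, χs, χc, χ1, χt⟩ := exists_chi (n := n)
  obtain ⟨χ0, χ0s, χ0c, χ01, χ0t⟩ := exists_chi0 (n := n) (ρ := 2) (by norm_num)
  obtain ⟨ρ, hρ, hκ0⟩ := ball_ne h00
  obtain ⟨δ, hδ, hκ'⟩ := ball_ne h00'
  obtain ⟨X, Xs, Xc, X1, Xt⟩ := exists_chi0 (n := n) (ρ := ρ / 2) (by positivity)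
  obtain ⟨c, hc⟩ := pow_unbounded_of_one_lt (4 / δ) (one_lt_two (α := ℝ))
  let c0 := c + 1
  have hc0 : 4 ≤ δ * 2 ^ c0 := by
    rw [div_lt_iff₀ hδ] at hc
    have : (2 : ℝ) ^ c0 = 2 * 2 ^ c := by simp [c0, pow_succ, mul_comm]
    rw [this]
    nlinarith [mul_pos (pow_pos (two_pos (α := ℝ)) c) hδ]
  have hc00 : c0 ≠ 0 := by simp [c0]
  have p2 : (0 : ℝ) < 2 ^ c0 := by positivity
  have nsm : ∀ x : Rn n, ‖(2 : ℝ) ^ c0 • x‖ = 2 ^ c0 * ‖x‖ := by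
    intro x; rw [norm_smul, norm_pow, Real.norm_ofNat]
  have κne : ∀ x : Rn n, 2 ^ c0 * ‖x‖ ≤ 4 → 0 < ‖x‖ → κ x ≠ 0 := by
    intro x h1 h2
    rw [hκ]
    refine mul_ne_zero ?_ (hκ' x ?_)
    · rw [Complex.ofReal_ne_zero]; positivity
    · have : 2 ^ c0 * ‖x‖ ≤ 2 ^ c0 * δ := by linarith
      exact le_of_mul_le_mul_left this p2
  have cont1 : Continuous fun x : Rn n => 2 ^ c0 * ‖x‖ := by fun_prop
  -- the three symbols
  obtain ⟨β, hβ⟩ := exists_div (fun x => χ ((2 : ℝ) ^ c0 • x)) κ (χs.comp (contDiff_const_smul _))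
    (χc.comp_smul p2.ne') (κ.smooth _) (by
      intro x hx
      have hcl : IsClosed {x : Rn n | 1 / 4 ≤ 2 ^ c0 * ‖x‖ ∧ 2 ^ c0 * ‖x‖ ≤ 4} :=
        (isClosed_le continuous_const cont1).inter (isClosed_le cont1 continuous_const)
      obtain ⟨h1, h2⟩ := ts_le hcl (fun x hx => by
        have := χt _ (subset_tsupport _ hx)
        rwa [nsm] at this) hx
      refine κne x h2 ?_
      by_contra h3
      have : ‖x‖ = 0 := le_antisymm (not_lt.1 h3) (norm_nonneg _)
      rw [this] at h1; norm_num at h1)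
  obtain ⟨β0, hβ0⟩ := exists_div X κ0 Xs Xc (κ0.smooth _) (fun x hx => hκ0 x (by
    have := Xt x hx; linarith))
  obtain ⟨β1, hβ1⟩ := exists_div (fun x => (1 - X ((2 : ℝ) ^ c0 • x)) * χ0 ((2 : ℝ) ^ c0 • x)) κ
    ((contDiff_const.sub (Xs.comp (contDiff_const_smul _))).mul (χ0s.comp (contDiff_const_smul _)))
    ((χ0c.comp_smul p2.ne').mul_left) (κ.smooth _) (by
      intro x hx
      have hcl : IsClosed {x : Rn n | ρ / 2 ≤ 2 ^ c0 * ‖x‖ ∧ 2 ^ c0 * ‖x‖ ≤ 4} :=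
        (isClosed_le continuous_const cont1).inter (isClosed_le cont1 continuous_const)
      obtain ⟨h1, h2⟩ := ts_le hcl (fun x hx => by
        have h1 := left_ne_zero_of_mul hx
        have h2 := χ0t _ (subset_tsupport _ (right_ne_zero_of_mul hx))
        rw [nsm] at h2
        refine ⟨?_, by linarith⟩
        by_contra h3
        rw [X1 _ (by rw [nsm]; linarith)] at h1
        simp at h1) hx
      refine κne x h2 ?_
      by_contra h3
      have : ‖x‖ = 0 := le_antisymm (not_lt.1 h3) (norm_nonneg _)
      rw [this] at h1; linarith)
  obtain ⟨D, hD, kD⟩ := kernel_bd β a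
  obtain ⟨D0, hD0, kD0⟩ := kernel_bd β0 a
  obtain ⟨D1, hD1, kD1⟩ := kernel_bd β1 a
  obtain ⟨Cφ, hCφ, hAA⟩ := AA_phi hφ a
  let P : ℝ≥0∞ := 2 ^ (a * c0)
  have hP : P ≠ ⊤ := by simp [P]
  have hP1 : 1 ≤ P := one_le_pow₀ (by norm_num)
  refine ⟨c0, P * P * Cφ * (D + 2 * (D0 + D1)), ?_, fun f m x r h0 h1 => ?_⟩
  · finiteness
  rcases Nat.eq_zero_or_pos m with rfl | hm
  · have e : φ 0 = mulS (φ 0) (mulS (dl β0 0) (kap κ0 κ 0) + mulS (dl β1 c0) (kap κ0 κ c0)) := by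
      ext ξ
      rw [mulS_apply]
      by_cases h : φ 0 ξ = 0
      · simp [h]
      have hξ : ‖ξ‖ ≤ 2 := by simpa using phi_norm_le hφ h
      have : (mulS (dl β0 0) (kap κ0 κ 0) + mulS (dl β1 c0) (kap κ0 κ c0)) ξ = 1 := by
        rw [_root_.add_apply, mulS_apply, mulS_apply, kap, kap, if_pos rfl, if_neg hc00, dl_zero,
          dl_apply, dl_apply, hβ0, hβ1, smul_smul, mul_inv_cancel₀ p2.ne', one_smul, χ01 ξ hξ, mul_one]
        have t1 : X ξ / κ0 ξ * κ0 ξ = X ξ := by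
          by_cases hX : X ξ = 0
          · simp [hX]
          · refine div_mul_cancel₀ _ (hκ0 ξ ?_)
            have := Xt ξ (subset_tsupport _ hX); linarith
        have t2 : (1 - X ξ) / κ (((2 : ℝ) ^ c0)⁻¹ • ξ) * κ (((2 : ℝ) ^ c0)⁻¹ • ξ) = 1 - X ξ := by
          by_cases hX : ‖ξ‖ ≤ ρ / 2
          · simp [X1 ξ hX]
          · refine div_mul_cancel₀ _ (κne _ ?_ ?_)
            · rw [← nsm, smul_smul, mul_inv_cancel₀ p2.ne', one_smul]; linarith
            · rw [norm_smul, norm_inv, norm_pow, Real.norm_ofNat]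
              have : 0 < ‖ξ‖ := by linarith
              positivity
        rw [t1, t2]; ring
      rw [this, mul_one]
    have s1 : star a 0 (mOp (φ 0) f) x ≤ Cφ * (star a 0 (mOp (mulS (dl β0 0) (kap κ0 κ 0)) f) x +
        P * star a c0 (mOp (mulS (dl β1 c0) (kap κ0 κ c0)) f) x) := by
      conv_lhs => rw [e]
      refine (star_mul a 0 _ _ f x).trans ?_
      gcongr
      · exact hAA 0
      · refine (star_add a 0 _ _ f x).trans ?_
        gcongr
        exact star_scale a c0 0 _ x
    have s2 := M2 (dl β0 0) (kap κ0 κ 0) a 0 D0 (kD0 0) h0 h1 f x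
    have s3 := M2 (dl β1 c0) (kap κ0 κ c0) a c0 D1 (kD1 c0) h0 h1 f x
    set T0 := (star a 0 (mOp (kap κ0 κ 0) f) x) ^ (1 - r) * II a 0 r (mOp (kap κ0 κ 0) f) x
    set T1 := (star a c0 (mOp (kap κ0 κ c0) f) x) ^ (1 - r) * II a c0 r (mOp (kap κ0 κ c0) f) x
    have fin : ∀ T, T0 ≤ T → T1 ≤ T → star a 0 (mOp (φ 0) f) x ≤
        P * P * Cφ * (D + 2 * (D0 + D1)) * T := by
      intro T hT0 hT1
      calc _ ≤ Cφ * ((D0 + D1) * T + P * ((D0 + D1) * T)) := by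
            refine s1.trans ?_
            gcongr
            · exact s2.trans (by gcongr; exact le_self_add)
            · exact s3.trans (by gcongr; exact le_add_self)
        _ ≤ Cφ * (P * P * ((D0 + D1) * T) + P * P * ((D0 + D1) * T)) := by
            have i1 : P ≤ P * P := le_mul_of_one_le_left (by simp) hP1
            have i2 : (D0 + D1) * T ≤ P * P * ((D0 + D1) * T) :=
              le_mul_of_one_le_left (by simp) (hP1.trans i1)
            exact mul_le_mul_right (add_le_add i2 (mul_le_mul_left i1 _)) _
        _ = P * P * Cφ * (2 * (D0 + D1)) * T := by ring
        _ ≤ _ := by gcongr; exact le_add_self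
    rcases le_total T0 T1 with h | h
    · exact ⟨c0, Nat.zero_le _, by omega, fin T1 h le_rfl⟩
    · exact ⟨0, le_rfl, Nat.zero_le _, fin T0 le_rfl h⟩
  · let l := m + c0
    have e : φ m = mulS (φ m) (mulS (dl β l) (kap κ0 κ l)) := by
      ext ξ
      rw [mulS_apply]
      by_cases h : φ m ξ = 0
      · simp [h]
      have g1 := phi_norm_le hφ h
      have g2 := phi_le_norm hφ hm h
      have p3 : (0 : ℝ) < 2 ^ m := by positivity
      have g0 : 0 < ‖ξ‖ := by linarith
      have : mulS (dl β l) (kap κ0 κ l) ξ = 1 := by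
        rw [mulS_apply, kap, if_neg (by simp only [l]; omega), dl_apply, dl_apply, hβ]
        have z1 : (2 : ℝ) ^ c0 • ((2 : ℝ) ^ l)⁻¹ • ξ = ((2 : ℝ) ^ m)⁻¹ • ξ := by
          rw [smul_smul]; congr 1; simp only [l, pow_add]; field_simp
        have z2 : ‖((2 : ℝ) ^ m)⁻¹ • ξ‖ = ‖ξ‖ / 2 ^ m := by
          rw [norm_smul, norm_inv, norm_pow, Real.norm_ofNat, inv_mul_eq_div]
        have z3 : ‖((2 : ℝ) ^ m)⁻¹ • ξ‖ ≤ 2 := by rw [z2, div_le_iff₀ p3]; linarith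
        rw [z1, χ1 _ (by rw [z2, le_div_iff₀ p3]; linarith) z3]
        refine div_mul_cancel₀ _ (κne _ ?_ ?_)
        · rw [← nsm, z1]; linarith
        · rw [norm_smul, norm_inv, norm_pow, Real.norm_ofNat]; positivity
      rw [this, mul_one]
    refine ⟨l, by simp [l], le_rfl, ?_⟩
    have s3 := M2 (dl β l) (kap κ0 κ l) a l D (kD l) h0 h1 f x
    have hlm : l - m = c0 := by simp [l]
    set T := (star a l (mOp (kap κ0 κ l) f) x) ^ (1 - r) * II a l r (mOp (kap κ0 κ l) f) x
    calc star a m (mOp (φ m) f) x ≤ P * star a l (mOp (φ m) f) x := by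
          have := star_scale a l m (mOp (φ m) f) x
          rwa [hlm] at this
      _ ≤ P * (AA a l (φ m) * star a l (mOp (mulS (dl β l) (kap κ0 κ l)) f) x) := by
          gcongr
          conv_lhs => rw [e]
          exact star_mul a l _ _ f x
      _ ≤ P * ((P * Cφ) * (D * T)) := by
          gcongr
          have := AA_le a l m (φ m)
          rw [hlm] at this
          exact this.trans (by gcongr; exact hAA m)
      _ = P * P * Cφ * D * T := by ring
      _ ≤ _ := by gcongr; exact le_self_add

end LM


namespace LM

open LineDeriv
open scoped ContDiff

/-- the controlling maximal function -/
def FF (φ : ℕ → Sch n) (a : ℕ) (A B : ℝ) (f : TDist n E) (j : ℕ) (x : Rn n) : ℝ≥0∞ :=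
  ⨆ m : ℕ, two (ee A B ((m : ℝ) - j)) * star a m (mOp (φ m) f) x

lemma FF_shift (φ : ℕ → Sch n) (a : ℕ) (A B : ℝ) (f : TDist n E) (j l : ℕ) (x : Rn n) :
    two (ee A B ((l : ℝ) - j)) * FF φ a A B f l x ≤ FF φ a A B f j x := by
  unfold FF
  rw [ENNReal.mul_iSup]
  refine iSup_le fun m => ?_
  refine le_trans ?_ (le_iSup (fun m : ℕ => two (ee A B ((m : ℝ) - j)) * star a m (mOp (φ m) f) x) m)
  rw [← mul_assoc, ← two_add]
  gcongr
  refine two_mono ((ee_add A B _ _).trans (le_of_eq ?_))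
  congr 1
  ring

lemma ee_small (A B : ℝ) (c d : ℝ) (h0 : 0 ≤ d) (h1 : d ≤ c) : -((|A| + |B|) * c) ≤ ee A B d := by
  unfold ee
  refine le_min ?_ ?_
  · nlinarith [neg_abs_le A, le_abs_self A, abs_nonneg B, abs_nonneg A, mul_nonneg (abs_nonneg B) (h0.trans h1), mul_nonneg (abs_nonneg A) (sub_nonneg.2 h1), mul_nonneg (sub_nonneg.2 (le_abs_self A)) h0]
  · nlinarith [neg_abs_le B, abs_nonneg A, mul_nonneg (abs_nonneg A) (h0.trans h1), mul_nonneg (abs_nonneg B) (sub_nonneg.2 h1), mul_nonneg (sub_nonneg.2 (neg_abs_le B)) h0]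

theorem closureB [CompleteSpace E] {φ : ℕ → Sch n} (hφ : SmoothResolution n φ) (κ0 κ κ' : Sch n) (N : ℕ)
    (hκ : ∀ x, κ x = ((‖x‖ ^ 2) ^ N : ℝ) * κ' x) (h00 : κ0 0 ≠ 0) (h00' : κ' 0 ≠ 0) (a : ℕ)
    (A B : ℝ) (hAB : 0 ≤ A + B) (hB : B < 2 * N) (r : ℝ) (hr : 0 < r) (hr1 : r ≤ 1) :
    ∃ C : ℝ≥0∞, C ≠ ⊤ ∧ ∀ (f : TDist n E) (j : ℕ) (x : Rn n), (FF φ a A B f j x ≠ ⊤ ∨ r = 1) →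
      ‖mOp (φ j) f x‖ₑ ≤
        C * ⨆ l : ℕ, two (ee A B ((l : ℝ) - j)) * (II a l r (mOp (kap κ0 κ l) f) x) ^ (1 / r) := by
  obtain ⟨C1, hC1, h1⟩ := M1' (E := E) hφ κ0 κ κ' N hκ a A B hAB hB
  obtain ⟨c0, C2, hC2, h2⟩ := Bpart (E := E) hφ κ0 κ κ' N hκ h00 h00' a
  have hr' : 0 ≤ 1 - r := by linarith
  let D := two ((|A| + |B|) * c0)
  let C := C2 * C1 ^ (1 - r) * D
  have hC : C ≠ ⊤ := ENNReal.mul_ne_top (ENNReal.mul_ne_top hC2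
    (ENNReal.rpow_ne_top_of_nonneg hr' hC1)) (two_ne_top _)
  refine ⟨C ^ (1 / r), ENNReal.rpow_ne_top_of_nonneg (by positivity) hC, fun f j x hfin => ?_⟩
  set H := ⨆ l : ℕ, two (ee A B ((l : ℝ) - j)) * (II a l r (mOp (kap κ0 κ l) f) x) ^ (1 / r) with hH
  have key : FF φ a A B f j x ≤ C * ((FF φ a A B f j x) ^ (1 - r) * H ^ r) := by
    refine iSup_le fun m => ?_
    obtain ⟨l, hl1, hl2, hl⟩ := h2 f m x r hr.le hr1
    have q1 : two (ee A B ((m : ℝ) - j)) ≤ D * two (ee A B ((l : ℝ) - j)) := by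
      rw [← two_add]
      apply two_mono
      have t1 := ee_add A B ((m : ℝ) - j) ((l : ℝ) - m)
      have t2 := ee_small A B c0 ((l : ℝ) - m) (by simpa using hl1) (by
        have : (l : ℝ) ≤ m + c0 := by exact_mod_cast hl2
        linarith)
      rw [show (m : ℝ) - j + (l - m) = l - j by ring] at t1
      linarith
    have q2 : two (ee A B ((l : ℝ) - j)) * ((FF φ a A B f l x) ^ (1 - r) * II a l r (mOp (kap κ0 κ l) f) x)
        ≤ (FF φ a A B f j x) ^ (1 - r) * H ^ r := by
      have s1 : two (ee A B ((l : ℝ) - j)) ^ (1 - r) * (FF φ a A B f l x) ^ (1 - r) ≤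
          (FF φ a A B f j x) ^ (1 - r) := by
        rw [← ENNReal.mul_rpow_of_nonneg _ _ hr']
        exact ENNReal.rpow_le_rpow (FF_shift φ a A B f j l x) hr'
      have s2 : two (ee A B ((l : ℝ) - j)) ^ r * II a l r (mOp (kap κ0 κ l) f) x ≤ H ^ r := by
        have : II a l r (mOp (kap κ0 κ l) f) x = ((II a l r (mOp (kap κ0 κ l) f) x) ^ (1 / r)) ^ r := by
          rw [← ENNReal.rpow_mul, one_div, inv_mul_cancel₀ hr.ne', ENNReal.rpow_one]
        rw [this, ← ENNReal.mul_rpow_of_nonneg _ _ hr.le]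
        refine ENNReal.rpow_le_rpow ?_ hr.le
        exact le_iSup (fun l : ℕ => two (ee A B ((l : ℝ) - j)) *
          (II a l r (mOp (kap κ0 κ l) f) x) ^ (1 / r)) l
      calc _ = (two (ee A B ((l : ℝ) - j)) ^ (1 - r) * (FF φ a A B f l x) ^ (1 - r)) *
            (two (ee A B ((l : ℝ) - j)) ^ r * II a l r (mOp (kap κ0 κ l) f) x) := by
              conv_lhs => rw [split_rpow hr.le hr1 (two (ee A B ((l : ℝ) - j)))]
              ring
        _ ≤ _ := mul_le_mul' s1 s2
    calc _ ≤ (D * two (ee A B ((l : ℝ) - j))) * (C2 * ((C1 * FF φ a A B f l x) ^ (1 - r) *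
          II a l r (mOp (kap κ0 κ l) f) x)) := by
            refine mul_le_mul' q1 (hl.trans ?_)
            gcongr
            exact h1 f l x
      _ = C * (two (ee A B ((l : ℝ) - j)) * ((FF φ a A B f l x) ^ (1 - r) *
          II a l r (mOp (kap κ0 κ l) f) x)) := by
            rw [ENNReal.mul_rpow_of_nonneg _ _ hr']; simp only [C]; ring
      _ ≤ _ := by gcongr
  have := absorb hr hr1 key hfin
  rw [ENNReal.mul_rpow_of_nonneg _ _ (by positivity), ← ENNReal.rpow_mul H, one_div,
    mul_inv_cancel₀ hr.ne', ENNReal.rpow_one, ← one_div] at this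
  refine le_trans ?_ this
  refine (le_star_self a j _ x).trans ?_
  refine le_trans ?_ (le_iSup (fun m : ℕ => two (ee A B ((m : ℝ) - j)) * star a m (mOp (φ m) f) x) j)
  simp [ee_zero, two_zero]

theorem closureA [CompleteSpace E] {φ : ℕ → Sch n} (hφ : SmoothResolution n φ) (κ0 κ κ' : Sch n) (N : ℕ)
    (hκ : ∀ x, κ x = ((‖x‖ ^ 2) ^ N : ℝ) * κ' x) (a : ℕ)
    (A B : ℝ) (hAB : 0 ≤ A + B) (hB : B < 2 * N) (r : ℝ) (hr : 0 < r) (hr1 : r ≤ 1) :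
    ∃ C : ℝ≥0∞, C ≠ ⊤ ∧ ∀ (f : TDist n E) (j : ℕ) (x : Rn n),
      ((∀ m, star a m (mOp (φ m) f) x ≠ ⊤) ∨ r = 1) →
      ‖mOp (kap κ0 κ j) f x‖ₑ ≤
        C * ⨆ m : ℕ, two (ee A B ((m : ℝ) - j)) * (II a m r (mOp (φ m) f) x) ^ (1 / r) := by
  obtain ⟨C1, hC1, h1⟩ := M1' (E := E) hφ κ0 κ κ' N hκ a A B hAB hB
  obtain ⟨C2, hC2, h2⟩ := peetre (E := E) hφ a
  refine ⟨C1 * C2 ^ (1 / r), ENNReal.mul_ne_top hC1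
    (ENNReal.rpow_ne_top_of_nonneg (by positivity) hC2), fun f j x hfin => ?_⟩
  refine (le_star_self a j _ x).trans ((h1 f j x).trans ?_)
  rw [mul_assoc, ENNReal.mul_iSup (_ ^ (1 / r))]
  refine mul_le_mul_right (iSup_mono fun m => ?_) _
  rw [mul_left_comm]
  refine mul_le_mul_right ?_ _
  rw [← ENNReal.mul_rpow_of_nonneg _ _ (by positivity)]
  exact absorb hr hr1 (h2 f m x r hr.le hr1) (hfin.imp_left fun h => h m)

/-- qualitative growth of the maximal functions -/
theorem star_growth [CompleteSpace E] {φ : ℕ → Sch n} (hφ : SmoothResolution n φ) (f : TDist n E) :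
    ∃ K M : ℕ, ∀ a, K ≤ a → ∃ C : ℝ≥0∞, C ≠ ⊤ ∧ ∀ m x,
      star a m (mOp (φ m) f) x ≤ C * 2 ^ (m * M) * W a 0 x := by
  obtain ⟨K, M, hg⟩ := growth f
  obtain ⟨χ0, χ0s, χ0c, χ01, χ0t⟩ := exists_chi0 (n := n) (ρ := 2) (by norm_num)
  obtain ⟨ν3, hν3⟩ := exists_div χ0 (fun _ => 1) χ0s χ0c contDiff_const (by simp)
  obtain ⟨C, hC, hg⟩ := hg ν3
  refine ⟨K, M, fun a ha => ?_⟩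
  obtain ⟨Cφ, hCφ, hAA⟩ := AA_phi hφ a
  refine ⟨Cφ * C, ENNReal.mul_ne_top hCφ hC.ne, fun m x => ?_⟩
  have e : φ m = mulS (φ m) (dl ν3 m) := by
    ext ξ
    rw [mulS_apply, dl_apply, hν3]
    by_cases h : φ m ξ = 0
    · simp [h]
    · have h1 := phi_norm_le hφ h
      have h3 : (0 : ℝ) < 2 ^ m := by positivity
      rw [χ01]
      · simp
      · rw [norm_smul, norm_inv, Real.norm_of_nonneg h3.le, inv_mul_eq_div, div_le_iff₀ h3]; linarith
  conv_lhs => rw [e]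
  refine (star_mul a m _ _ f x).trans ?_
  calc _ ≤ Cφ * (C * 2 ^ (m * M) * W a 0 x) := by
        gcongr
        · exact hAA m
        · refine star_le fun y => (hg m y).trans ?_
          rw [mul_assoc (C * 2 ^ (m * M))]
          gcongr
          have w1 : W K 0 y ≤ W a 0 y := by
            unfold W
            apply ENNReal.ofReal_le_ofReal
            exact pow_le_pow_right₀ (by simp) ha
          have w2 : W a 0 y ≤ W a 0 x * W a 0 (y - x) := by
            have := W_add a 0 x (y - x)
            rwa [add_sub_cancel] at this
          have w3 : W a 0 (y - x) ≤ W a m (x - y) := by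
            rw [← neg_sub, W_neg]
            have := W_le a 0 m (x - y)
            simpa using this
          exact w1.trans (w2.trans (by gcongr))
    _ = _ := by ring

lemma FF_fin (φ : ℕ → Sch n) (a : ℕ) (A B : ℝ) (f : TDist n E) (x : Rn n) (C : ℝ≥0∞) (hC : C ≠ ⊤) (t : ℝ)
    (ht : t ≤ A) (h : ∀ m : ℕ, star a m (mOp (φ m) f) x ≤ C * two (m * t)) (j : ℕ) :
    FF φ a A B f j x ≠ ⊤ := by
  refine ne_top_of_le_ne_top (b := C * two (A * j)) (ENNReal.mul_ne_top hC (two_ne_top _)) ?_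
  refine iSup_le fun m => ?_
  refine (mul_le_mul_right (h m) _).trans ?_
  rw [mul_left_comm, ← two_add]
  gcongr
  apply two_mono
  have : ee A B ((m : ℝ) - j) ≤ -A * (m - j) := min_le_left _ _
  have hm : (0 : ℝ) ≤ m := by positivity
  nlinarith [mul_le_mul_of_nonneg_left ht hm]

end LM


namespace LM

lemma le_lq {q : ℝ≥0∞} (hq : 0 < q) (a : ℕ → ℝ≥0∞) (j : ℕ) : a j ≤ lqSum q a := by
  unfold lqSum
  split_ifs with h
  · exact le_iSup a j
  · have h0 : 0 < q.toReal := ENNReal.toReal_pos hq.ne' h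
    rw [one_div, ENNReal.le_rpow_inv_iff h0]
    exact ENNReal.le_tsum j

lemma lq_mono {q : ℝ≥0∞} {a b : ℕ → ℝ≥0∞} (h : ∀ j, a j ≤ b j) : lqSum q a ≤ lqSum q b := by
  unfold lqSum
  split_ifs with hh
  · exact iSup_mono h
  · refine ENNReal.rpow_le_rpow (ENNReal.tsum_le_tsum fun j => ?_) (by positivity)
    exact ENNReal.rpow_le_rpow (h j) ENNReal.toReal_nonneg

lemma lq_const {q : ℝ≥0∞} (hq : 0 < q) (c : ℝ≥0∞) (a : ℕ → ℝ≥0∞) :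
    lqSum q (fun j => c * a j) = c * lqSum q a := by
  unfold lqSum
  split_ifs with h
  · rw [ENNReal.mul_iSup]
  · have h0 : 0 < q.toReal := ENNReal.toReal_pos hq.ne' h
    simp_rw [ENNReal.mul_rpow_of_nonneg _ _ h0.le]
    rw [ENNReal.tsum_mul_left, ENNReal.mul_rpow_of_nonneg _ _ (by positivity), ← ENNReal.rpow_mul,
      mul_one_div_cancel h0.ne', ENNReal.rpow_one]

lemma two_pow_r (t u : ℝ) : two t ^ u = two (t * u) := by
  unfold two; rw [← ENNReal.rpow_mul]

lemma two_le_one {t : ℝ} (h : t ≤ 0) : two t ≤ 1 := by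
  rw [← two_zero]; exact two_mono h

lemma lq_geo {q : ℝ≥0∞} (hq : 0 < q) {ε : ℝ} (hε : 0 < ε) : ∃ C : ℝ≥0∞, C ≠ ⊤ ∧
    ∀ j : ℕ, lqSum q (fun m : ℕ => two (-ε * |(m : ℝ) - j|)) ≤ C := by
  by_cases h : q = ⊤
  · refine ⟨1, by simp, fun j => ?_⟩
    unfold lqSum
    rw [if_pos h]
    refine iSup_le fun m => two_le_one ?_
    have := abs_nonneg ((m : ℝ) - j)
    nlinarith
  · have h0 : 0 < q.toReal := ENNReal.toReal_pos hq.ne' h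
    obtain ⟨C, hC, hg⟩ := geo (ε := ε * q.toReal) (by positivity)
    refine ⟨C ^ (1 / q.toReal), ENNReal.rpow_ne_top_of_nonneg (by positivity) hC, fun j => ?_⟩
    unfold lqSum
    rw [if_neg h]
    refine ENNReal.rpow_le_rpow (le_trans (le_of_eq ?_) (hg j)) (by positivity)
    refine tsum_congr fun m => ?_
    rw [two_pow_r]; congr 1; ring

lemma lq_half {q : ℝ≥0∞} (hq : 0 < q) {ε : ℝ} (hε : 0 < ε) : ∃ C : ℝ≥0∞, C ≠ ⊤ ∧
    ∀ (j : ℕ) (b : ℕ → ℝ≥0∞), lqSum q (fun m : ℕ => two (-ε * |(m : ℝ) - j|) * b m) ≤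
      C * ⨆ m : ℕ, two (-(ε / 2) * |(m : ℝ) - j|) * b m := by
  obtain ⟨C, hC, hg⟩ := lq_geo hq (half_pos hε)
  refine ⟨C, hC, fun j b => ?_⟩
  set S := ⨆ m : ℕ, two (-(ε / 2) * |(m : ℝ) - j|) * b m with hS
  calc _ ≤ lqSum q (fun m : ℕ => S * two (-(ε / 2) * |(m : ℝ) - j|)) := by
        refine lq_mono fun m => ?_
        rw [show -ε * |(m : ℝ) - j| = -(ε / 2) * |(m : ℝ) - j| + -(ε / 2) * |(m : ℝ) - j| by ring,
          two_add, mul_assoc, mul_comm S]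
        exact mul_le_mul_right (le_iSup (fun m : ℕ => two (-(ε / 2) * |(m : ℝ) - j|) * b m) m) _
    _ ≤ _ := by
        rw [lq_const hq, mul_comm]
        exact mul_le_mul_left (hg j) _

lemma lq_young {q : ℝ≥0∞} (hq : 0 < q) {ε : ℝ} (hε : 0 < ε) : ∃ C : ℝ≥0∞, C ≠ ⊤ ∧
    ∀ (b : ℕ → ℝ≥0∞), lqSum q (fun j : ℕ => ⨆ m : ℕ, two (-ε * |(m : ℝ) - j|) * b m) ≤
      C * lqSum q b := by
  by_cases h : q = ⊤
  · refine ⟨1, by simp, fun b => ?_⟩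
    rw [one_mul]
    have : lqSum q (fun j : ℕ => ⨆ m : ℕ, two (-ε * |(m : ℝ) - j|) * b m) =
      ⨆ j : ℕ, ⨆ m : ℕ, two (-ε * |(m : ℝ) - j|) * b m := by
      unfold lqSum; rw [if_pos h]
    rw [this]
    refine iSup_le fun j => iSup_le fun m => ?_
    refine le_trans ?_ (le_lq hq b m)
    refine mul_le_of_le_one_left zero_le (two_le_one ?_)
    have := abs_nonneg ((m : ℝ) - j)
    nlinarith
  · have h0 : 0 < q.toReal := ENNReal.toReal_pos hq.ne' h
    obtain ⟨C, hC, hg⟩ := geo (ε := ε * q.toReal) (by positivity)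
    refine ⟨C ^ (1 / q.toReal), ENNReal.rpow_ne_top_of_nonneg (by positivity) hC, fun b => ?_⟩
    have key : ∀ j : ℕ, (⨆ m : ℕ, two (-ε * |(m : ℝ) - j|) * b m) ^ q.toReal ≤
        ∑' m : ℕ, two (-(ε * q.toReal) * |(m : ℝ) - j|) * b m ^ q.toReal := by
      intro j
      rw [← ENNReal.le_rpow_inv_iff h0]
      refine iSup_le fun m => ?_
      rw [ENNReal.le_rpow_inv_iff h0]
      refine le_trans (le_of_eq ?_) (ENNReal.le_tsum m)
      rw [ENNReal.mul_rpow_of_nonneg _ _ h0.le, two_pow_r]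
      congr 2; ring
    unfold lqSum
    rw [if_neg h, if_neg h, ← ENNReal.mul_rpow_of_nonneg _ _ (by positivity)]
    refine ENNReal.rpow_le_rpow ((ENNReal.tsum_le_tsum key).trans ?_) (by positivity)
    rw [ENNReal.tsum_comm, ← ENNReal.tsum_mul_left]
    refine ENNReal.tsum_le_tsum fun m => ?_
    rw [ENNReal.tsum_mul_right]
    refine mul_le_mul_left (le_trans (le_of_eq (tsum_congr fun j => ?_)) (hg m)) _
    rw [abs_sub_comm]

lemma lq_split {q : ℝ≥0∞} (hq : 0 < q) : ∃ C : ℝ≥0∞, C ≠ ⊤ ∧ ∀ a : ℕ → ℝ≥0∞,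
    lqSum q a ≤ C * (a 0 + lqSum q fun j => a (j + 1)) := by
  by_cases h : q = ⊤
  · refine ⟨1, by simp, fun a => ?_⟩
    rw [one_mul]
    have : lqSum q a = ⨆ j, a j := by unfold lqSum; rw [if_pos h]
    rw [this]
    refine iSup_le fun j => ?_
    cases j with
    | zero => exact le_self_add
    | succ j => exact le_trans (le_lq hq (fun j => a (j + 1)) j) le_add_self
  · have h0 : 0 < q.toReal := ENNReal.toReal_pos hq.ne' h
    refine ⟨2 ^ (1 / q.toReal), ENNReal.rpow_ne_top_of_nonneg (by positivity) (by simp), fun a => ?_⟩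
    set T := a 0 + lqSum q fun j => a (j + 1) with hT
    unfold lqSum
    rw [if_neg h]
    have h1 : a 0 ^ q.toReal ≤ T ^ q.toReal := ENNReal.rpow_le_rpow le_self_add h0.le
    have h2 : ∑' j, a (j + 1) ^ q.toReal ≤ T ^ q.toReal := by
      have : lqSum q (fun j => a (j + 1)) ≤ T := le_add_self
      unfold lqSum at this
      rw [if_neg h, one_div, ENNReal.rpow_inv_le_iff h0] at this
      exact this
    calc _ ≤ (2 * T ^ q.toReal) ^ (1 / q.toReal) := by
          refine ENNReal.rpow_le_rpow ?_ (by positivity)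
          rw [tsum_eq_zero_add' ENNReal.summable, two_mul]
          exact add_le_add h1 h2
      _ = _ := by
          rw [ENNReal.mul_rpow_of_nonneg _ _ (by positivity), ← ENNReal.rpow_mul,
            mul_one_div_cancel h0.ne', ENNReal.rpow_one]

lemma lq_shift {q : ℝ≥0∞} (hq : 0 < q) (a : ℕ → ℝ≥0∞) :
    (a 0 + lqSum q fun j => a (j + 1)) ≤ 2 * lqSum q a := by
  rw [two_mul]
  refine add_le_add (le_lq hq a 0) ?_
  unfold lqSum
  split_ifs with h
  · exact iSup_le fun j => le_iSup a (j + 1)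
  · refine ENNReal.rpow_le_rpow ?_ (by positivity)
    rw [tsum_eq_zero_add' (f := fun j => a j ^ q.toReal) ENNReal.summable]
    exact le_add_self

end LM


namespace LM

/-- the convolution kernel -/
def KK (a m : ℕ) (r : ℝ) (z : Rn n) : ℝ≥0∞ := (2 ^ m) ^ n * (W a m z)⁻¹ ^ r

lemma KK_meas (a m : ℕ) (r : ℝ) : Measurable (KK a m r : Rn n → ℝ≥0∞) := by
  unfold KK
  exact (((W_cont a m).measurable.inv).pow_const r).const_mul _

lemma KK_int (a m : ℕ) (r : ℝ) : ∫⁻ z : Rn n, KK a m r z = ∫⁻ z : Rn n, KK a 0 r z := by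
  have := lint_scale (n := n) m (fun z => KK a 0 r z) (KK_meas a 0 r)
  rw [← this]
  refine lintegral_congr fun z => ?_
  simp [KK, W_smul]

lemma KK_fin (a : ℕ) {r : ℝ} (ha : (n : ℝ) < a * r) : ∫⁻ z : Rn n, KK a 0 r z ≠ ⊤ := by
  have h := integrable_one_add_norm (E := Rn n) (μ := volume) (r := a * r) (by simpa using ha)
  have h2 := h.lintegral_lt_top
  refine ne_of_lt (lt_of_le_of_lt (le_of_eq (lintegral_congr fun z => ?_)) h2)
  have hz : 0 < 1 + ‖z‖ := by positivity
  simp only [KK, W, pow_zero, one_pow, one_mul]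
  rw [← ENNReal.ofReal_inv_of_pos (by positivity), ENNReal.ofReal_rpow_of_pos (by positivity)]
  congr 1
  rw [← Real.rpow_natCast, ← Real.rpow_neg hz.le, ← Real.rpow_mul hz.le]
  congr 1; ring

lemma II_eq (a m : ℕ) (r : ℝ) (g : Rn n → E) (x : Rn n) :
    II a m r g x = ∫⁻ y, KK a m r (x - y) * ‖g y‖ₑ ^ r := by
  unfold II KK
  simp_rw [mul_assoc]

lemma II_meas (a m : ℕ) (r : ℝ) (g : Rn n → E) (hg : Continuous g) : Measurable (II a m r g) := by
  have : II a m r g = fun x => ∫⁻ y, KK a m r (x - y) * ‖g y‖ₑ ^ r := by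
    ext x; exact II_eq a m r g x
  rw [this]
  refine Measurable.lintegral_prod_right' (f := fun z : Rn n × Rn n => KK a m r (z.1 - z.2) * ‖g z.2‖ₑ ^ r) ?_
  refine Measurable.mul ((KK_meas a m r).comp (measurable_fst.sub measurable_snd)) ?_
  exact (((continuous_enorm.comp hg).measurable).comp measurable_snd).pow_const r

lemma jensen {K h : Rn n → ℝ≥0∞} (hK : Measurable K) (hh : Measurable h) {t : ℝ} (ht : 1 ≤ t) :
    (∫⁻ y, K y * h y) ^ t ≤ (∫⁻ y, K y) ^ (t - 1) * ∫⁻ y, K y * h y ^ t := by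
  have ht0 : 0 < t := by linarith
  have h1 := eLpNorm'_le_eLpNorm'_mul_rpow_measure_univ (μ := volume.withDensity K) (f := h)
    zero_lt_one ht hh.aestronglyMeasurable
  simp only [eLpNorm'_eq_lintegral_enorm, enorm_eq_self, ENNReal.rpow_one, div_one] at h1
  rw [lintegral_withDensity_eq_lintegral_mul _ hK hh,
    lintegral_withDensity_eq_lintegral_mul _ hK (hh.pow_const t), withDensity_apply _ MeasurableSet.univ,
    Measure.restrict_univ] at h1
  have h2 := ENNReal.rpow_le_rpow h1 ht0.le
  rw [ENNReal.mul_rpow_of_nonneg _ _ ht0.le, ← ENNReal.rpow_mul, ← ENNReal.rpow_mul,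
    one_div_mul_cancel ht0.ne', ENNReal.rpow_one, sub_mul, one_div_mul_cancel ht0.ne', one_mul] at h2
  rw [mul_comm]
  exact h2

lemma LpII {p : ℝ≥0∞} (a : ℕ) {r : ℝ} (hr : 0 < r) (hrp : ENNReal.ofReal r ≤ p) (ha : (n : ℝ) < a * r) :
    ∃ C : ℝ≥0∞, C ≠ ⊤ ∧ ∀ (m : ℕ) (g : Rn n → E), Continuous g →
      eLpNorm (fun x => (II a m r g x) ^ (1 / r)) p volume ≤ C * eLpNorm g p volume := by
  set K0 := ∫⁻ z : Rn n, KK a 0 r z with hK0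
  have hK : K0 ≠ ⊤ := KK_fin a ha
  have hp0 : p ≠ 0 := (lt_of_lt_of_le (ENNReal.ofReal_pos.2 hr) hrp).ne'
  refine ⟨K0 ^ (1 / r), ENNReal.rpow_ne_top_of_nonneg (by positivity) hK, fun m g hg => ?_⟩
  have hsub : ∀ x : Rn n, ∫⁻ y, KK a m r (x - y) = K0 := fun x => by
    rw [lintegral_sub_left_eq_self (μ := volume) (fun y => KK a m r y) x, KK_int]
  have hgm : Measurable fun y => ‖g y‖ₑ := (continuous_enorm.comp hg).measurable
  have hKx : ∀ x : Rn n, Measurable fun y => KK a m r (x - y) := fun x =>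
    (KK_meas a m r).comp (measurable_const.sub measurable_id)
  by_cases hp : p = ⊤
  · subst hp
    rw [eLpNorm_exponent_top, eLpNorm_exponent_top]
    refine essSup_le_of_ae_le _ (Eventually.of_forall fun x => ?_)
    simp only [enorm_eq_self]
    set M := eLpNormEssSup g volume with hM
    have hb : ∀ᵐ y ∂(volume : Measure (Rn n)), ‖g y‖ₑ ≤ M := ae_le_eLpNormEssSup
    have : II a m r g x ≤ K0 * M ^ r := by
      rw [II_eq, ← hsub x, ← lintegral_mul_const _ (hKx x)]
      refine lintegral_mono_ae ?_
      filter_upwards [hb] with y hy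
      exact mul_le_mul_right (ENNReal.rpow_le_rpow hy hr.le) _
    refine (ENNReal.rpow_le_rpow this (by positivity)).trans (le_of_eq ?_)
    rw [ENNReal.mul_rpow_of_nonneg _ _ (by positivity), ← ENNReal.rpow_mul, mul_one_div_cancel hr.ne',
      ENNReal.rpow_one]
  · have hpp : 0 < p.toReal := ENNReal.toReal_pos hp0 hp
    set P := p.toReal with hP
    have hrP : r ≤ P := (ENNReal.ofReal_le_iff_le_toReal hp).1 hrp
    have ht : 1 ≤ P / r := (one_le_div hr).2 hrP
    rw [eLpNorm_eq_lintegral_rpow_enorm_toReal hp0 hp, eLpNorm_eq_lintegral_rpow_enorm_toReal hp0 hp, ← hP]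
    simp only [enorm_eq_self]
    have main : ∫⁻ x, ((II a m r g x) ^ (1 / r)) ^ P ≤ K0 ^ (P / r) * ∫⁻ y, ‖g y‖ₑ ^ P := by
      calc _ ≤ ∫⁻ x, K0 ^ (P / r - 1) * ∫⁻ y, KK a m r (x - y) * ‖g y‖ₑ ^ P := by
            refine lintegral_mono fun x => ?_
            simp only
            rw [← ENNReal.rpow_mul, II_eq]
            have := jensen (hKx x) (hgm.pow_const r) ht
            rw [hsub x] at this
            rw [one_div_mul_eq_div]
            refine this.trans (le_of_eq ?_)
            congr 1
            refine lintegral_congr fun y => ?_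
            rw [← ENNReal.rpow_mul, mul_div_cancel₀ _ hr.ne']
        _ = K0 ^ (P / r - 1) * ∫⁻ x, ∫⁻ y, KK a m r (x - y) * ‖g y‖ₑ ^ P := by
            rw [lintegral_const_mul' _ _ (ENNReal.rpow_ne_top_of_nonneg (by linarith) hK)]
        _ = K0 ^ (P / r - 1) * ∫⁻ y, K0 * ‖g y‖ₑ ^ P := by
            congr 1
            rw [lintegral_lintegral_swap]
            · refine lintegral_congr fun y => ?_
              have hm : Measurable fun x => KK a m r (x - y) :=
                (KK_meas a m r).comp (measurable_id.sub measurable_const)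
              rw [lintegral_mul_const _ hm]
              congr 1
              rw [lintegral_sub_right_eq_self (μ := volume) (fun x => KK a m r x) y, KK_int]
            · refine Measurable.aemeasurable ?_
              refine Measurable.mul ((KK_meas a m r).comp (measurable_fst.sub measurable_snd)) ?_
              exact (hgm.comp measurable_snd).pow_const P
        _ = _ := by
            rw [lintegral_const_mul' _ _ hK, ← mul_assoc]
            congr 1
            conv_rhs => rw [show P / r = (P / r - 1) + 1 by ring]
            rw [ENNReal.rpow_add_of_nonneg _ _ (by linarith) zero_le_one, ENNReal.rpow_one]
    refine (ENNReal.rpow_le_rpow main (by positivity)).trans (le_of_eq ?_)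
    rw [ENNReal.mul_rpow_of_nonneg _ _ (by positivity), ← ENNReal.rpow_mul]
    congr 2
    field_simp

lemma Lp_sup {p : ℝ≥0∞} (hp0 : 0 < p) (g : ℕ → Rn n → ℝ≥0∞) (hg : ∀ m, Measurable (g m)) :
    eLpNorm (fun x => ⨆ m, g m x) p volume ≤ lqSum p fun m => eLpNorm (g m) p volume := by
  unfold lqSum
  split_ifs with hp
  · subst hp
    simp_rw [eLpNorm_exponent_top]
    refine essSup_le_of_ae_le _ ?_
    have : ∀ᵐ x ∂(volume : Measure (Rn n)), ∀ m, ‖g m x‖ₑ ≤ eLpNormEssSup (g m) volume :=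
      ae_all_iff.2 fun m => ae_le_eLpNormEssSup
    filter_upwards [this] with x hx
    simp only [enorm_eq_self] at hx ⊢
    exact iSup_mono hx
  · have hpp : 0 < p.toReal := ENNReal.toReal_pos hp0.ne' hp
    simp_rw [eLpNorm_eq_lintegral_rpow_enorm_toReal hp0.ne' hp, ← ENNReal.rpow_mul,
      one_div_mul_cancel hpp.ne', ENNReal.rpow_one, enorm_eq_self]
    refine ENNReal.rpow_le_rpow ?_ (by positivity)
    rw [← lintegral_tsum fun m => ((hg m).pow_const _).aemeasurable]
    refine lintegral_mono fun x => ?_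
    rw [← ENNReal.le_rpow_inv_iff hpp]
    refine iSup_le fun m => ?_
    rw [ENNReal.le_rpow_inv_iff hpp]
    exact ENNReal.le_tsum (f := fun m => g m x ^ p.toReal) m

end LM


namespace LM

lemma ee_shift {A B s ε : ℝ} (h1 : ε ≤ A + s) (h2 : ε ≤ B - s) (j m : ℕ) :
    two ((j : ℝ) * s) * two (ee A B ((m : ℝ) - j)) ≤ two (-ε * |(m : ℝ) - j|) * two ((m : ℝ) * s) := by
  rw [← two_add, ← two_add]
  apply two_mono
  unfold ee
  rcases le_total 0 ((m : ℝ) - j) with h | h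
  · have := min_le_left (-A * ((m : ℝ) - j)) (B * ((m : ℝ) - j))
    rw [abs_of_nonneg h]
    nlinarith
  · have := min_le_right (-A * ((m : ℝ) - j)) (B * ((m : ℝ) - j))
    rw [abs_of_nonpos h]
    nlinarith

theorem FL {p q : ℝ≥0∞} (hq : 0 < q) (a : ℕ) {r : ℝ} (hr : 0 < r)
    (hrp : ENNReal.ofReal r ≤ p) (ha : (n : ℝ) < a * r) {A B s : ℝ} (hA : 0 < A + s) (hB : 0 < B - s) :
    ∃ C : ℝ≥0∞, C ≠ ⊤ ∧ ∀ (U V : ℕ → Rn n → E) (C1 : ℝ≥0∞), C1 ≠ ⊤ → (∀ m, Continuous (V m)) →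
      (∀ j x, ‖U j x‖ₑ ≤ C1 * ⨆ m : ℕ, two (ee A B ((m : ℝ) - j)) * (II a m r (V m) x) ^ (1 / r)) →
      lqSum q (fun j : ℕ => two ((j : ℝ) * s) * eLpNorm (U j) p volume) ≤
        C1 * (C * lqSum q (fun j : ℕ => two ((j : ℝ) * s) * eLpNorm (V j) p volume)) := by
  obtain ⟨ε, hε, h1, h2⟩ : ∃ ε : ℝ, 0 < ε ∧ ε ≤ A + s ∧ ε ≤ B - s :=
    ⟨min (A + s) (B - s), lt_min hA hB, min_le_left _ _, min_le_right _ _⟩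
  have hp : 0 < p := lt_of_lt_of_le (ENNReal.ofReal_pos.2 hr) hrp
  obtain ⟨D1, hD1, hLp⟩ := LpII (E := E) a hr hrp ha
  obtain ⟨D2, hD2, hhalf⟩ := lq_half hp hε
  obtain ⟨D3, hD3, hyoung⟩ := lq_young hq (half_pos hε)
  refine ⟨D2 * D1 * D3, by finiteness, fun U V C1 hC1 hV hUV => ?_⟩
  set b : ℕ → ℝ≥0∞ := fun j : ℕ => two ((j : ℝ) * s) * eLpNorm (V j) p volume with hb
  have key : ∀ j : ℕ, two ((j : ℝ) * s) * eLpNorm (U j) p volume ≤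
      C1 * (D2 * D1) * ⨆ m : ℕ, two (-(ε / 2) * |(m : ℝ) - j|) * b m := by
    intro j
    let g : ℕ → Rn n → ℝ≥0∞ := fun m x =>
      (C1 * two (ee A B ((m : ℝ) - j))) * (II a m r (V m) x) ^ (1 / r)
    have hgm : ∀ m, Measurable (g m) := fun m => ((II_meas a m r (V m) (hV m)).pow_const _).const_mul _
    have e1 : eLpNorm (U j) p volume ≤ eLpNorm (fun x => ⨆ m, g m x) p volume := by
      refine eLpNorm_mono_enorm fun x => ?_
      rw [enorm_eq_self]
      refine (hUV j x).trans (le_of_eq ?_)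
      rw [ENNReal.mul_iSup]
      simp only [g, mul_assoc]
    have e2 : ∀ m, eLpNorm (g m) p volume ≤
        (C1 * two (ee A B ((m : ℝ) - j))) * (D1 * eLpNorm (V m) p volume) := by
      intro m
      refine le_trans ?_ (mul_le_mul_right (hLp m (V m) (hV m)) _)
      have hc : C1 * two (ee A B ((m : ℝ) - j)) ≠ ⊤ := ENNReal.mul_ne_top hC1 (two_ne_top _)
      simp only [g]
      lift C1 * two (ee A B ((m : ℝ) - j)) to ℝ≥0 using hc with c
      exact eLpNorm_le_nnreal_smul_eLpNorm_of_ae_le_mul' (f := fun x => (c : ℝ≥0∞) * (II a m r (V m) x) ^ (1 / r))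
        (g := fun x => (II a m r (V m) x) ^ (1 / r)) (Eventually.of_forall fun x => by simp) p
    calc _ ≤ two ((j : ℝ) * s) * lqSum p fun m => (C1 * two (ee A B ((m : ℝ) - j))) * (D1 * eLpNorm (V m) p volume) :=
          mul_le_mul_right (e1.trans ((Lp_sup hp g hgm).trans (lq_mono e2))) _
      _ ≤ lqSum p fun m => C1 * D1 * (two (-ε * |(m : ℝ) - j|) * b m) := by
          rw [← lq_const hp]
          refine lq_mono fun m => ?_
          have := mul_le_mul_left (ee_shift h1 h2 j m) (C1 * D1 * eLpNorm (V m) p volume)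
          calc _ = two (↑j * s) * two (ee A B (↑m - ↑j)) * (C1 * D1 * eLpNorm (V m) p volume) := by ring
            _ ≤ _ := this
            _ = _ := by rw [hb]; ring
      _ ≤ C1 * D1 * (D2 * ⨆ m : ℕ, two (-(ε / 2) * |(m : ℝ) - j|) * b m) := by
          rw [lq_const hp]
          exact mul_le_mul_right (hhalf j b) _
      _ = _ := by ring
  refine (lq_mono key).trans ?_
  rw [lq_const hq]
  refine (mul_le_mul_right (hyoung b) _).trans (le_of_eq ?_)
  ring

end LM


namespace LM

lemma besov_eq (s : ℝ) (p q : ℝ≥0∞) (φ : ℕ → Sch n) (f : TDist n E) :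
    besovNorm s p q φ f = lqSum q fun j => two ((j : ℝ) * s) * eLpNorm (mOp (φ j) f) p volume := rfl

lemma fin_unif [CompleteSpace E] {φ : ℕ → Sch n} (hφ : SmoothResolution n φ) {q : ℝ≥0∞} (hq : 0 < q)
    {r : ℝ} (hr : 0 < r) (hr1 : r ≤ 1) (s : ℝ) (f : TDist n E)
    (hf : besovNorm s (ENNReal.ofReal r) q φ f < ⊤) :
    ∃ C : ℝ≥0∞, C ≠ ⊤ ∧ ∀ (a m : ℕ) x, star a m (mOp (φ m) f) x ≤ C * two (m * (n / r - s)) := by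
  obtain ⟨K, M, hK⟩ := star_growth hφ f
  obtain ⟨C, hC, h1⟩ := hK K le_rfl
  obtain ⟨Cp, hCp, h2⟩ := peetre (E := E) hφ K
  set S := besovNorm s (ENNReal.ofReal r) q φ f with hS
  have hpt : ∀ (m : ℕ) x, ‖mOp (φ m) f x‖ₑ ≤ Cp ^ (1 / r) * S * two (m * (n / r - s)) := by
    intro m x
    have hfin : star K m (mOp (φ m) f) x ≠ ⊤ :=
      ne_top_of_le_ne_top (by have := W_ne_top (n := n) K 0 x; finiteness) (h1 m x)
    refine (le_star_self K m _ x).trans ((absorb hr hr1 (h2 f m x r hr.le hr1) (Or.inl hfin)).trans ?_)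
    have hLp : eLpNorm (mOp (φ m) f) (ENNReal.ofReal r) volume ≤ two (-(m * s)) * S := by
      have := le_lq hq (fun j : ℕ => two ((j : ℝ) * s) * eLpNorm (mOp (φ j) f) (ENNReal.ofReal r) volume) m
      rw [← besov_eq] at this
      have h3 := mul_le_mul_right this (two (-(m * s)))
      rwa [← mul_assoc, ← two_add, neg_add_cancel, two_zero, one_mul] at h3
    have hint : ∫⁻ y, ‖mOp (φ m) f y‖ₑ ^ r ≤ (two (-(m * s)) * S) ^ r := by
      rw [eLpNorm_eq_lintegral_rpow_enorm_toReal (by simpa using hr) (by simp),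
        ENNReal.toReal_ofReal hr.le, one_div, ENNReal.rpow_inv_le_iff hr] at hLp
      exact hLp
    have hII : II K m r (mOp (φ m) f) x ≤ two (m * n) * (two (-(m * s)) * S) ^ r := by
      refine le_trans ?_ (mul_le_mul_right hint _)
      rw [← lintegral_const_mul' _ _ (two_ne_top _)]
      unfold II
      refine lintegral_mono fun y => ?_
      refine mul_le_mul' (le_of_eq ?_) ?_
      · rw [← two_nat, ← ENNReal.rpow_natCast, two_rpow]
      · refine mul_le_of_le_one_left zero_le ?_
        exact ENNReal.rpow_le_one (ENNReal.inv_le_one.2 (one_le_W _ _ _)) hr.le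
    refine (ENNReal.rpow_le_rpow (mul_le_mul_right hII Cp) (by positivity)).trans (le_of_eq ?_)
    rw [ENNReal.mul_rpow_of_nonneg _ _ (by positivity), ENNReal.mul_rpow_of_nonneg _ _ (by positivity),
      ← ENNReal.rpow_mul _ r, mul_one_div_cancel hr.ne', ENNReal.rpow_one, two_rpow,
      show (m : ℝ) * (n / r - s) = m * n * (1 / r) + -(m * s) by ring, two_add]
    ring
  refine ⟨Cp ^ (1 / r) * S, ?_, fun a m x => ?_⟩
  · have := ENNReal.rpow_ne_top_of_nonneg (y := 1 / r) (by positivity) hCp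
    exact ENNReal.mul_ne_top this hf.ne
  · refine iSup_le fun y => ?_
    refine (mul_le_of_le_one_right zero_le (ENNReal.inv_le_one.2 (one_le_W _ _ _))).trans (hpt m y)

lemma exists_r {p : ℝ≥0∞} (hp : 0 < p) : ∃ r : ℝ, 0 < r ∧ r ≤ 1 ∧ ENNReal.ofReal r ≤ p ∧
    (p = ENNReal.ofReal r ∨ r = 1) := by
  rcases le_total 1 p with h | h
  · exact ⟨1, one_pos, le_rfl, by simpa using h, Or.inr rfl⟩
  · have hp' : p ≠ ⊤ := ne_top_of_le_ne_top ENNReal.one_ne_top h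
    refine ⟨p.toReal, ENNReal.toReal_pos hp.ne' hp', ?_, ENNReal.ofReal_toReal_le, Or.inl ?_⟩
    · have := ENNReal.toReal_mono ENNReal.one_ne_top h
      simpa using this
    · rw [ENNReal.ofReal_toReal hp']

lemma exists_a (n : ℕ) {r : ℝ} (hr : 0 < r) : ∃ a : ℕ, (n : ℝ) < a * r := by
  obtain ⟨a, ha⟩ := exists_nat_gt ((n : ℝ) / r)
  exact ⟨a, by rwa [div_lt_iff₀ hr] at ha⟩

/-- the `ℓ_q(L_p)` norm of the generalized local means -/
def LMn (s : ℝ) (p q : ℝ≥0∞) (κ0 κ : Sch n) (f : TDist n E) : ℝ≥0∞ :=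
  lqSum q fun j : ℕ => two ((j : ℝ) * s) * eLpNorm (mOp (kap κ0 κ j) f) p volume

theorem TA [CompleteSpace E] {φ : ℕ → Sch n} (hφ : SmoothResolution n φ) (κ0 κ κ' : Sch n) (N : ℕ)
    (hκ : ∀ x, κ x = ((‖x‖ ^ 2) ^ N : ℝ) * κ' x) {s : ℝ} {p q : ℝ≥0∞} (hp : 0 < p) (hq : 0 < q)
    (hN : s < 2 * N) :
    ∃ C : ℝ≥0∞, C ≠ ⊤ ∧ ∀ f : TDist n E, besovNorm s p q φ f < ⊤ →
      LMn s p q κ0 κ f ≤ C * besovNorm s p q φ f := by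
  obtain ⟨r, hr, hr1, hrp, hor⟩ := exists_r hp
  obtain ⟨a, ha⟩ := exists_a n hr
  have hA : 0 < (|s| + 1) + s := by linarith [neg_abs_le s]
  have hB : 0 < (s + 2 * N) / 2 - s := by linarith
  obtain ⟨C, hC, hFL⟩ := FL (E := E) hq a hr hrp ha hA hB
  obtain ⟨C1, hC1, hcl⟩ := closureA (E := E) hφ κ0 κ κ' N hκ a (|s| + 1) ((s + 2 * N) / 2) (by linarith)
    (by linarith) r hr hr1
  refine ⟨C1 * C, ENNReal.mul_ne_top hC1 hC, fun f hf => ?_⟩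
  rw [mul_assoc]
  refine hFL (fun j => mOp (kap κ0 κ j) f) (fun j => mOp (φ j) f) C1 hC1 (fun m => mOp_cont _ _) ?_
  intro j x
  refine hcl f j x ?_
  rcases hor with rfl | h
  · obtain ⟨D, hD, hst⟩ := fin_unif hφ hq hr hr1 s f hf
    exact Or.inl fun m => ne_top_of_le_ne_top (ENNReal.mul_ne_top hD (two_ne_top _)) (hst a m x)
  · exact Or.inr h

theorem TB [CompleteSpace E] {φ : ℕ → Sch n} (hφ : SmoothResolution n φ) (κ0 κ κ' : Sch n) (N : ℕ)
    (hκ : ∀ x, κ x = ((‖x‖ ^ 2) ^ N : ℝ) * κ' x) (h00 : κ0 0 ≠ 0) (h00' : κ' 0 ≠ 0)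
    {s : ℝ} {p q : ℝ≥0∞} (hp : 0 < p) (hq : 0 < q) (hN : s < 2 * N) :
    ∃ C : ℝ≥0∞, C ≠ ⊤ ∧ ∀ f : TDist n E, besovNorm s p q φ f < ⊤ →
      besovNorm s p q φ f ≤ C * LMn s p q κ0 κ f := by
  obtain ⟨r, hr, hr1, hrp, hor⟩ := exists_r hp
  obtain ⟨a, ha⟩ := exists_a n hr
  obtain ⟨A, hA1, hA2⟩ : ∃ A : ℝ, |s| + 1 ≤ A ∧ n / r - s ≤ A := ⟨_, le_max_left _ _, le_max_right _ _⟩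
  have hA : 0 < A + s := by linarith [neg_abs_le s]
  have hB : 0 < (s + 2 * N) / 2 - s := by linarith
  obtain ⟨C, hC, hFL⟩ := FL (E := E) hq a hr hrp ha hA hB
  obtain ⟨C1, hC1, hcl⟩ := closureB (E := E) hφ κ0 κ κ' N hκ h00 h00' a A ((s + 2 * N) / 2) (by linarith)
    (by linarith) r hr hr1
  refine ⟨C1 * C, ENNReal.mul_ne_top hC1 hC, fun f hf => ?_⟩
  rw [mul_assoc]
  refine hFL (fun j => mOp (φ j) f) (fun j => mOp (kap κ0 κ j) f) C1 hC1 (fun m => mOp_cont _ _) ?_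
  intro j x
  refine hcl f j x ?_
  rcases hor with rfl | h
  · obtain ⟨D, hD, hst⟩ := fin_unif hφ hq hr hr1 s f hf
    exact Or.inl (FF_fin φ a A _ f x D hD _ hA2 (fun m => hst a m x) j)
  · exact Or.inr h

theorem TC [CompleteSpace E] {φ : ℕ → Sch n} (hφ : SmoothResolution n φ) (κ0 κ κ' : Sch n) (N : ℕ)
    (hκ : ∀ x, κ x = ((‖x‖ ^ 2) ^ N : ℝ) * κ' x) (h00 : κ0 0 ≠ 0) (h00' : κ' 0 ≠ 0)
    {s : ℝ} {p q : ℝ≥0∞} (hp : 0 < p) (hq : 0 < q) (hN : s < 2 * N) (f : TDist n E) :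
    ∃ C : ℝ≥0∞, C ≠ ⊤ ∧ besovNorm s p q φ f ≤ C * LMn s p q κ0 κ f := by
  obtain ⟨r, hr, hr1, hrp, -⟩ := exists_r hp
  obtain ⟨a0, ha0⟩ := exists_a n hr
  obtain ⟨K, M, hK⟩ := star_growth hφ f
  obtain ⟨a, ha1, ha2⟩ : ∃ a : ℕ, a0 ≤ a ∧ K ≤ a := ⟨_, le_max_left _ _, le_max_right _ _⟩
  have ha : (n : ℝ) < a * r :=
    ha0.trans_le (mul_le_mul_of_nonneg_right (by exact_mod_cast ha1) hr.le)
  obtain ⟨D, hD, hst⟩ := hK a ha2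
  obtain ⟨A, hA1, hA2⟩ : ∃ A : ℝ, |s| + 1 ≤ A ∧ (M : ℝ) ≤ A := ⟨_, le_max_left _ _, le_max_right _ _⟩
  have hA : 0 < A + s := by linarith [neg_abs_le s]
  have hB : 0 < (s + 2 * N) / 2 - s := by linarith
  obtain ⟨C, hC, hFL⟩ := FL (E := E) hq a hr hrp ha hA hB
  obtain ⟨C1, hC1, hcl⟩ := closureB (E := E) hφ κ0 κ κ' N hκ h00 h00' a A ((s + 2 * N) / 2) (by linarith)
    (by linarith) r hr hr1
  refine ⟨C1 * C, ENNReal.mul_ne_top hC1 hC, ?_⟩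
  rw [mul_assoc]
  refine hFL (fun j => mOp (φ j) f) (fun j => mOp (kap κ0 κ j) f) C1 hC1 (fun m => mOp_cont _ _) ?_
  intro j x
  refine hcl f j x (Or.inl (FF_fin φ a A _ f x (D * W a 0 x)
    (ENNReal.mul_ne_top hD (W_ne_top _ _ _)) _ hA2 (fun m => ?_) j))
  refine (hst m x).trans (le_of_eq ?_)
  rw [show ((m : ℝ) * M) = ((m * M : ℕ) : ℝ) by push_cast; ring, two_nat]
  ring

end LM


namespace LM

lemma fourier_lap (k : Sch n) (x : Rn n) :
    (𝓕 (schLap k) : Sch n) x = ((-(4 * π ^ 2) * ‖x‖ ^ 2 : ℝ) : ℂ) * (𝓕 k : Sch n) x := by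
  have h1 : ∀ (g : Sch n) (m : Rn n), (𝓕 (LineDeriv.lineDerivOpCLM ℝ (Sch n) m g) : Sch n) x =
      (2 * π * Complex.I) * ((inner ℝ x m : ℝ) * (𝓕 g : Sch n) x) := by
    intro g m
    have ht : (inner ℝ · m : Rn n → ℝ).HasTemperateGrowth := by fun_prop
    have := SchwartzMap.fourier_lineDerivOp_eq g m
    rw [LineDeriv.lineDerivOpCLM_apply, this, _root_.smul_apply, SchwartzMap.smulLeftCLM_apply_apply ht]
    simp
  have h2 : (𝓕 (schLap k) : Sch n) = ∑ i : Fin n, 𝓕 (LineDeriv.lineDerivOpCLM ℝ (Sch n) (EuclideanSpace.single i (1 : ℝ))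
    (LineDeriv.lineDerivOpCLM ℝ (Sch n) (EuclideanSpace.single i (1 : ℝ)) k)) := by
    change FourierTransform.fourierCLE ℂ (Sch n) (schLap k) = _
    unfold schLap
    rw [map_sum]
    rfl
  rw [h2, _root_.sum_apply]
  simp_rw [h1]
  rw [EuclideanSpace.norm_sq_eq, Finset.mul_sum, Complex.ofReal_sum, Finset.sum_mul]
  refine Finset.sum_congr rfl fun i _ => ?_
  have : (2 * (π : ℂ) * Complex.I) * (2 * π * Complex.I) = -(4 * π ^ 2) := by
    linear_combination 4 * (π : ℂ) ^ 2 * Complex.I_sq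
  rw [EuclideanSpace.inner_single_right]
  simp only [Real.norm_eq_abs, sq_abs]
  push_cast
  simp
  linear_combination ((x i : ℝ) : ℂ) ^ 2 * (𝓕 k : Sch n) x * this

lemma fourier_lap_iter (k : Sch n) (N : ℕ) (x : Rn n) :
    (𝓕 (schLap^[N] k) : Sch n) x =
      ((‖x‖ ^ 2) ^ N : ℝ) * (((((-(4 * π ^ 2)) ^ N : ℝ)) • (𝓕 k : Sch n) : Sch n) x) := by
  rw [_root_.smul_apply]
  induction N with
  | zero => simp
  | succ N ih =>
    rw [Function.iterate_succ_apply', fourier_lap, ih]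
    simp only [Complex.real_smul]
    push_cast
    ring

lemma tdConv_eq (k : Sch n) (f : TDist n E) : tdConv k f = mOp (𝓕 k) f := by
  unfold mOp
  rw [invFourierS_eq, FourierTransform.fourierInv_fourier_eq]

lemma tdConv_dl (k : Sch n) (f : TDist n E) (j : ℕ) :
    tdConv (((2 : ℝ) ^ (((j : ℝ) + 1) * (n : ℝ))) • dilate k ((2 : ℝ) ^ ((j : ℝ) + 1))) f =
      mOp (dl (𝓕 k) (j + 1)) f := by
  unfold mOp
  rw [invFourierS_eq, inv_dl, FourierTransform.fourierInv_fourier_eq]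
  have e : (2 : ℝ) ^ ((j : ℝ) + 1) = 2 ^ (j + 1) := by
    rw [← Real.rpow_natCast]; push_cast; rfl
  rw [Real.rpow_mul (by norm_num), e, Real.rpow_natCast]

lemma local_eq (s : ℝ) (p q : ℝ≥0∞) (k0 kN : Sch n) (f : TDist n E) (a : ℕ → ℝ≥0∞)
    (ha : a = fun j : ℕ => two ((j : ℝ) * s) * eLpNorm (mOp (kap (𝓕 k0) (𝓕 kN) j) f) p volume) :
    localMeansB s p q k0 kN f = a 0 + lqSum q fun j => a (j + 1) := by
  unfold localMeansB
  simp_rw [tdConv_dl, tdConv_eq, ha]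
  simp [kap, two]

end LM

/-- the local means `k₀, k^N = Δ^N k⁰` give an equivalent norm and
characterization of `B^s_{p,q}(E)` when `2N > s`. -/
theorem statement6 (n : ℕ) (E : Type*) [NormedAddCommGroup E] [NormedSpace ℂ E]
    [CompleteSpace E] (s : ℝ) (p q : ℝ≥0∞) (hp : 0 < p) (hq : 0 < q)
    (k0 k0' : Sch n) (hk0 : fourierS k0 0 ≠ 0) (hk0' : fourierS k0' 0 ≠ 0)
    (N : ℕ) (hN : s < 2 * N)
    (φ : ℕ → Sch n) (hφ : SmoothResolution n φ) :
    (∃ c₁ > (0 : ℝ), ∃ c₂ > (0 : ℝ), ∀ f : TDist n E, besovNorm s p q φ f < ∞ →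
      ENNReal.ofReal c₁ * besovNorm s p q φ f ≤ localMeansB s p q k0 (schLap^[N] k0') f ∧
        localMeansB s p q k0 (schLap^[N] k0') f ≤ ENNReal.ofReal c₂ * besovNorm s p q φ f) ∧
    ∀ f : TDist n E,
      besovNorm s p q φ f < ∞ ↔ localMeansB s p q k0 (schLap^[N] k0') f < ∞ := by
  have hκ := LM.fourier_lap_iter k0' N
  have h00' : ((((-(4 * π ^ 2)) ^ N : ℝ)) • (𝓕 k0' : Sch n) : Sch n) 0 ≠ 0 := by
    rw [_root_.smul_apply]
    refine smul_ne_zero (pow_ne_zero _ ?_) hk0'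
    have := Real.pi_pos
    have : 0 < 4 * π ^ 2 := by positivity
    linarith
  obtain ⟨CA, hCA, hA⟩ := LM.TA (E := E) hφ (𝓕 k0) _ _ N hκ hp hq hN
  obtain ⟨CB, hCB, hB⟩ := LM.TB (E := E) hφ (𝓕 k0) _ _ N hκ hk0 h00' hp hq hN
  obtain ⟨D, hD, hs⟩ := LM.lq_split hq
  have up : ∀ f : TDist n E, localMeansB s p q k0 (schLap^[N] k0') f ≤
      2 * LM.LMn s p q (𝓕 k0) (𝓕 (schLap^[N] k0')) f := fun f => by
    rw [LM.local_eq s p q k0 (schLap^[N] k0') f _ rfl]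
    exact LM.lq_shift hq _
  have lo : ∀ f : TDist n E, LM.LMn s p q (𝓕 k0) (𝓕 (schLap^[N] k0')) f ≤
      D * localMeansB s p q k0 (schLap^[N] k0') f := fun f => by
    rw [LM.local_eq s p q k0 (schLap^[N] k0') f _ rfl]
    exact hs _
  have le_c : ∀ C : ℝ≥0∞, C ≠ ⊤ → C ≤ ENNReal.ofReal (C.toReal + 1) := fun C hC => by
    conv_lhs => rw [← ENNReal.ofReal_toReal hC]
    exact ENNReal.ofReal_le_ofReal (by linarith)
  refine ⟨⟨((CB * D).toReal + 1)⁻¹, by positivity, (2 * CA).toReal + 1, by positivity, fun f hf => ⟨?_, ?_⟩⟩,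
    fun f => ⟨fun hf => ?_, fun hf => ?_⟩⟩
  · rw [ENNReal.ofReal_inv_of_pos (by positivity), ENNReal.inv_mul_le_iff (by simp; positivity) (by simp)]
    refine (hB f hf).trans ((mul_le_mul_right (lo f) _).trans ?_)
    rw [← mul_assoc]
    exact mul_le_mul_left (le_c _ (ENNReal.mul_ne_top hCB hD)) _
  · refine (up f).trans ((mul_le_mul_right (hA f hf) _).trans ?_)
    rw [← mul_assoc]
    exact mul_le_mul_left (le_c _ (ENNReal.mul_ne_top (by simp) hCA)) _
  · refine ((up f).trans ((mul_le_mul_right (hA f hf) _))).trans_lt ?_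
    have := hf.ne
    exact (ENNReal.mul_ne_top (by simp) (ENNReal.mul_ne_top hCA this)).lt_top
  · obtain ⟨CC, hCC, hC⟩ := LM.TC (E := E) hφ (𝓕 k0) _ _ N hκ hk0 h00' hp hq hN f
    refine (hC.trans (mul_le_mul_right (lo f) _)).trans_lt ?_
    exact (ENNReal.mul_ne_top hCC (ENNReal.mul_ne_top hD hf.ne)).lt_top


end
end

section
/- Let n ∈ ℕ, ε' > 0 and let Φ, φ ∈ S(ℝ^n) satisfy |Φ(x)| > 0 for |x| < 2ε' and |φ(x)| > 0 for ε'/2 < |x| < 2ε'. Then there exist Λ, λ ∈ S(ℝ^n) with supp Λ ⊂ {x : |x| < 2ε'}, supp λ ⊂ {x : ε'/2 < |x| < 2ε'}, and Λ(x)Φ(x) + Σ_{j=1}^∞ λ(2^{−j}x)φ(2^{−j}x) = 1 for all x ∈ ℝ^n. -/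
noncomputable section

open MeasureTheory Filter Metric Real Set SchwartzMap
open scoped ENNReal NNReal Topology FourierTransform

variable {n : ℕ} {E : Type*} [NormedAddCommGroup E] [NormedSpace ℂ E]

lemma exists_div_sch {n : ℕ} (f : Rn n → ℂ) (hf : ContDiff ℝ (⊤ : ℕ∞) f)
    (hc : HasCompactSupport f) (φ : Sch n) (h : ∀ x ∈ tsupport f, φ x ≠ 0) :
    ∃ ψ : Sch n, (∀ x, ψ x * φ x = f x) ∧ ∀ x, ψ x ≠ 0 → f x ≠ 0 := by
  have hs : Function.support (fun x => f x * (φ x)⁻¹) ⊆ Function.support f := by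
    intro x hx
    simp only [Function.mem_support, ne_eq, mul_eq_zero, not_or] at hx
    exact hx.1
  have hsm : ContDiff ℝ (⊤ : ℕ∞) (fun x => f x * (φ x)⁻¹) := by
    rw [contDiff_iff_contDiffAt]
    intro x
    by_cases hx' : x ∈ tsupport f
    swap
    · have he : (fun x => f x * (φ x)⁻¹) =ᶠ[𝓝 x] fun _ => (0 : ℂ) := by
        filter_upwards [notMem_tsupport_iff_eventuallyEq.1 hx'] with y hy
        simp [hy]
      exact contDiffAt_const.congr_of_eventuallyEq he
    exact hf.contDiffAt.mul (φ.smooth'.contDiffAt.inv (h x hx'))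
  have hcs : HasCompactSupport (fun x => f x * (φ x)⁻¹) := hc.mono hs
  refine ⟨hcs.toSchwartzMap hsm, fun x => ?_, fun x hx => ?_⟩
  · show f x * (φ x)⁻¹ * φ x = f x
    by_cases hx : φ x = 0
    · have : f x = 0 := by
        by_contra h0
        exact h x (subset_tsupport f h0) hx
      simp [this]
    · field_simp
  · exact hs hx

/-- existence of `Λ, λ` with
`Λ(x)Φ(x) + ∑_{j≥1} λ(2^{-j}x)φ(2^{-j}x) = 1`. -/
theorem statement8 (n : ℕ) (ε' : ℝ) (hε : 0 < ε') (Φ φ : Sch n)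
    (hΦ : ∀ x : Rn n, ‖x‖ < 2 * ε' → 0 < ‖Φ x‖)
    (hφ : ∀ x : Rn n, ε' / 2 < ‖x‖ → ‖x‖ < 2 * ε' → 0 < ‖φ x‖) :
    ∃ Λ lam : Sch n,
      Function.support (fun x => Λ x) ⊆ {x : Rn n | ‖x‖ < 2 * ε'} ∧
      Function.support (fun x => lam x) ⊆ {x : Rn n | ε' / 2 < ‖x‖ ∧ ‖x‖ < 2 * ε'} ∧
      ∀ x : Rn n, Λ x * Φ x +
        (∑' j : ℕ, lam (((2 : ℝ) ^ (-((j : ℝ) + 1))) • x) *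
          φ (((2 : ℝ) ^ (-((j : ℝ) + 1))) • x)) = 1 := by
  have hr : (0:ℝ) < 6 / 5 * ε' := by positivity
  let η : ContDiffBump (0 : Rn n) := ⟨6 / 5 * ε', 9 / 5 * ε', hr, by linarith⟩
  have h1 : ∀ x : Rn n, ‖x‖ ≤ 6 / 5 * ε' → η x = 1 := fun x hx =>
    η.one_of_mem_closedBall (by simpa using hx)
  have h0 : ∀ x : Rn n, 9 / 5 * ε' ≤ ‖x‖ → η x = 0 := fun x hx =>
    η.zero_of_le_dist (by simpa using hx)
  have hηs : ContDiff ℝ (⊤ : ℕ∞) (fun x : Rn n => η x) := η.contDiff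
  let f : Rn n → ℂ := fun x => ((η x : ℝ) : ℂ)
  let g : Rn n → ℂ := fun x => ((η x - η ((2:ℝ) • x) : ℝ) : ℂ)
  have hfs : ContDiff ℝ (⊤ : ℕ∞) f := Complex.ofRealCLM.contDiff.comp hηs
  have hgs : ContDiff ℝ (⊤ : ℕ∞) g :=
    Complex.ofRealCLM.contDiff.comp (hηs.sub (hηs.comp (contDiff_const_smul (2:ℝ))))
  have hft : tsupport f ⊆ closedBall 0 (9 / 5 * ε') := by
    refine closure_minimal (fun x hx => ?_) isClosed_closedBall
    by_contra hh
    rw [mem_closedBall_zero_iff, not_le] at hh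
    exact hx (by simp [f, h0 x hh.le])
  have hgt : tsupport g ⊆ {x | 3 / 5 * ε' ≤ ‖x‖} ∩ closedBall 0 (9 / 5 * ε') := by
    refine closure_minimal (fun x hx => ?_)
      ((isClosed_le continuous_const continuous_norm).inter isClosed_closedBall)
    have h2 : ‖(2:ℝ) • x‖ = 2 * ‖x‖ := by rw [norm_smul]; norm_num
    constructor
    · by_contra hh
      simp only [mem_ofPred_eq, not_le] at hh
      exact hx (by simp [g, h1 x (by linarith), h1 ((2:ℝ) • x) (by rw [h2]; linarith)])
    · by_contra hh
      rw [mem_closedBall_zero_iff, not_le] at hh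
      exact hx (by simp [g, h0 x hh.le,
        h0 ((2:ℝ) • x) (by rw [h2]; linarith [norm_nonneg x])])
  have hfc : HasCompactSupport f :=
    (isCompact_closedBall (0 : Rn n) (9 / 5 * ε')).of_isClosed_subset (isClosed_tsupport f) hft
  have hgc : HasCompactSupport g :=
    (isCompact_closedBall (0 : Rn n) (9 / 5 * ε')).of_isClosed_subset (isClosed_tsupport g)
      (hgt.trans inter_subset_right)
  obtain ⟨Λ, hΛ, hΛs⟩ := exists_div_sch f hfs hfc Φ (fun x hx => by
    have := hft hx
    rw [mem_closedBall_zero_iff] at this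
    exact norm_pos_iff.1 (hΦ x (by linarith)))
  obtain ⟨lam, hl, hls⟩ := exists_div_sch g hgs hgc φ (fun x hx => by
    have := hgt hx
    rw [mem_inter_iff, mem_closedBall_zero_iff, mem_ofPred_eq] at this
    exact norm_pos_iff.1 (hφ x (by linarith) (by linarith)))
  refine ⟨Λ, lam, fun x hx => ?_, fun x hx => ?_, fun x => ?_⟩
  · have := hft (subset_tsupport f (hΛs x hx))
    rw [mem_closedBall_zero_iff] at this
    simp only [mem_ofPred_eq]
    linarith
  · have := hgt (subset_tsupport g (hls x hx))
    rw [mem_inter_iff, mem_closedBall_zero_iff, mem_ofPred_eq] at this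
    exact ⟨by linarith, by linarith⟩
  · simp only [hΛ, hl]
    let u : ℕ → ℂ := fun j => f (((2:ℝ) ^ (-(j:ℝ))) • x)
    have hu : ∀ j : ℕ, g (((2 : ℝ) ^ (-((j : ℝ) + 1))) • x) = u (j + 1) - u j := by
      intro j
      have h2 : (2:ℝ) * (2 : ℝ) ^ (-((j : ℝ) + 1)) = (2:ℝ) ^ (-(j:ℝ)) := by
        rw [neg_add, Real.rpow_add two_pos, Real.rpow_neg_one]
        ring
      simp only [g, u, f, smul_smul, h2]
      push_cast
      rfl
    obtain ⟨N, hN⟩ := pow_unbounded_of_one_lt (‖x‖ / (6 / 5 * ε')) (one_lt_two (α := ℝ))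
    have hu1 : ∀ j : ℕ, N ≤ j → u j = 1 := by
      intro j hj
      have : ‖((2:ℝ) ^ (-(j:ℝ))) • x‖ ≤ 6 / 5 * ε' := by
        rw [norm_smul, Real.rpow_neg two_pos.le, Real.rpow_natCast, norm_inv, norm_pow,
          Real.norm_ofNat, inv_mul_le_iff₀ (by positivity)]
        rw [div_lt_iff₀ hr] at hN
        have h3 : (2:ℝ) ^ N ≤ 2 ^ j := pow_le_pow_right₀ one_le_two hj
        nlinarith
      simp only [u, f, h1 _ this, Complex.ofReal_one]
    simp only [hu]
    rw [tsum_eq_sum (s := Finset.range N), Finset.sum_range_sub, hu1 N le_rfl]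
    · simp [u]
    · intro j hj
      rw [Finset.mem_range, not_lt] at hj
      rw [hu1 j hj, hu1 (j + 1) (by omega), sub_self]

end
end
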